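/- (Compactness in the negligible-fusion regime.) Let K be a continuous, symmetric coagulation kernel satisfying the power-law bounds with exponents α, β, and let r be an admissible fusion kernel with μ > 0. Let f_in be a nonnegative Radon measure on (0,∞)² supported in {a ≥ c₀ v^{2/3}} with ∫ (v^{−μ−2} + v^{μ+2} + v^{σ(μ+2)} + a^{μ+2}) df_in < ∞, and T > 0. Then for every ε ∈ (0,1) there exists a weak solution f_ε of the fusion–coagulation problem with fusion coefficient ε, and these satisfy the uniform-in-time, uniform-in-ε equicontinuity estimate: for every φ ∈ C¹_c((0,∞)²) there is C > 0 independent of ε with |∫ φ df_ε(t) − ∫ φ df_ε(s)| ≤ C(‖φ‖_∞ + ‖∂_a φ‖_∞) |t − s| for all s,t ∈ [0,T]; consequently there exist a sequence ε_n → 0 and f̲ ∈ C([0,T]; 𝓜^I₊) with f_{ε_n}(t) → f̲(t) in the weak-* topology for every t ∈ [0,T]. -/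

import Mathlib

open MeasureTheory Real Set Filter Topology
open scoped ENNReal

noncomputable section

/-- `c₀ = (36π)^(1/3)`, the isoperimetric constant relating area and volume of a ball. -/
def c0 : ℝ := (36 * Real.pi) ^ ((1 : ℝ) / 3)

/-- The open quadrant `(0,∞)²` of pairs `(a,v)` (surface area, volume). -/
def Quad : Set (ℝ × ℝ) := {p | 0 < p.1 ∧ 0 < p.2}

/-- The isoperimetric region `{(a,v) : v > 0, a ≥ c₀ v^(2/3)}`. -/
def IsoRegion : Set (ℝ × ℝ) := {p | 0 < p.2 ∧ c0 * p.2 ^ ((2 : ℝ) / 3) ≤ p.1}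

/-- A nonnegative (Radon) measure on `(0,∞)²` supported in `{a ≥ c₀ v^(2/3)}`:
it gives zero mass to the complement of the isoperimetric region. -/
def IsIsoMeasure (m : Measure (ℝ × ℝ)) : Prop := m IsoRegionᶜ = 0

/-- `C₀((0,∞)²)`: continuous functions vanishing at infinity of the open quadrant
(extended by zero outside the quadrant). -/
def IsC0Quad (φ : ℝ × ℝ → ℝ) : Prop :=
  Continuous φ ∧ (∀ p, p ∉ Quad → φ p = 0) ∧
    ∀ δ > 0, ∃ Kc : Set (ℝ × ℝ), IsCompact Kc ∧ Kc ⊆ Quad ∧ ∀ p ∉ Kc, |φ p| ≤ δ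

/-- `C_c((0,∞)²)`: continuous functions with compact support contained in the quadrant. -/
def IsCcQuad (φ : ℝ × ℝ → ℝ) : Prop :=
  Continuous φ ∧ HasCompactSupport φ ∧ tsupport φ ⊆ Quad

/-- `C₀((0,∞))`: continuous functions on `(0,∞)` vanishing at infinity (extended by zero). -/
def IsC0Pos (φ : ℝ → ℝ) : Prop :=
  Continuous φ ∧ (∀ v, v ∉ Ioi (0 : ℝ) → φ v = 0) ∧
    ∀ δ > 0, ∃ Kc : Set ℝ, IsCompact Kc ∧ Kc ⊆ Ioi (0 : ℝ) ∧ ∀ v ∉ Kc, |φ v| ≤ δ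

/-- `C_c((0,∞))`: continuous functions with compact support contained in `(0,∞)`. -/
def IsCcPos (φ : ℝ → ℝ) : Prop :=
  Continuous φ ∧ HasCompactSupport φ ∧ tsupport φ ⊆ Ioi (0 : ℝ)

/-- Partial derivative in the area variable `a`. -/
def da (φ : ℝ × ℝ → ℝ) (p : ℝ × ℝ) : ℝ := deriv (fun a => φ (a, p.2)) p.1

/-- Time-dependent test functions `φ ∈ C¹_c([0,∞); C¹_c((0,∞)²))`. -/
def IsTestFun (ψ : ℝ × (ℝ × ℝ) → ℝ) : Prop :=
  ContDiff ℝ 1 ψ ∧ HasCompactSupport ψ ∧ ∀ q : ℝ × (ℝ × ℝ), q.2 ∉ Quad → ψ q = 0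

/-- The assumptions on the coagulation kernel `K`: continuity, symmetry, and the
two-sided power law bounds with constants `K₀ ≥ K₁ > 0` and exponents
`al > 0`, `be ∈ (0,1)`, `be - al ∈ (0,1)`. -/
structure IsCoagKernel (K : ℝ × ℝ → ℝ × ℝ → ℝ) (K₀ K₁ al be : ℝ) : Prop where
  cont : ContinuousOn (fun q : (ℝ × ℝ) × (ℝ × ℝ) => K q.1 q.2) (Quad ×ˢ Quad)
  symm : ∀ η η', K η η' = K η' η
  K1_pos : 0 < K₁
  K1_le_K0 : K₁ ≤ K₀
  al_pos : 0 < al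
  be_mem : be ∈ Ioo (0 : ℝ) 1
  be_sub_al_mem : be - al ∈ Ioo (0 : ℝ) 1
  lower : ∀ η ∈ Quad, ∀ η' ∈ Quad,
    K₁ * (η.2 ^ (-al) * η'.2 ^ be + η'.2 ^ (-al) * η.2 ^ be) ≤ K η η'
  upper : ∀ η ∈ Quad, ∀ η' ∈ Quad,
    K η η' ≤ K₀ * (η.2 ^ (-al) * η'.2 ^ be + η'.2 ^ (-al) * η.2 ^ be)

/-- The assumptions on an admissible fusion kernel `r`: positivity, `C¹` regularity,
two-sided power law bounds `R₀ a^mu v^sg ≤ r ≤ R₁ a^mu v^sg`, and the structural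
differential inequalities on the isoperimetric region. -/
structure IsFusionKernel (r : ℝ × ℝ → ℝ) (R₀ R₁ mu sg B : ℝ) : Prop where
  smooth : ContDiffOn ℝ 1 r Quad
  pos : ∀ η ∈ Quad, 0 < r η
  R0_pos : 0 < R₀
  R1_pos : 0 < R₁
  B_pos : 0 < B
  lower : ∀ η ∈ Quad, R₀ * η.1 ^ mu * η.2 ^ sg ≤ r η
  upper : ∀ η ∈ Quad, r η ≤ R₁ * η.1 ^ mu * η.2 ^ sg
  cond_pos : 0 < mu → ∀ η ∈ IsoRegion, 0 ≤ da r η - mu * η.1⁻¹ * r η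
  cond_nonpos : mu ≤ 0 → ∀ η ∈ IsoRegion,
    0 ≤ da r η * (η.1 - c0 * η.2 ^ ((2 : ℝ) / 3)) + r η
  cond_upper : ∀ η ∈ IsoRegion, da r η ≤ B * η.1⁻¹ * r η

/-- The weak identity at time `t` against the test function `ψ`, for the
fusion–coagulation equation with fusion coefficient `c` (the `Λ`-fusion problem
corresponds to `c = Λ⁻¹`). -/
def WeakIdentity (K : ℝ × ℝ → ℝ × ℝ → ℝ) (r : ℝ × ℝ → ℝ) (c : ℝ)
    (fin : Measure (ℝ × ℝ)) (f : ℝ → Measure (ℝ × ℝ))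
    (ψ : ℝ × (ℝ × ℝ) → ℝ) (t : ℝ) : Prop :=
  (∫ η, ψ (t, η) ∂(f t)) - (∫ η, ψ (0, η) ∂fin)
      - ∫ s in (0 : ℝ)..t, ∫ η, deriv (fun u => ψ (u, η)) s ∂(f s)
    = (∫ s in (0 : ℝ)..t, (1 / 2) *
        ∫ η, ∫ η', K η η' * (ψ (s, η + η') - ψ (s, η) - ψ (s, η')) ∂(f s) ∂(f s))
      + c * ∫ s in (0 : ℝ)..t,
          ∫ η, r η * (c0 * η.2 ^ ((2 : ℝ) / 3) - η.1) * da (fun p => ψ (s, p)) η ∂(f s)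

/-- A weak solution of the fusion–coagulation problem with fusion coefficient `c`
(power-law exponents `al`, `be` of the coagulation kernel enter the a priori moment
bound), initial datum `fin`: a weak-* continuous family of measures supported in the
isoperimetric region, with locally uniformly bounded `(v^(-al) + v^be)`-moments,
satisfying the weak identity for all test functions and times. -/
def IsWeakSolution (K : ℝ × ℝ → ℝ × ℝ → ℝ) (r : ℝ × ℝ → ℝ) (c al be : ℝ)
    (fin : Measure (ℝ × ℝ)) (f : ℝ → Measure (ℝ × ℝ)) : Prop :=
  (∀ t, 0 ≤ t → IsIsoMeasure (f t)) ∧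
  (∀ φ, IsC0Quad φ → ContinuousOn (fun t => ∫ η, φ η ∂(f t)) (Ici (0 : ℝ))) ∧
  (∀ T > (0 : ℝ), ∃ C : ℝ≥0∞, C ≠ ⊤ ∧ ∀ t ∈ Icc (0 : ℝ) T,
      (∫⁻ η, ENNReal.ofReal (η.2 ^ (-al) + η.2 ^ be) ∂(f t)) ≤ C) ∧
  (∀ ψ, IsTestFun ψ → ∀ t, 0 ≤ t → WeakIdentity K r c fin f ψ t)

/-- The regularized fusion kernel `r̄_ε(a,v) = r(a,v)/(1 + ε^(2μ+2) a^μ)`. -/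
def rbarFn (r : ℝ × ℝ → ℝ) (mu ε : ℝ) (η : ℝ × ℝ) : ℝ :=
  r η / (1 + ε ^ (2 * mu + 2) * η.1 ^ mu)

end

open scoped NNReal BoundedContinuousFunction
set_option linter.unusedSectionVars false

/-- A continuous weight `Ω ≥ 1` with compact sublevel sets. -/
structure IsProperWeight {E : Type*} [TopologicalSpace E] (Ω : E → ℝ) : Prop where
  continuous : Continuous Ω
  one_le : ∀ x, 1 ≤ Ω x
  isCompact_le : ∀ L, IsCompact {x | Ω x ≤ L}

theorem IsProperWeight.prod {E F : Type*} [TopologicalSpace E] [TopologicalSpace F]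
    {Ω : E → ℝ} {Ω' : F → ℝ} (h : IsProperWeight Ω) (h' : IsProperWeight Ω') :
    IsProperWeight (fun p : E × F => Ω p.1 * Ω' p.2) where
  continuous := (h.continuous.comp continuous_fst).mul (h'.continuous.comp continuous_snd)
  one_le p := one_le_mul_of_one_le_of_one_le (h.one_le _) (h'.one_le _)
  isCompact_le L := by
    refine ((h.isCompact_le L).prod (h'.isCompact_le L)).of_isClosed_subset ?_ ?_
    · exact isClosed_le ((h.continuous.comp continuous_fst).mul
        (h'.continuous.comp continuous_snd)) continuous_const
    · rintro ⟨x, y⟩ (hp : Ω x * Ω' y ≤ L)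
      have h1 := h.one_le x
      have h2 := h'.one_le y
      exact ⟨show Ω x ≤ L by nlinarith, show Ω' y ≤ L by nlinarith⟩

/-- Finite measures whose `Ω`-moment is at most `C`. -/
def momentSet {E : Type*} [MeasurableSpace E] (Ω : E → ℝ) (C : ℝ≥0) : Set (FiniteMeasure E) :=
  {μ | ∫⁻ x, ENNReal.ofReal (Ω x) ∂(μ : Measure E) ≤ C}

theorem mem_momentSet {E : Type*} [MeasurableSpace E] {Ω : E → ℝ} {C : ℝ≥0} {μ : FiniteMeasure E} :
    μ ∈ momentSet Ω C ↔ ∫⁻ x, ENNReal.ofReal (Ω x) ∂(μ : Measure E) ≤ C := Iff.rfl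

theorem momentSet_mono {E : Type*} [MeasurableSpace E] (Ω : E → ℝ) {C C' : ℝ≥0} (h : C ≤ C') :
    momentSet Ω C ⊆ momentSet Ω C' :=
  fun _ hμ => le_trans (mem_momentSet.1 hμ) (by exact_mod_cast h)


section MomentSet

variable {E : Type*} [TopologicalSpace E] [MeasurableSpace E] [BorelSpace E] {Ω : E → ℝ} {C : ℝ≥0}

theorem IsProperWeight.integrable (hΩ : IsProperWeight Ω) {μ : FiniteMeasure E}
    (hμ : μ ∈ momentSet Ω C) : Integrable Ω (μ : Measure E) := by
  refine ⟨hΩ.continuous.measurable.aestronglyMeasurable, ?_⟩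
  rw [hasFiniteIntegral_iff_ofReal (ae_of_all _ fun x => zero_le_one.trans (hΩ.one_le x))]
  exact lt_of_le_of_lt hμ ENNReal.coe_lt_top

theorem IsProperWeight.integral_le (hΩ : IsProperWeight Ω) {μ : FiniteMeasure E}
    (hμ : μ ∈ momentSet Ω C) : ∫ x, Ω x ∂(μ : Measure E) ≤ C := by
  rw [integral_eq_lintegral_of_nonneg_ae (ae_of_all _ fun x => zero_le_one.trans (hΩ.one_le x))
    hΩ.continuous.measurable.aestronglyMeasurable]
  exact ENNReal.toReal_le_of_le_ofReal C.2 (by simpa using! hμ)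

theorem IsProperWeight.mass_le (hΩ : IsProperWeight Ω) {μ : FiniteMeasure E}
    (hμ : μ ∈ momentSet Ω C) : μ.mass ≤ C := by
  have : (μ : Measure E) univ ≤ C := by
    refine le_trans ?_ (show ∫⁻ x, ENNReal.ofReal (Ω x) ∂(μ : Measure E) ≤ C from hμ)
    rw [← lintegral_one]
    exact lintegral_mono fun x => by simpa using hΩ.one_le x
  rw [← FiniteMeasure.ennreal_mass] at this
  exact_mod_cast this

theorem IsProperWeight.isClosed_momentSet (hΩ : IsProperWeight Ω) (C : ℝ≥0) :
    IsClosed (momentSet Ω C : Set (FiniteMeasure E)) := by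
  let g (n : ℕ) : E →ᵇ ℝ≥0 := BoundedContinuousFunction.mkOfBound
    ⟨fun x => min (Ω x).toNNReal n,
      (continuous_real_toNNReal.comp hΩ.continuous).min continuous_const⟩ n
    (fun x y => by
      rw [NNReal.dist_eq, abs_le]
      have hx : ((min (Ω x).toNNReal (n : ℝ≥0) : ℝ≥0) : ℝ) ≤ n := by
        exact_mod_cast min_le_right (Ω x).toNNReal (n : ℝ≥0)
      have hy : ((min (Ω y).toNNReal (n : ℝ≥0) : ℝ≥0) : ℝ) ≤ n := by
        exact_mod_cast min_le_right (Ω y).toNNReal (n : ℝ≥0)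
      have hx0 := (min (Ω x).toNNReal (n : ℝ≥0)).2
      have hy0 := (min (Ω y).toNNReal (n : ℝ≥0)).2
      constructor
      · simp only [ContinuousMap.coe_mk]; simp only [NNReal.val_eq_coe] at hx0 hy0; linarith
      · simp only [ContinuousMap.coe_mk]; simp only [NNReal.val_eq_coe] at hx0 hy0; linarith)
  have hg (n : ℕ) (x : E) : ((g n x : ℝ≥0) : ℝ≥0∞) = min (ENNReal.ofReal (Ω x)) n := by
    change ((min (Ω x).toNNReal (n : ℝ≥0) : ℝ≥0) : ℝ≥0∞) = _
    rw [ENNReal.coe_min, ENNReal.coe_natCast]; rfl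
  have key : (momentSet Ω C : Set (FiniteMeasure E)) =
      ⋂ n : ℕ, {μ : FiniteMeasure E | ∫⁻ x, g n x ∂(μ : Measure E) ≤ C} := by
    ext μ
    simp only [momentSet, mem_ofPred_eq, mem_iInter]
    have hsup : ∀ x, ENNReal.ofReal (Ω x) = ⨆ n : ℕ, ((g n x : ℝ≥0) : ℝ≥0∞) := by
      intro x
      simp only [hg]
      refine le_antisymm ?_ (iSup_le fun n => min_le_left _ _)
      obtain ⟨n, hn⟩ := exists_nat_ge (Ω x)
      refine le_iSup_of_le n ?_
      rw [min_eq_left]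
      rw [← ENNReal.ofReal_natCast]; exact ENNReal.ofReal_le_ofReal hn
    have : ∫⁻ x, ENNReal.ofReal (Ω x) ∂(μ : Measure E)
        = ⨆ n : ℕ, ∫⁻ x, g n x ∂(μ : Measure E) := by
      simp_rw [hsup]
      refine lintegral_iSup (fun n => (g n).continuous.measurable.coe_nnreal_ennreal) ?_
      intro m n hmn x
      simp only [hg]
      gcongr
    rw [this, iSup_le_iff]
  rw [key]
  refine isClosed_iInter fun n => isClosed_le ?_ continuous_const
  exact FiniteMeasure.continuous_lintegral_boundedContinuousFunction (g n)

theorem IsProperWeight.isCompact_momentSet [T2Space E] (hΩ : IsProperWeight Ω) (C : ℝ≥0) :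
    IsCompact (momentSet Ω C : Set (FiniteMeasure E)) := by
  have hu : Tendsto (fun n : ℕ => C / ((n : ℝ≥0) + 1)) atTop (𝓝 0) := by
    rw [← NNReal.tendsto_coe]
    push_cast
    simpa [div_eq_mul_inv] using
      (tendsto_one_div_add_atTop_nhds_zero_nat (𝕜 := ℝ)).const_mul (C : ℝ)
  refine (isCompact_setOfPred_finiteMeasure_mass_le_compl_isCompact_le (E := E)
    (K := fun n : ℕ => {x | Ω x ≤ (n : ℝ) + 1}) C hu
    (fun n => hΩ.isCompact_le _) (Or.inr ?_)).of_isClosed_subset (hΩ.isClosed_momentSet C) ?_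
  · intro m n hmn x hx
    have : (m : ℝ) ≤ n := by exact_mod_cast hmn
    simp only [mem_ofPred_eq] at hx ⊢
    linarith
  · intro μ hμ
    refine ⟨hΩ.mass_le hμ, fun n => ?_⟩
    have h1 : (μ : Measure E) {x | Ω x ≤ (n : ℝ) + 1}ᶜ * ((n : ℝ≥0∞) + 1) ≤ C := by
      refine le_trans ?_ (show ∫⁻ x, ENNReal.ofReal (Ω x) ∂(μ : Measure E) ≤ C from hμ)
      refine le_trans ?_ (mul_meas_ge_le_lintegral
        (hΩ.continuous.measurable.ennreal_ofReal) ((n : ℝ≥0∞) + 1))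
      rw [mul_comm]
      gcongr
      intro x hx
      simp only [mem_compl_iff, mem_ofPred_eq, not_le] at hx ⊢
      rw [ENNReal.le_ofReal_iff_toReal_le (by simp) (by linarith [hΩ.one_le x])]
      · rw [ENNReal.toReal_add (by simp) (by simp)]; simpa using hx.le
    have h2 : (μ : Measure E) {x | Ω x ≤ (n : ℝ) + 1}ᶜ ≤ ((C / ((n : ℝ≥0) + 1) : ℝ≥0) : ℝ≥0∞) := by
      rw [ENNReal.coe_div (by positivity)]
      rw [ENNReal.le_div_iff_mul_le (by simp) (by simp)]
      simpa using h1
    rw [← FiniteMeasure.ennreal_coeFn_eq_coeFn_toMeasure] at h2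
    exact_mod_cast h2

/-- Weak convergence with a uniform moment bound, tested against locally uniformly convergent
integrands that are uniformly small compared to the weight. -/
theorem IsProperWeight.tendsto_integral (hΩ : IsProperWeight Ω) {ι : Type*} {l : Filter ι}
    [l.NeBot] {μ : ι → FiniteMeasure E} {μ₀ : FiniteMeasure E} (hμ : ∀ i, μ i ∈ momentSet Ω C)
    (hlim : Tendsto μ l (𝓝 μ₀)) {G : ι → C(E, ℝ)} {G₀ : C(E, ℝ)} (hG : Tendsto G l (𝓝 G₀)) {M : ℝ}
    (hM : ∀ i x, G i x ^ 2 ≤ M * Ω x) :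
    Tendsto (fun i => ∫ x, G i x ∂(μ i : Measure E)) l (𝓝 (∫ x, G₀ x ∂(μ₀ : Measure E))) := by
  have hM0 : ∀ x, G₀ x ^ 2 ≤ M * Ω x := fun x =>
    le_of_tendsto (((continuous_eval_const (F := C(E, ℝ)) x).tendsto G₀ |>.comp hG).pow 2)
      (Eventually.of_forall fun i => hM i x)
  have hμ₀ : μ₀ ∈ momentSet Ω C :=
    (hΩ.isClosed_momentSet C).mem_of_tendsto hlim (Eventually.of_forall hμ)
  rcases isEmpty_or_nonempty E with hE | ⟨⟨x₀⟩⟩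
  · simp [Measure.eq_zero_of_isEmpty]
  have hMpos : 0 ≤ M := by
    have := (sq_nonneg _).trans (hM0 x₀)
    exact nonneg_of_mul_nonneg_left this (zero_lt_one.trans_le (hΩ.one_le x₀))
  have habs : ∀ {k g : ℝ}, 0 < k → |g| ≤ g ^ 2 / k + k := by
    intro k g hk
    rw [← sq_abs]
    have : |g| ^ 2 / k + k - |g| = ((|g| - k) ^ 2 + |g| * k) / k := by field_simp; ring
    have : 0 ≤ |g| ^ 2 / k + k - |g| := by rw [this]; positivity
    linarith
  rw [Metric.tendsto_nhds]
  intro e he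
  have hC : (0 : ℝ) ≤ C := C.2
  obtain ⟨k, hk0, hk⟩ : ∃ k : ℝ, 0 < k ∧ (4 * M + 2) * C / k < e / 3 := by
    refine ⟨(4 * M + 2) * C * 3 / e + 1, by positivity, ?_⟩
    rw [div_lt_iff₀ (by positivity)]
    have : e / 3 * ((4 * M + 2) * C * 3 / e + 1) = (4 * M + 2) * C + e / 3 := by field_simp
    rw [this]; linarith
  set δ : ℝ := e / (3 * (C + 1)) with hδ
  have hδ0 : 0 < δ := by positivity
  have hδC : δ * C < e / 3 := by
    rw [hδ, div_mul_eq_mul_div, div_lt_div_iff₀ (by positivity) (by norm_num)]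
    nlinarith
  let cl : E →ᵇ ℝ := BoundedContinuousFunction.ofNormedAddCommGroup
    (fun x => max (-k) (min (G₀ x) k)) (by fun_prop) k (fun x => by
      rw [Real.norm_eq_abs, abs_le]
      exact ⟨le_max_left _ _, max_le (by linarith) (min_le_right _ _)⟩)
  have hcl : ∀ x, |G₀ x - cl x| ≤ M / k * Ω x := by
    intro x
    have hx := hM0 x
    change |G₀ x - max (-k) (min (G₀ x) k)| ≤ _
    have h1 : |G₀ x - max (-k) (min (G₀ x) k)| ≤ G₀ x ^ 2 / k := by
      rw [le_div_iff₀ hk0]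
      rcases le_total (G₀ x) k with h | h
      · rw [min_eq_left h]
        rcases le_total (-k) (G₀ x) with h' | h'
        · rw [max_eq_right h']; simp; positivity
        · rw [max_eq_left h', abs_of_nonpos (by linarith)]; nlinarith
      · rw [min_eq_right h, max_eq_right (by linarith), abs_of_nonneg (by linarith)]; nlinarith
    calc _ ≤ G₀ x ^ 2 / k := h1
      _ ≤ M * Ω x / k := by gcongr
      _ = _ := by ring
  have hunif := (ContinuousMap.tendsto_iff_forall_isCompact_tendstoUniformlyOn.1 hG)
    {x | Ω x ≤ k ^ 2} (hΩ.isCompact_le _)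
  have hclt : Tendsto (fun i => ∫ x, cl x ∂(μ i : Measure E)) l
      (𝓝 (∫ x, cl x ∂(μ₀ : Measure E))) :=
    FiniteMeasure.tendsto_iff_forall_integral_tendsto.1 hlim cl
  filter_upwards [Metric.tendstoUniformlyOn_iff.1 hunif δ hδ0,
    Metric.tendsto_nhds.1 hclt (e / 3) (by positivity)] with i hi hcli
  have hint : ∀ {ν : FiniteMeasure E} (_ : ν ∈ momentSet Ω C) (g : E → ℝ) (_ : Continuous g)
      (c : ℝ) (_ : ∀ x, |g x| ≤ c * Ω x), Integrable g (ν : Measure E) :=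
    fun hν g hg c hc => ((hΩ.integrable hν).const_mul c).mono' hg.measurable.aestronglyMeasurable
      (ae_of_all _ fun x => (Real.norm_eq_abs _).trans_le (hc x))
  have hle : ∀ {ν : FiniteMeasure E} (_ : ν ∈ momentSet Ω C) (g : E → ℝ)
      (c : ℝ) (_ : 0 ≤ c) (_ : ∀ x, |g x| ≤ c * Ω x), |∫ x, g x ∂(ν : Measure E)| ≤ c * C := by
    intro ν hν g c hc0 hc
    refine (norm_integral_le_of_norm_le ((hΩ.integrable hν).const_mul c)
      (ae_of_all _ fun x => (Real.norm_eq_abs _).trans_le (hc x))).trans ?_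
    rw [integral_const_mul]
    exact mul_le_mul_of_nonneg_left (hΩ.integral_le hν) hc0
  have hsq : ∀ g x, g ^ 2 ≤ M * Ω x → |g| ≤ (M + 1) * Ω x := by
    intro g x hg
    have := habs (k := 1) (g := g) one_pos
    have := hΩ.one_le x
    rw [div_one] at *
    nlinarith
  have hdiff : ∀ x, |G i x - G₀ x| ≤ (δ + 2 * (M + 1) / k) * Ω x := by
    intro x
    have h1 := hΩ.one_le x
    have hp : 0 ≤ 2 * (M + 1) / k := by positivity
    by_cases hx : Ω x ≤ k ^ 2
    · have := hi x hx
      rw [dist_comm, Real.dist_eq] at this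
      nlinarith
    · push Not at hx
      have hk' : k ≤ Ω x / k := by rw [le_div_iff₀ hk0]; nlinarith
      have e1 := habs (g := G i x) hk0
      have e2 := habs (g := G₀ x) hk0
      have e3 : G i x ^ 2 / k ≤ M * Ω x / k := by gcongr; exact hM i x
      have e4 : G₀ x ^ 2 / k ≤ M * Ω x / k := by gcongr; exact hM0 x
      have e5 := abs_sub (G i x) (G₀ x)
      have e6 : (δ + 2 * (M + 1) / k) * Ω x = δ * Ω x + 2 * (M * Ω x / k + Ω x / k) := by
        field_simp
      have : 0 ≤ δ * Ω x := by positivity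
      linarith
  have i1 := hint (hμ i) (G i) (G i).continuous _ (fun x => hsq _ x (hM i x))
  have i2 := hint (hμ i) G₀ G₀.continuous _ (fun x => hsq _ x (hM0 x))
  have i3 := hint hμ₀ G₀ G₀.continuous _ (fun x => hsq _ x (hM0 x))
  have i4 := cl.integrable (μ i : Measure E)
  have i5 := cl.integrable (μ₀ : Measure E)
  have b1 := hle (hμ i) (fun x => G i x - G₀ x) _ (by positivity) hdiff
  have b2 := hle (hμ i) (fun x => G₀ x - cl x) _ (by positivity) hcl
  have b3 := hle hμ₀ (fun x => G₀ x - cl x) _ (by positivity) hcl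
  rw [integral_sub i1 i2] at b1
  rw [integral_sub i2 i4] at b2
  rw [integral_sub i3 i5] at b3
  rw [Real.dist_eq] at hcli ⊢
  have hsum : (δ + 2 * (M + 1) / k) * C + M / k * C + M / k * C
      = δ * C + (4 * M + 2) * C / k := by ring
  rw [abs_lt] at hcli ⊢
  rw [abs_le] at b1 b2 b3
  constructor <;> linarith [b1.1, b1.2, b2.1, b2.2, b3.1, b3.2, hcli.1, hcli.2]

end MomentSet

/-- Compactness for asymptotically equicontinuous families of curves, tested against a countable
point-separating family of observables. -/
theorem exists_subseq_tendsto_of_equicontinuous {Y ι : Type*} [TopologicalSpace Y]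
    [Countable ι] {ℓ : ι → Y → ℝ} (hℓ : ∀ i, Continuous (ℓ i))
    (hsep : ∀ x y, (∀ i, ℓ i x = ℓ i y) → x = y) {S : ℝ → Set Y} (hS : ∀ t, IsCompact (S t))
    {F : ℕ → ℝ → Y} (hF : ∀ n t, F n t ∈ S t)
    (heq : ∀ i t, ∀ e > 0, ∃ δ > 0, ∀ s, |s - t| < δ →
      ∀ᶠ n in atTop, |ℓ i (F n s) - ℓ i (F n t)| ≤ e) :
    ∃ φ : ℕ → ℕ, StrictMono φ ∧ ∃ f : ℝ → Y, ∀ t, f t ∈ S t ∧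
      Tendsto (fun k => F (φ k) t) atTop (𝓝 (f t)) := by
  let u : ℕ → (ℚ × ι → ℝ) := fun n p => ℓ p.2 (F n p.1)
  have hcomp : IsCompact (Set.pi univ fun p : ℚ × ι => ℓ p.2 '' S p.1) :=
    isCompact_univ_pi fun p => (hS _).image (hℓ _)
  obtain ⟨a, -, φ, hφ, ha⟩ := hcomp.tendsto_subseq (x := u)
    (fun n p _ => mem_image_of_mem _ (hF n _))
  refine ⟨φ, hφ, ?_⟩
  have hcau : ∀ t i, ∃ L, Tendsto (fun k => ℓ i (F (φ k) t)) atTop (𝓝 L) := by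
    intro t i
    apply cauchySeq_tendsto_of_complete
    rw [Metric.cauchySeq_iff']
    intro e he
    obtain ⟨δ, hδ, h⟩ := heq i t (e / 8) (by positivity)
    obtain ⟨q, hq1, hq2⟩ := exists_rat_btwn (show t < t + δ by linarith)
    have h1 := hφ.tendsto_atTop.eventually (h q (by rw [abs_lt]; constructor <;> linarith))
    have h2 : Tendsto (fun k => ℓ i (F (φ k) q)) atTop (𝓝 (a (q, i))) :=
      (tendsto_pi_nhds.1 ha (q, i))
    have h3 := Metric.tendsto_nhds.1 h2 (e / 8) (by positivity)
    obtain ⟨N, hN⟩ := eventually_atTop.1 (h1.and h3)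
    refine ⟨N, fun n hn => ?_⟩
    obtain ⟨a1, a2⟩ := hN n hn
    obtain ⟨b1, b2⟩ := hN N le_rfl
    rw [Real.dist_eq, abs_lt] at *
    rw [abs_le] at a1 b1
    constructor <;> linarith
  have hlim : ∀ t, ∃ y ∈ S t, Tendsto (fun k => F (φ k) t) atTop (𝓝 y) := by
    intro t
    obtain ⟨y, hy, hyc⟩ := (hS t).exists_mapClusterPt (f := atTop) (u := fun k => F (φ k) t)
      (tendsto_principal.2 (Eventually.of_forall fun k => hF (φ k) t))
    refine ⟨y, hy, (hS t).tendsto_nhds_of_unique_mapClusterPt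
      (Eventually.of_forall fun k => hF (φ k) t) fun z _ hzc => ?_⟩
    refine hsep _ _ fun i => ?_
    obtain ⟨L, hL⟩ := hcau t i
    have key : ∀ w, MapClusterPt w atTop (fun k => F (φ k) t) → ℓ i w = L := by
      intro w hw
      have := hw.continuousAt_comp (hℓ i).continuousAt
      have hne : (𝓝 (ℓ i w) ⊓ 𝓝 L).NeBot := NeBot.mono this (inf_le_inf_left _ hL)
      exact eq_of_nhds_neBot hne
    rw [key z hzc, key y hyc]
  choose f hf using hlim
  exact ⟨f, hf⟩

theorem FiniteMeasure.tendsto_prod {E ι : Type*} [TopologicalSpace E] [PolishSpace E]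
    [MeasurableSpace E] [BorelSpace E] {l : Filter ι}
    {μ : ι → FiniteMeasure E} {μ₀ : FiniteMeasure E} (h : Tendsto μ l (𝓝 μ₀)) :
    Tendsto (fun i => (μ i).prod (μ i)) l (𝓝 (μ₀.prod μ₀)) := by
  by_cases h0 : μ₀ = 0
  · subst h0
    rw [FiniteMeasure.zero_prod]
    apply FiniteMeasure.tendsto_zero_of_tendsto_zero_mass
    have := h.mass
    simpa using this.mul this
  · have hne : Nonempty E := by
      by_contra hE
      rw [not_nonempty_iff] at hE
      exact h0 (Subtype.ext (Measure.eq_zero_of_isEmpty _))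
    have e : ∀ ν : FiniteMeasure E, ν.prod ν
        = (ν.mass * ν.mass) • (ν.normalize.prod ν.normalize).toFiniteMeasure := by
      intro ν
      apply Subtype.ext
      conv_lhs => rw [ν.self_eq_mass_smul_normalize]
      simp only [FiniteMeasure.val_eq_toMeasure, FiniteMeasure.toMeasure_prod,
        FiniteMeasure.toMeasure_smul,
        ProbabilityMeasure.toMeasure_comp_toFiniteMeasure_eq_toMeasure,
        ProbabilityMeasure.toMeasure_prod]
      rw [Measure.prod_smul_left, Measure.prod_smul_right, smul_smul]
    have hn := FiniteMeasure.tendsto_normalize_of_tendsto h h0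
    have hp := (ProbabilityMeasure.continuous_prod.tendsto (μ₀.normalize, μ₀.normalize)).comp
      (hn.prodMk_nhds hn)
    have hp' := (ProbabilityMeasure.tendsto_nhds_iff_toFiniteMeasure_tendsto_nhds l).1 hp
    rw [e μ₀]
    simp_rw [e]
    exact (h.mass.mul h.mass).smul hp'

theorem prod_mem_momentSet {E : Type*} [MeasurableSpace E] {Ω : E → ℝ} (hΩm : Measurable Ω)
    (hΩ : ∀ x, 1 ≤ Ω x) {C : ℝ≥0} {μ : FiniteMeasure E} (hμ : μ ∈ momentSet Ω C) :
    μ.prod μ ∈ momentSet (fun p : E × E => Ω p.1 * Ω p.2) (C * C) := by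
  rw [mem_momentSet] at *
  have : ∀ p : E × E, ENNReal.ofReal (Ω p.1 * Ω p.2)
      = ENNReal.ofReal (Ω p.1) * ENNReal.ofReal (Ω p.2) :=
    fun p => ENNReal.ofReal_mul (zero_le_one.trans (hΩ _))
  simp_rw [this]
  rw [FiniteMeasure.toMeasure_prod, lintegral_prod_mul (f := fun x => ENNReal.ofReal (Ω x))
    (g := fun x => ENNReal.ofReal (Ω x)) (by fun_prop) (by fun_prop), ENNReal.coe_mul]
  exact mul_le_mul' hμ hμ

/-- A finite measure is determined by the integrals of a family of functions built from
nonnegative functions whose supports form a basis of the topology. -/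
theorem FiniteMeasure.eq_of_integral_bump_eq {E ι : Type*} [TopologicalSpace E]
    [MeasurableSpace E] [BorelSpace E] [Countable ι] {g : ι → E → ℝ} (hg : ∀ i, Continuous (g i))
    (hg0 : ∀ i x, 0 ≤ g i x) (hg1 : ∀ i x, g i x ≤ 1)
    (hbasis : ∀ U : Set E, IsOpen U → ∀ x ∈ U, ∃ i, g i x ≠ 0 ∧ Function.support (g i) ⊆ U)
    {μ ν : FiniteMeasure E}
    (h : ∀ (F : Finset ι) (k : ℕ), ∫ x, (1 - ∏ i ∈ F, (1 - g i x) ^ k) ∂(μ : Measure E)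
      = ∫ x, (1 - ∏ i ∈ F, (1 - g i x) ^ k) ∂(ν : Measure E)) : μ = ν := by
  classical
  have hfin : ∀ F : Finset ι, (μ : Measure E) (⋃ i ∈ F, Function.support (g i))
      = (ν : Measure E) (⋃ i ∈ F, Function.support (g i)) := by
    intro F
    have hms : MeasurableSet (⋃ i ∈ F, Function.support (g i)) :=
      (isOpen_biUnion fun i _ => (hg i).isOpen_support).measurableSet
    have key : ∀ m : FiniteMeasure E, Tendsto
        (fun k : ℕ => ∫ x, (1 - ∏ i ∈ F, (1 - g i x) ^ k) ∂(m : Measure E)) atTop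
        (𝓝 ((m : Measure E).real (⋃ i ∈ F, Function.support (g i)))) := by
      intro m
      rw [← integral_indicator_one hms]
      refine tendsto_integral_of_dominated_convergence (fun _ => (1 : ℝ))
        (fun k => (by fun_prop : Continuous _).measurable.aestronglyMeasurable)
        (integrable_const _) (fun k => ae_of_all _ fun x => ?_) (ae_of_all _ fun x => ?_)
      · have a1 : 0 ≤ ∏ i ∈ F, (1 - g i x) ^ k :=
          Finset.prod_nonneg fun i _ => pow_nonneg (by linarith [hg1 i x]) _
        have a2 : ∏ i ∈ F, (1 - g i x) ^ k ≤ 1 :=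
          Finset.prod_le_one (fun i _ => pow_nonneg (by linarith [hg1 i x]) _)
            fun i _ => pow_le_one₀ (by linarith [hg1 i x]) (by linarith [hg0 i x])
        rw [Real.norm_eq_abs, abs_le]; constructor <;> linarith
      · by_cases hx : x ∈ ⋃ i ∈ F, Function.support (g i)
        · rw [indicator_of_mem hx]
          obtain ⟨i, hi, hxi⟩ := mem_iUnion₂.1 hx
          have hpos : 0 < g i x := lt_of_le_of_ne (hg0 i x) (Ne.symm hxi)
          have h0 : Tendsto (fun k : ℕ => ∏ i ∈ F, (1 - g i x) ^ k) atTop (𝓝 0) := by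
            simp_rw [Finset.prod_pow]
            refine tendsto_pow_atTop_nhds_zero_of_lt_one
              (Finset.prod_nonneg fun i _ => by linarith [hg1 i x]) ?_
            rw [← Finset.mul_prod_erase _ _ hi]
            have a1 : 0 ≤ ∏ i ∈ F.erase i, (1 - g i x) :=
              Finset.prod_nonneg fun i _ => by linarith [hg1 i x]
            have a2 : ∏ i ∈ F.erase i, (1 - g i x) ≤ 1 :=
              Finset.prod_le_one (fun i _ => by linarith [hg1 i x])
                fun i _ => by linarith [hg0 i x]
            nlinarith [hg1 i x]
          simpa using h0.const_sub 1
        · rw [indicator_of_notMem hx]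
          have : ∀ k : ℕ, (1 - ∏ i ∈ F, (1 - g i x) ^ k) = 0 := by
            intro k
            rw [Finset.prod_eq_one, sub_self]
            intro i hi
            have : g i x = 0 := by
              by_contra hne
              exact hx (mem_iUnion₂.2 ⟨i, hi, hne⟩)
            rw [this, sub_zero, one_pow]
          simp_rw [this]
          exact tendsto_const_nhds
    have := tendsto_nhds_unique (key μ) (by simpa only [h] using key ν)
    exact (measureReal_eq_measureReal_iff (measure_ne_top _ _) (measure_ne_top _ _)).1 this
  have hopen : ∀ U : Set E, IsOpen U → (μ : Measure E) U = (ν : Measure E) U := by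
    intro U hU
    let I := {i : ι // Function.support (g i) ⊆ U}
    have hUeq : U = ⋃ F : Finset I, ⋃ i ∈ F.map (Function.Embedding.subtype _),
        Function.support (g i) := by
      ext x
      constructor
      · intro hx
        obtain ⟨i, hi, hiU⟩ := hbasis U hU x hx
        exact mem_iUnion.2 ⟨{⟨i, hiU⟩}, by simpa using hi⟩
      · intro hx
        obtain ⟨F, hF⟩ := mem_iUnion.1 hx
        obtain ⟨i, hi, hxi⟩ := mem_iUnion₂.1 hF
        obtain ⟨j, -, rfl⟩ := Finset.mem_map.1 hi
        exact j.2 hxi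
    have hdir : Directed (· ⊆ ·) fun F : Finset I => ⋃ i ∈ F.map (Function.Embedding.subtype _),
        Function.support (g i) := by
      apply Monotone.directed_le
      intro F F' hFF'
      exact biUnion_subset_biUnion_left (by exact_mod_cast Finset.map_subset_map.2 hFF')
    rw [hUeq, hdir.measure_iUnion, hdir.measure_iUnion]
    simp_rw [hfin]
  apply Subtype.ext
  refine ext_of_generate_finite (μ := (μ : Measure E)) (ν := (ν : Measure E)) {s | IsOpen s} ?_
    isPiSystem_isOpen (fun U hU => hopen U hU) (hopen _ isOpen_univ)
  exact BorelSpace.measurable_eq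

section DiscreteScheme

variable {E : Type*} [MeasurableSpace E] {k : E × E → ℝ} {join : E × E → E} {T : E → E}
  {h lam κ M : ℝ} {μ : Measure E}

/-- One explicit Euler step of size `h` for binary coagulation with rate `k` and jumps
`x ↦ T x` with rate `lam`. -/
noncomputable def coagStep (k : E × E → ℝ) (join : E × E → E) (T : E → E) (h lam : ℝ)
    (μ : Measure E) : Measure E :=
  (μ.withDensity fun x => ENNReal.ofReal (1 - h * lam - h * ∫ y, k (x, y) ∂μ))
    + ENNReal.ofReal (h * lam) • μ.map T
    + ((μ.prod μ).withDensity fun p => ENNReal.ofReal (h / 2 * k p)).map join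

/-- The data of a bounded coagulation rate and of a jump rate, with a time step which keeps the
Euler scheme positive for masses at most `M`. -/
structure IsStepData (k : E × E → ℝ) (join : E × E → E) (T : E → E) (h lam κ M : ℝ) : Prop where
  meas_k : Measurable k
  meas_add : Measurable join
  meas_T : Measurable T
  symm : ∀ x y, k (x, y) = k (y, x)
  nonneg : ∀ p, 0 ≤ k p
  le : ∀ p, k p ≤ κ
  h_nonneg : 0 ≤ h
  lam_nonneg : 0 ≤ lam
  small : h * (lam + κ * M) ≤ 1

namespace IsStepData

variable (H : IsStepData k join T h lam κ M) [IsFiniteMeasure μ]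

include H

theorem integrable_section (x : E) : Integrable (fun y => k (x, y)) μ :=
  Integrable.of_bound (H.meas_k.comp measurable_prodMk_left).aestronglyMeasurable κ
    (ae_of_all _ fun y => by rw [Real.norm_eq_abs, abs_of_nonneg (H.nonneg _)]; exact H.le _)

theorem integral_section_nonneg (x : E) : 0 ≤ ∫ y, k (x, y) ∂μ :=
  integral_nonneg fun _ => H.nonneg _

theorem integral_section_le (x : E) (hM : μ.real univ ≤ M) : ∫ y, k (x, y) ∂μ ≤ κ * M := by
  have hκ : 0 ≤ κ := (H.nonneg (x, x)).trans (H.le _)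
  calc ∫ y, k (x, y) ∂μ ≤ ∫ _, κ ∂μ :=
        integral_mono (H.integrable_section x) (integrable_const _) fun y => H.le _
    _ = κ * μ.real univ := by rw [integral_const, smul_eq_mul, mul_comm]
    _ ≤ κ * M := by gcongr

theorem measurable_integral_section : Measurable fun x => ∫ y, k (x, y) ∂μ :=
  (H.meas_k.stronglyMeasurable.integral_prod_right' (ν := μ)).measurable

theorem remaining_nonneg (x : E) (hM : μ.real univ ≤ M) :
    0 ≤ 1 - h * lam - h * ∫ y, k (x, y) ∂μ := by
  have h1 := mul_le_mul_of_nonneg_left (H.integral_section_le x hM) H.h_nonneg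
  have h2 := H.small
  linarith [mul_add h lam (κ * M)]

theorem lintegral_coagStep {w : E → ℝ≥0∞} (hw : Measurable w) :
    ∫⁻ x, w x ∂(coagStep k join T h lam μ)
      = ∫⁻ x, ENNReal.ofReal (1 - h * lam - h * ∫ y, k (x, y) ∂μ) * w x ∂μ
        + ENNReal.ofReal (h * lam) * ∫⁻ x, w (T x) ∂μ
        + ∫⁻ p, ENNReal.ofReal (h / 2 * k p) * w (join p) ∂(μ.prod μ) := by
  have hk := H.meas_k
  have hs := H.measurable_integral_section (μ := μ)
  rw [coagStep, lintegral_add_measure, lintegral_add_measure, lintegral_smul_measure,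
    lintegral_map hw H.meas_T, lintegral_map hw H.meas_add,
    lintegral_withDensity_eq_lintegral_mul _ (by fun_prop) hw,
    lintegral_withDensity_eq_lintegral_mul _ (by fun_prop)
      (g := fun p => w (join p)) (hw.comp H.meas_add)]
  rfl

theorem lintegral_eq {w : E → ℝ≥0∞} (hw : Measurable w) (hM : μ.real univ ≤ M) :
    ∫⁻ x, w x ∂μ
      = ∫⁻ x, ENNReal.ofReal (1 - h * lam - h * ∫ y, k (x, y) ∂μ) * w x ∂μ
        + ENNReal.ofReal (h * lam) * ∫⁻ x, w x ∂μ
        + ∫⁻ p, ENNReal.ofReal (h / 2 * k p) * (w p.1 + w p.2) ∂(μ.prod μ) := by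
  have hk := H.meas_k
  have hs := H.measurable_integral_section (μ := μ)
  have hsec : ∀ x, ∫⁻ y, ENNReal.ofReal (h / 2 * k (x, y)) ∂μ
      = ENNReal.ofReal (h / 2 * ∫ y, k (x, y) ∂μ) := by
    intro x
    rw [← integral_const_mul, ofReal_integral_eq_lintegral_ofReal
      ((H.integrable_section x).const_mul _)
      (ae_of_all _ fun y => mul_nonneg (by linarith [H.h_nonneg]) (H.nonneg _))]
  have h1 : ∫⁻ p, ENNReal.ofReal (h / 2 * k p) * w p.1 ∂(μ.prod μ)
      = ∫⁻ x, ENNReal.ofReal (h / 2 * ∫ y, k (x, y) ∂μ) * w x ∂μ := by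
    rw [lintegral_prod _ (by fun_prop)]
    refine lintegral_congr fun x => ?_
    dsimp only
    rw [lintegral_mul_const _ (by fun_prop), hsec]
  have h2 : ∫⁻ p, ENNReal.ofReal (h / 2 * k p) * w p.2 ∂(μ.prod μ)
      = ∫⁻ p, ENNReal.ofReal (h / 2 * k p) * w p.1 ∂(μ.prod μ) := by
    conv_lhs => rw [← Measure.prod_swap, lintegral_map (by fun_prop) measurable_swap]
    refine lintegral_congr fun p => ?_
    rw [show k p.swap = k p from H.symm _ _]; rfl
  simp_rw [mul_add]
  rw [lintegral_add_left (by fun_prop), h2, h1, ← lintegral_const_mul _ hw,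
    ← lintegral_add_left (by fun_prop), ← lintegral_add_left (by fun_prop),
    ← lintegral_add_left (by fun_prop)]
  refine lintegral_congr fun x => ?_
  have e : ENNReal.ofReal (1 - h * lam - h * ∫ y, k (x, y) ∂μ) + ENNReal.ofReal (h * lam)
      + (ENNReal.ofReal (h / 2 * ∫ y, k (x, y) ∂μ) + ENNReal.ofReal (h / 2 * ∫ y, k (x, y) ∂μ))
      = 1 := by
    have a1 := H.remaining_nonneg x hM
    have a2 := mul_nonneg H.h_nonneg H.lam_nonneg
    have a3 := mul_nonneg (by linarith [H.h_nonneg] : 0 ≤ h / 2)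
      (H.integral_section_nonneg (μ := μ) x)
    rw [← ENNReal.ofReal_add a1 a2, ← ENNReal.ofReal_add a3 a3, ← ENNReal.ofReal_add (by positivity)
      (by positivity), ← ENNReal.ofReal_one]
    congr 1; ring
  calc w x = 1 * w x := (one_mul _).symm
    _ = _ := by rw [← e]; ring

theorem lintegral_coagStep_le {w : E → ℝ≥0∞} (hw : Measurable w) (hM : μ.real univ ≤ M)
    (hT : ∀ x, w (T x) ≤ w x) {R : E × E → ℝ≥0∞} (hR : Measurable R)
    (hadd : ∀ p, ENNReal.ofReal (k p) * w (join p)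
      ≤ ENNReal.ofReal (k p) * (w p.1 + w p.2) + R p) :
    ∫⁻ x, w x ∂(coagStep k join T h lam μ)
      ≤ ∫⁻ x, w x ∂μ + ENNReal.ofReal (h / 2) * ∫⁻ p, R p ∂(μ.prod μ) := by
  have hk := H.meas_k
  have hs := H.measurable_integral_section (μ := μ)
  have hh : 0 ≤ h / 2 := by linarith [H.h_nonneg]
  rw [H.lintegral_coagStep hw, H.lintegral_eq hw hM, ← lintegral_const_mul _ hR, add_assoc _ _
    (∫⁻ p, ENNReal.ofReal (h / 2) * R p ∂(μ.prod μ)), ← lintegral_add_left (by fun_prop)]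
  gcongr with x p
  · exact hT x
  · rw [ENNReal.ofReal_mul hh, mul_assoc, mul_assoc, ← mul_add]
    gcongr
    exact hadd p

theorem coagStep_univ_le (hM : μ.real univ ≤ M) :
    (coagStep k join T h lam μ) univ ≤ μ univ := by
  have := H.lintegral_coagStep_le (w := fun _ => 1) measurable_const hM (fun _ => le_rfl)
    (R := fun _ => 0) measurable_const (fun p => by rw [add_zero]; gcongr; simp)
  simpa using this

theorem integral_coagStep {φ : E → ℝ} (hφ : Measurable φ) {B : ℝ} (hB : ∀ x, |φ x| ≤ B)
    (hM : μ.real univ ≤ M) :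
    ∫ x, φ x ∂(coagStep k join T h lam μ) = ∫ x, φ x ∂μ
      + h * (1 / 2 * ∫ p, k p * (φ (join p) - φ p.1 - φ p.2) ∂(μ.prod μ)
        + ∫ x, lam * (φ (T x) - φ x) ∂μ) := by
  have hk := H.meas_k
  have hadd := H.meas_add
  have hTm := H.meas_T
  have hs := H.measurable_integral_section (μ := μ)
  have hh : 0 ≤ h / 2 := by linarith [H.h_nonneg]
  have hfin : IsFiniteMeasure (coagStep k join T h lam μ) :=
    ⟨(H.coagStep_univ_le hM).trans_lt (measure_lt_top _ _)⟩
  have hint : Integrable φ (coagStep k join T h lam μ) :=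
    Integrable.of_bound hφ.aestronglyMeasurable B (ae_of_all _ fun x => hB x)
  have hkint : ∀ g : E × E → ℝ, Measurable g → (∀ p, |g p| ≤ B) →
      Integrable (fun p => k p * g p) (μ.prod μ) := by
    intro g hg hgB
    refine Integrable.of_bound (hk.mul hg).aestronglyMeasurable (κ * B) (ae_of_all _ fun p => ?_)
    rw [norm_mul, Real.norm_eq_abs, Real.norm_eq_abs, abs_of_nonneg (H.nonneg p)]
    exact mul_le_mul (H.le p) (hgB p) (abs_nonneg _) ((H.nonneg p).trans (H.le p))
  have hφi : Integrable φ μ :=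
    Integrable.of_bound hφ.aestronglyMeasurable B (ae_of_all _ fun x => hB x)
  have hφT : Integrable (fun x => φ (T x)) μ :=
    Integrable.of_bound (hφ.comp hTm).aestronglyMeasurable B (ae_of_all _ fun x => hB _)
  have i0 := hkint (fun p => φ (join p)) (hφ.comp hadd) (fun p => hB _)
  have i1 := hkint (fun p => φ p.1) (hφ.comp measurable_fst) (fun p => hB _)
  have i2 := hkint (fun p => φ p.2) (hφ.comp measurable_snd) (fun p => hB _)
  have e21 : ∫ p, k p * φ p.2 ∂(μ.prod μ) = ∫ p, k p * φ p.1 ∂(μ.prod μ) := by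
    rw [← integral_prod_swap]
    refine integral_congr_ae (ae_of_all _ fun p => ?_)
    simp only [Prod.snd_swap]
    rw [show k p.swap = k p from H.symm _ _]
  have e1 : ∫ p, k p * φ p.1 ∂(μ.prod μ) = ∫ x, (∫ y, k (x, y) ∂μ) * φ x ∂μ := by
    rw [integral_prod _ i1]
    simp_rw [integral_mul_const]
  have i1' : Integrable (fun x => (∫ y, k (x, y) ∂μ) * φ x) μ := by
    have := i1.integral_prod_left
    simpa only [integral_mul_const] using this
  have hint1 := hint
  rw [coagStep] at hint1
  rw [integrable_add_measure, integrable_add_measure] at hint1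
  rw [coagStep, integral_add_measure (integrable_add_measure.2 hint1.1) hint1.2,
    integral_add_measure hint1.1.1 hint1.1.2, integral_smul_measure,
    integral_map hTm.aemeasurable hφ.aestronglyMeasurable,
    integral_map hadd.aemeasurable hφ.aestronglyMeasurable,
    integral_withDensity_eq_integral_toReal_smul (by fun_prop) (ae_of_all _ fun _ => by simp),
    integral_withDensity_eq_integral_toReal_smul (by fun_prop) (ae_of_all _ fun _ => by simp)]
  have r1 : ∀ x, (ENNReal.ofReal (1 - h * lam - h * ∫ y, k (x, y) ∂μ)).toReal • φ x
      = φ x - h * lam * φ x - h * ((∫ y, k (x, y) ∂μ) * φ x) := by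
    intro x
    rw [ENNReal.toReal_ofReal (H.remaining_nonneg x hM), smul_eq_mul]; ring
  have r2 : ∀ p, (ENNReal.ofReal (h / 2 * k p)).toReal • φ (join p)
      = h / 2 * (k p * φ (join p)) := by
    intro p
    rw [ENNReal.toReal_ofReal (mul_nonneg hh (H.nonneg p)), smul_eq_mul]; ring
  have r3 : ∀ p, k p * (φ (join p) - φ p.1 - φ p.2)
      = k p * φ (join p) - k p * φ p.1 - k p * φ p.2 := by
    intro p; ring
  simp_rw [r1, r2, r3]
  have hl := mul_nonneg H.h_nonneg H.lam_nonneg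
  have s1 : ∫ x, (φ x - h * lam * φ x - h * ((∫ y, k (x, y) ∂μ) * φ x)) ∂μ
      = ∫ x, φ x ∂μ - h * lam * ∫ x, φ x ∂μ - h * ∫ x, (∫ y, k (x, y) ∂μ) * φ x ∂μ := by
    rw [integral_sub (f := fun x => φ x - h * lam * φ x) (hφi.sub (hφi.const_mul _))
      (i1'.const_mul _), integral_sub hφi (hφi.const_mul _), integral_const_mul, integral_const_mul]
  have s2 : ∫ p, (k p * φ (join p) - k p * φ p.1 - k p * φ p.2) ∂(μ.prod μ)
      = ∫ p, k p * φ (join p) ∂(μ.prod μ) - ∫ p, k p * φ p.1 ∂(μ.prod μ)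
        - ∫ p, k p * φ p.2 ∂(μ.prod μ) := by
    rw [integral_sub (f := fun p => k p * φ (join p) - k p * φ p.1) (i0.sub i1) i2,
      integral_sub i0 i1]
  rw [s1, s2, integral_const_mul, integral_const_mul, integral_sub hφT hφi, e21, e1,
    ENNReal.toReal_ofReal hl, smul_eq_mul]
  ring

end IsStepData

theorem IsStepData.exists_trajectory (H : IsStepData k join T h lam κ M) (μ₀ : FiniteMeasure E)
    (h₀ : (μ₀.mass : ℝ) ≤ M) :
    ∃ m : ℕ → FiniteMeasure E, m 0 = μ₀ ∧ (∀ j, (m j : Measure E).real univ ≤ M) ∧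
      ∀ j, (m (j + 1) : Measure E) = coagStep k join T h lam (m j : Measure E) := by
  let Y := {μ : FiniteMeasure E // (μ : Measure E).real univ ≤ M}
  let s : Y → Y := fun μ => by
    have hle := H.coagStep_univ_le (μ := (μ.1 : Measure E)) μ.2
    refine ⟨⟨coagStep k join T h lam (μ.1 : Measure E),
      ⟨hle.trans_lt (measure_lt_top _ _)⟩⟩, ?_⟩
    exact (ENNReal.toReal_mono (measure_ne_top _ _) hle).trans μ.2
  let y₀ : Y := ⟨μ₀, h₀⟩
  refine ⟨fun j => (s^[j] y₀).1, rfl, fun j => (s^[j] y₀).2, fun j => ?_⟩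
  change ((s^[j + 1] y₀).1 : Measure E) = _
  rw [Function.iterate_succ_apply']
  rfl

/-- A Gronwall inequality for explicit Euler steps, with values in `[0, ∞]`. -/
theorem le_exp_mul_of_euler_step_le {x : ℕ → ℝ≥0∞} {A : ℝ} (hA : 0 ≤ A) (hh : 0 ≤ h) {J : ℕ}
    (hx : ∀ j < J, x (j + 1) ≤ x j + ENNReal.ofReal (h * A) * x j) :
    x J ≤ ENNReal.ofReal (Real.exp (A * (J * h))) * x 0 := by
  induction J with
  | zero => simp
  | succ J ih =>
    have h1 := ih fun j hj => hx j (by omega)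
    calc x (J + 1) ≤ x J + ENNReal.ofReal (h * A) * x J := hx J (by omega)
      _ = (ENNReal.ofReal 1 + ENNReal.ofReal (h * A)) * x J := by rw [ENNReal.ofReal_one]; ring
      _ ≤ ENNReal.ofReal (Real.exp (h * A)) *
          (ENNReal.ofReal (Real.exp (A * (J * h))) * x 0) := by
        rw [← ENNReal.ofReal_add zero_le_one (by positivity)]
        gcongr
        rw [add_comm]; exact Real.add_one_le_exp _
      _ = _ := by
        rw [← mul_assoc, ← ENNReal.ofReal_mul (Real.exp_nonneg _), ← Real.exp_add]
        congr 3
        push_cast; ring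

/-- Growth of a moment over one step when the coagulation gain is controlled by a product. -/
theorem IsStepData.moment_coagStep_le [IsFiniteMeasure μ] (H : IsStepData k join T h lam κ M)
    (hM : μ.real univ ≤ M) {u w : E → ℝ} (hu : Measurable u) (hw : Measurable w)
    (hu0 : ∀ x, 0 ≤ u x) (hw0 : ∀ x, 0 ≤ w x) (hT : ∀ x, w (T x) ≤ w x) {c : ℝ} (hc : 0 ≤ c)
    (hadd : ∀ p, k p * (w (join p) - w p.1 - w p.2) ≤ c * (u p.1 * w p.2 + w p.1 * u p.2)) :
    ∫⁻ x, ENNReal.ofReal (w x) ∂(coagStep k join T h lam μ)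
      ≤ ∫⁻ x, ENNReal.ofReal (w x) ∂μ + ENNReal.ofReal (h * c)
        * ((∫⁻ x, ENNReal.ofReal (u x) ∂μ) * ∫⁻ x, ENNReal.ofReal (w x) ∂μ) := by
  have hR : Measurable fun p : E × E => ENNReal.ofReal c *
      (ENNReal.ofReal (u p.1) * ENNReal.ofReal (w p.2)
        + ENNReal.ofReal (w p.1) * ENNReal.ofReal (u p.2)) := by fun_prop
  refine (H.lintegral_coagStep_le (w := fun x => ENNReal.ofReal (w x)) (by fun_prop) hM
    (fun x => ENNReal.ofReal_le_ofReal (hT x)) hR fun p => ?_).trans (le_of_eq ?_)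
  · have := H.nonneg p
    have h1 := hu0 p.1
    have h2 := hu0 p.2
    have h3 := hw0 p.1
    have h4 := hw0 p.2
    rw [← ENNReal.ofReal_mul this, ← ENNReal.ofReal_add h3 h4, ← ENNReal.ofReal_mul this,
      ← ENNReal.ofReal_mul h1, ← ENNReal.ofReal_mul h3,
      ← ENNReal.ofReal_add (by positivity) (by positivity), ← ENNReal.ofReal_mul hc,
      ← ENNReal.ofReal_add (by positivity) (by positivity)]
    exact ENNReal.ofReal_le_ofReal (by linarith [hadd p])
  · have e1 := lintegral_prod_mul (μ := μ) (ν := μ) (f := fun x => ENNReal.ofReal (u x))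
      (g := fun x => ENNReal.ofReal (w x)) (by fun_prop) (by fun_prop)
    have e2 := lintegral_prod_mul (μ := μ) (ν := μ) (f := fun x => ENNReal.ofReal (w x))
      (g := fun x => ENNReal.ofReal (u x)) (by fun_prop) (by fun_prop)
    rw [lintegral_const_mul _ (by fun_prop), lintegral_add_left (by fun_prop), e1, e2,
      show h * c = h / 2 * (2 * c) by ring, ENNReal.ofReal_mul (by linarith [H.h_nonneg]),
      ENNReal.ofReal_mul zero_le_two, ENNReal.ofReal_ofNat]
    ring

/-- Propagation of a hierarchy of three moments along an Euler trajectory. -/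
theorem IsStepData.moment_trajectory_le (H : IsStepData k join T h lam κ M)
    {m : ℕ → FiniteMeasure E} (hM : ∀ j, (m j : Measure E).real univ ≤ M)
    (hm : ∀ j, (m (j + 1) : Measure E) = coagStep k join T h lam (m j)) {w₁ w₂ w₃ : E → ℝ}
    (hw₁ : Measurable w₁) (hw₂ : Measurable w₂) (hw₃ : Measurable w₃) (h0 : ∀ x, 0 ≤ w₁ x)
    (h12 : ∀ x, w₁ x ≤ w₂ x) (h23 : ∀ x, w₂ x ≤ w₃ x) (hT₁ : ∀ x, w₁ (T x) ≤ w₁ x)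
    (hT₂ : ∀ x, w₂ (T x) ≤ w₂ x) (hT₃ : ∀ x, w₃ (T x) ≤ w₃ x) {c X : ℝ} (hc : 0 ≤ c) (hX : 0 ≤ X)
    (ha₁ : ∀ p, k p * (w₁ (join p) - w₁ p.1 - w₁ p.2) ≤ 0)
    (ha₂ : ∀ p, k p * (w₂ (join p) - w₂ p.1 - w₂ p.2) ≤ c * (w₁ p.1 * w₂ p.2 + w₂ p.1 * w₁ p.2))
    (ha₃ : ∀ p, k p * (w₃ (join p) - w₃ p.1 - w₃ p.2) ≤ c * (w₂ p.1 * w₃ p.2 + w₃ p.1 * w₂ p.2))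
    (hX₀ : ∫⁻ x, ENNReal.ofReal (w₃ x) ∂(m 0 : Measure E) ≤ ENNReal.ofReal X) {j : ℕ} {t : ℝ}
    (hj : j * h ≤ t) :
    ∫⁻ x, ENNReal.ofReal (w₃ x) ∂(m j : Measure E)
      ≤ ENNReal.ofReal (Real.exp (c * (Real.exp (c * X * t) * X) * t) * X) := by
  have g0 : ∀ x, 0 ≤ w₂ x := fun x => (h0 x).trans (h12 x)
  have k0 : ∀ x, 0 ≤ w₃ x := fun x => (g0 x).trans (h23 x)
  have hh := H.h_nonneg
  have i1 : ∀ j, ∫⁻ x, ENNReal.ofReal (w₁ x) ∂(m j : Measure E) ≤ ENNReal.ofReal X := by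
    intro j
    induction j with
    | zero =>
      exact (lintegral_mono fun x => ENNReal.ofReal_le_ofReal ((h12 x).trans (h23 x))).trans hX₀
    | succ j ih =>
      rw [hm]
      refine (H.moment_coagStep_le (hM j) hw₁ hw₁ h0 h0 hT₁ (c := 0) le_rfl
        (by simpa using ha₁)).trans ?_
      simpa using ih
  have i2 : ∀ i : ℕ, i * h ≤ t → ∫⁻ x, ENNReal.ofReal (w₂ x) ∂(m i : Measure E)
      ≤ ENNReal.ofReal (Real.exp (c * X * t) * X) := by
    intro i hi
    have := le_exp_mul_of_euler_step_le
      (x := fun j => ∫⁻ x, ENNReal.ofReal (w₂ x) ∂(m j : Measure E))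
      (A := c * X) (by positivity) hh (J := i) fun j _ => by
        rw [hm]
        refine (H.moment_coagStep_le (hM j) hw₁ hw₂ h0 g0 hT₂ hc ha₂).trans ?_
        rw [← mul_assoc h, ENNReal.ofReal_mul (p := h * c) (by positivity), mul_assoc]
        gcongr
        exact i1 j
    refine this.trans ?_
    rw [ENNReal.ofReal_mul (Real.exp_nonneg _)]
    gcongr
    exact (lintegral_mono fun x => ENNReal.ofReal_le_ofReal (h23 x)).trans hX₀
  have := le_exp_mul_of_euler_step_le (x := fun j => ∫⁻ x, ENNReal.ofReal (w₃ x) ∂(m j : Measure E))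
    (A := c * (Real.exp (c * X * t) * X)) (by positivity) hh (J := j) fun i hi => by
      rw [hm]
      refine (H.moment_coagStep_le (hM i) hw₂ hw₃ g0 k0 hT₃ hc ha₃).trans ?_
      rw [← mul_assoc h, ENNReal.ofReal_mul (p := h * c) (by positivity), mul_assoc]
      gcongr
      refine i2 i (le_trans ?_ hj)
      gcongr
  refine this.trans ?_
  rw [ENNReal.ofReal_mul (Real.exp_nonneg _)]
  gcongr

end DiscreteScheme

section Generator

variable {E : Type*} [TopologicalSpace E] [MeasurableSpace E]

/-- The weak generator: coagulation with rate `k`, tested against `φ`, plus the transport term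
`g`. -/
noncomputable def coagGen (k : E × E → ℝ) (join : E × E → E) (φ g : E → ℝ)
    (μ : FiniteMeasure E) : ℝ :=
  1 / 2 * ∫ p, k p * (φ (join p) - φ p.1 - φ p.2) ∂((μ : Measure E).prod (μ : Measure E))
    + ∫ x, g x ∂(μ : Measure E)

variable [BorelSpace E] [PolishSpace E] [LocallyCompactSpace E] {Ω : E → ℝ} {C : ℝ≥0}

theorem mul_sub_sub_sq_le {k c w B x y z : ℝ} (hk : k ^ 2 ≤ c * w) (hx : |x| ≤ B) (hy : |y| ≤ B)
    (hz : |z| ≤ B) : (k * (x - y - z)) ^ 2 ≤ (9 * B ^ 2 * c) * w := by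
  have h1 : |x - y - z| ≤ 3 * B := by
    rw [abs_le] at *; constructor <;> linarith [hx.1, hx.2, hy.1, hy.2, hz.1, hz.2]
  have h2 : (x - y - z) ^ 2 ≤ (3 * B) ^ 2 := by
    rw [← sq_abs (x - y - z)]; gcongr
  rw [mul_pow]
  calc k ^ 2 * (x - y - z) ^ 2 ≤ (c * w) * (3 * B) ^ 2 :=
        mul_le_mul hk h2 (sq_nonneg _) ((sq_nonneg _).trans hk)
    _ = _ := by ring

/-- Joint continuity of the generator along weakly convergent measures with bounded moments. -/
theorem IsProperWeight.tendsto_coagGen (hΩ : IsProperWeight Ω) {ι : Type*} {l : Filter ι}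
    [l.NeBot] {μ : ι → FiniteMeasure E} {μ₀ : FiniteMeasure E} (hμ : ∀ i, μ i ∈ momentSet Ω C)
    (hlim : Tendsto μ l (𝓝 μ₀)) (join : C(E × E, E)) {k : ι → C(E × E, ℝ)} {k₀ : C(E × E, ℝ)}
    (hk : Tendsto k l (𝓝 k₀)) {c : ℝ} (hkc : ∀ i p, k i p ^ 2 ≤ c * (Ω p.1 * Ω p.2))
    {φ g : ι → C(E, ℝ)} {φ₀ g₀ : C(E, ℝ)} (hφ : Tendsto φ l (𝓝 φ₀)) (hg : Tendsto g l (𝓝 g₀))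
    {B M : ℝ} (hB : ∀ i x, |φ i x| ≤ B) (hM : ∀ i x, g i x ^ 2 ≤ M * Ω x) :
    Tendsto (fun i => coagGen (k i) join (φ i) (g i) (μ i)) l (𝓝 (coagGen k₀ join φ₀ g₀ μ₀)) := by
  have h2 := hΩ.tendsto_integral hμ hlim hg hM
  have hcomp : ∀ u : C(E × E, E), Tendsto (fun i => (φ i).comp u) l (𝓝 (φ₀.comp u)) := fun u =>
    ((ContinuousMap.continuous_precomp u).tendsto φ₀).comp hφ
  have h1 := (hΩ.prod hΩ).tendsto_integral
    (fun i => prod_mem_momentSet hΩ.continuous.measurable hΩ.one_le (hμ i))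
    (FiniteMeasure.tendsto_prod hlim)
    (hk.mul (((hcomp join).sub (hcomp ⟨_, continuous_fst⟩)).sub (hcomp ⟨_, continuous_snd⟩)))
    (M := 9 * B ^ 2 * c) (fun i p => mul_sub_sub_sq_le (hkc i p) (hB i _) (hB i _) (hB i _))
  exact (h1.const_mul (1 / 2)).add h2

theorem IsProperWeight.abs_integral_le_of_sq_le (hΩ : IsProperWeight Ω) {μ : FiniteMeasure E}
    (hμ : μ ∈ momentSet Ω C) {g : E → ℝ} {M : ℝ} (hM0 : 0 ≤ M) (hM : ∀ x, g x ^ 2 ≤ M * Ω x) :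
    |∫ x, g x ∂(μ : Measure E)| ≤ (M + 1) * C := by
  have hle : ∀ x, |g x| ≤ (M + 1) * Ω x := by
    intro x
    have := hΩ.one_le x
    have h2 := hM x
    rw [← sq_abs] at h2
    nlinarith [sq_nonneg (|g x| - 1)]
  refine (norm_integral_le_of_norm_le ((hΩ.integrable hμ).const_mul (M + 1))
    (ae_of_all _ fun x => (Real.norm_eq_abs _).trans_le (hle x))).trans ?_
  rw [integral_const_mul]
  exact mul_le_mul_of_nonneg_left (hΩ.integral_le hμ) (by positivity)

theorem IsProperWeight.abs_coagGen_le (hΩ : IsProperWeight Ω) {μ : FiniteMeasure E}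
    (hμ : μ ∈ momentSet Ω C) (join : E × E → E) {k : E × E → ℝ} {c : ℝ} (hc : 0 ≤ c)
    (hkc : ∀ p, k p ^ 2 ≤ c * (Ω p.1 * Ω p.2)) {φ g : E → ℝ} {B M : ℝ} (hM0 : 0 ≤ M)
    (hB : ∀ x, |φ x| ≤ B) (hM : ∀ x, g x ^ 2 ≤ M * Ω x) :
    |coagGen k join φ g μ| ≤ (9 * B ^ 2 * c + 1) * (C * C) + (M + 1) * C := by
  have h1 := (hΩ.prod hΩ).abs_integral_le_of_sq_le
    (prod_mem_momentSet hΩ.continuous.measurable hΩ.one_le hμ) (M := 9 * B ^ 2 * c) (by positivity)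
    (fun p => mul_sub_sub_sq_le (hkc p) (hB (join p)) (hB p.1) (hB p.2))
  have h2 := hΩ.abs_integral_le_of_sq_le hμ hM0 hM
  rw [FiniteMeasure.toMeasure_prod, NNReal.coe_mul] at h1
  rw [coagGen]
  have hC : (0 : ℝ) ≤ C := C.2
  rw [abs_le] at *
  constructor <;> linarith [h1.1, h1.2, h2.1, h2.2]

end Generator

/-- The integral of a step function with steps of length `h`. -/
theorem integral_natFloor_div {h : ℝ} (hh : 0 < h) (a : ℕ → ℝ) (J : ℕ) :
    IntervalIntegrable (fun s => a ⌊s / h⌋₊) volume 0 (J * h) ∧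
      ∫ s in (0 : ℝ)..(J * h), a ⌊s / h⌋₊ = h * ∑ i ∈ Finset.range J, a i := by
  have hstep : ∀ i : ℕ, ∀ᵐ s ∂volume, s ∈ uIoc (i * h) ((i + 1 : ℕ) * h) →
      a i = a ⌊s / h⌋₊ := by
    intro i
    have hne : ∀ᵐ s ∂(volume : Measure ℝ), s ≠ (i + 1 : ℕ) * h := by
      simp [ae_iff, measure_singleton]
    filter_upwards [hne] with s hs hmem
    have hle : (i : ℝ) * h ≤ (i + 1 : ℕ) * h := by push_cast; nlinarith
    rw [uIoc_of_le hle] at hmem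
    congr 1
    symm
    rw [Nat.floor_eq_iff (div_nonneg ((by positivity : (0 : ℝ) ≤ i * h).trans hmem.1.le) hh.le)]
    constructor
    · rw [le_div_iff₀ hh]; exact hmem.1.le
    · rw [div_lt_iff₀ hh]
      have := lt_of_le_of_ne hmem.2 hs
      push_cast at this; exact this
  have hii : ∀ i : ℕ, IntervalIntegrable (fun s => a ⌊s / h⌋₊) volume (i * h) ((i + 1 : ℕ) * h) :=
    fun i => (intervalIntegrable_const (c := a i)).congr_ae
      ((ae_restrict_iff' measurableSet_uIoc).2 (hstep i))
  constructor
  · have := IntervalIntegrable.trans_iterate (a := fun i : ℕ => (i : ℝ) * h) (n := J)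
      (fun i _ => hii i)
    simpa using this
  · have := intervalIntegral.sum_integral_adjacent_intervals
        (a := fun i : ℕ => (i : ℝ) * h) (n := J)
      (fun i _ => hii i)
    rw [Nat.cast_zero, zero_mul] at this
    rw [← this, Finset.mul_sum]
    refine Finset.sum_congr rfl fun i _ => ?_
    rw [← intervalIntegral.integral_congr_ae (hstep i),
      intervalIntegral.integral_const, smul_eq_mul]
    push_cast; ring

/-- A curve in a compact set is continuous as soon as it is so against separating observables. -/
theorem continuousAt_of_separating {X Y ι : Type*} [TopologicalSpace X] [TopologicalSpace Y]
    {ℓ : ι → Y → ℝ} (hℓ : ∀ i, Continuous (ℓ i)) (hsep : ∀ x y, (∀ i, ℓ i x = ℓ i y) → x = y)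
    {S : Set Y} (hS : IsCompact S) {f : X → Y} {t : X} (hf : ∀ᶠ s in 𝓝 t, f s ∈ S)
    (hc : ∀ i, ContinuousAt (fun s => ℓ i (f s)) t) : ContinuousAt f t := by
  refine hS.tendsto_nhds_of_unique_mapClusterPt hf fun z _ hz => hsep _ _ fun i => ?_
  have := hz.continuousAt_comp (hℓ i).continuousAt
  have hne : (𝓝 (ℓ i z) ⊓ 𝓝 (ℓ i (f t))).NeBot := NeBot.mono this (inf_le_inf_left _ (hc i))
  exact eq_of_nhds_neBot hne

section Limit

variable {E : Type*} [TopologicalSpace E] [MeasurableSpace E] [BorelSpace E] [PolishSpace E]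
  [LocallyCompactSpace E] {Ω : E → ℝ}

/-- Increments of an Euler trajectory over a time interval. -/
theorem abs_euler_sub_le {h D s t t₀ : ℝ} (hh : 0 < h) (hst : s ≤ t) (ht : t ≤ t₀)
    {x a : ℕ → ℝ} (hx : ∀ j, x (j + 1) = x j + h * a j) (hD : 0 ≤ D)
    (ha : ∀ j : ℕ, j * h ≤ t₀ → |a j| ≤ D) :
    |x ⌊t / h⌋₊ - x ⌊s / h⌋₊| ≤ D * (t - s + h) := by
  have hle : ⌊s / h⌋₊ ≤ ⌊t / h⌋₊ := Nat.floor_mono (by gcongr)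
  have key : ∀ i, ⌊s / h⌋₊ + i ≤ ⌊t / h⌋₊ →
      |x (⌊s / h⌋₊ + i) - x ⌊s / h⌋₊| ≤ i * (h * D) := by
    intro i
    induction i with
    | zero => simp
    | succ i ih =>
      intro hi
      have h1 := ih (by omega)
      have h2 : ((⌊s / h⌋₊ + i : ℕ) : ℝ) * h ≤ t₀ := by
        rcases le_or_gt 0 t with ht0 | ht0
        · have h3 : ((⌊s / h⌋₊ + i : ℕ) : ℝ) ≤ t / h :=
            (Nat.cast_le.2 (by omega)).trans (Nat.floor_le (div_nonneg ht0 hh.le))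
          rw [le_div_iff₀ hh] at h3
          exact h3.trans ht
        · have : ⌊t / h⌋₊ = 0 := Nat.floor_of_nonpos (div_nonpos_of_nonpos_of_nonneg ht0.le hh.le)
          omega
      have h3 := ha _ h2
      have h4 : |h * a (⌊s / h⌋₊ + i)| ≤ h * D := by
        rw [abs_mul, abs_of_pos hh]; gcongr
      rw [← add_assoc, hx, add_sub_right_comm]
      refine (abs_add_le _ _).trans ?_
      push_cast
      linarith
  have h1 := key (⌊t / h⌋₊ - ⌊s / h⌋₊) (by omega)
  rw [Nat.add_sub_cancel' hle, Nat.cast_sub hle] at h1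
  refine h1.trans ?_
  have h2 : s / h < ⌊s / h⌋₊ + 1 := Nat.lt_floor_add_one _
  have h3 : (⌊t / h⌋₊ : ℝ) ≤ ⌊s / h⌋₊ + 1 + (t - s) / h := by
    have e : t / h = s / h + (t - s) / h := by field_simp; ring
    have h5 : 0 ≤ (t - s) / h := div_nonneg (by linarith) hh.le
    rcases le_or_gt 0 (t / h) with ht0 | ht0
    · have := Nat.floor_le ht0
      linarith
    · rw [Nat.floor_of_nonpos ht0.le]
      push_cast; positivity
  have h4 : ((⌊t / h⌋₊ : ℝ) - ⌊s / h⌋₊) * h ≤ t - s + h := by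
    calc ((⌊t / h⌋₊ : ℝ) - ⌊s / h⌋₊) * h ≤ (1 + (t - s) / h) * h := by gcongr; linarith
      _ = t - s + h := by field_simp; ring
  calc _ = D * (((⌊t / h⌋₊ : ℝ) - ⌊s / h⌋₊) * h) := by ring
    _ ≤ _ := by gcongr

/-- Time-discrete approximate solutions with uniform moment bounds converge, along a subsequence,
to a weakly continuous curve which solves the limit equation in weak form. -/
theorem IsProperWeight.exists_curve_of_euler (hΩ : IsProperWeight Ω) (join : C(E × E, E))
    {k : ℕ → C(E × E, ℝ)} {K : C(E × E, ℝ)} (hk : Tendsto k atTop (𝓝 K)) {c : ℝ} (hc : 0 ≤ c)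
    (hkc : ∀ n p, k n p ^ 2 ≤ c * (Ω p.1 * Ω p.2)) {h : ℕ → ℝ} (hh : ∀ n, 0 < h n)
    (hh0 : Tendsto h atTop (𝓝 0)) {m : ℕ → ℕ → FiniteMeasure E} {μ₀ : FiniteMeasure E}
    (hm0 : ∀ n, m n 0 = μ₀) {C : ℝ → ℝ≥0}
    (hm : ∀ n (j : ℕ) t, 0 ≤ t → j * h n ≤ t → m n j ∈ momentSet Ω (C t))
    {τ ι : Type*} [Countable ι]
    {Φ G : τ → C(E, ℝ)} {g : ℕ → τ → C(E, ℝ)} {B M : τ → ℝ} (hB : ∀ a x, |Φ a x| ≤ B a)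
    (hM0 : ∀ a, 0 ≤ M a) (hM : ∀ n a x, g n a x ^ 2 ≤ M a * Ω x)
    (hg : ∀ a, Tendsto (fun n => g n a) atTop (𝓝 (G a)))
    (hstep : ∀ n j a, ∫ x, Φ a x ∂(m n (j + 1) : Measure E)
      = ∫ x, Φ a x ∂(m n j : Measure E) + h n * coagGen (k n) join (Φ a) (g n a) (m n j))
    {e : ι → τ} (hsep : ∀ μ ν : FiniteMeasure E,
      (∀ i, ∫ x, Φ (e i) x ∂(μ : Measure E) = ∫ x, Φ (e i) x ∂(ν : Measure E)) → μ = ν) :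
    ∃ f : ℝ → FiniteMeasure E, Continuous f ∧ f 0 = μ₀ ∧ (∀ t, 0 ≤ t → f t ∈ momentSet Ω (C t)) ∧
      ∀ a t, 0 ≤ t → ∫ x, Φ a x ∂(f t : Measure E) - ∫ x, Φ a x ∂(μ₀ : Measure E)
        = ∫ s in (0 : ℝ)..t, coagGen K join (Φ a) (G a) (f s) := by
  let ℓ : τ → FiniteMeasure E → ℝ := fun a μ => ∫ x, Φ a x ∂(μ : Measure E)
  have hℓ : ∀ a, Continuous (ℓ a) := by
    intro a
    let b : E →ᵇ ℝ := BoundedContinuousFunction.ofNormedAddCommGroup (Φ a) (Φ a).continuous (B a)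
      (fun x => by simpa using hB a x)
    exact continuous_iff_continuousAt.2 fun μ =>
      (FiniteMeasure.tendsto_iff_forall_integral_tendsto.1 tendsto_id b)
  let F : ℕ → ℝ → FiniteMeasure E := fun n t => m n ⌊t / h n⌋₊
  have hF : ∀ n s t, 0 ≤ t → s ≤ t → F n s ∈ momentSet Ω (C t) := by
    intro n s t ht hst
    refine hm n _ t ht ?_
    rcases le_or_gt 0 (s / h n) with hs | hs
    · have := Nat.floor_le hs
      rw [le_div_iff₀ (hh n)] at this
      exact this.trans hst
    · rw [Nat.floor_of_nonpos hs.le]; simpa using ht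
  let D : τ → ℝ → ℝ := fun a t => (9 * B a ^ 2 * c + 1) * (C t * C t) + (M a + 1) * C t
  have hD : ∀ a t, 0 ≤ D a t := fun a t => by have := hM0 a; positivity
  have hgen : ∀ n a (j : ℕ) t, 0 ≤ t → j * h n ≤ t →
      |coagGen (k n) join (Φ a) (g n a) (m n j)| ≤ D a t := fun n a j t ht hj =>
    hΩ.abs_coagGen_le (hm n j t ht hj) join hc (hkc n) (hM0 a) (hB a) (hM n a)
  have hlip : ∀ n a s t t₀, 0 ≤ t₀ → s ≤ t₀ → t ≤ t₀ →
      |ℓ a (F n s) - ℓ a (F n t)| ≤ D a t₀ * (|s - t| + h n) := by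
    intro n a s t t₀ ht₀ hs ht
    rcases le_total s t with hst | hst
    · have := abs_euler_sub_le (hh n) hst ht (x := fun j => ℓ a (m n j))
        (fun j => hstep n j a) (hD a t₀) (fun j hj => hgen n a j t₀ ht₀ hj)
      rw [abs_sub_comm, abs_sub_comm s t, abs_of_nonneg (sub_nonneg.2 hst)]
      exact this
    · have := abs_euler_sub_le (hh n) hst hs (x := fun j => ℓ a (m n j))
        (fun j => hstep n j a) (hD a t₀) (fun j hj => hgen n a j t₀ ht₀ hj)
      rw [abs_of_nonneg (sub_nonneg.2 hst)]
      exact this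
  obtain ⟨φ, hφ, f, hf⟩ := exists_subseq_tendsto_of_equicontinuous (fun i => hℓ (e i)) hsep
    (S := fun t => momentSet Ω (C (max t 0))) (fun t => hΩ.isCompact_momentSet _)
    (fun n t => hF n t _ (le_max_right _ _) (le_max_left _ _)) (by
      intro i t ε hε
      set t₀ := |t| + 1
      have hD' := hD (e i) t₀
      refine ⟨min 1 (ε / (2 * (D (e i) t₀ + 1))), by positivity, fun s hs => ?_⟩
      have hε' : 0 < ε / (2 * (D (e i) t₀ + 1)) := by positivity
      filter_upwards [hh0.eventually (gt_mem_nhds hε')] with n hn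
      obtain ⟨hs1, hs2⟩ := lt_min_iff.1 hs
      have hst : s ≤ t₀ := by linarith [(abs_lt.1 hs1).2, le_abs_self t]
      refine (hlip n (e i) s t t₀ (by positivity) hst (by linarith [le_abs_self t])).trans ?_
      calc D (e i) t₀ * (|s - t| + h n) ≤ (D (e i) t₀ + 1)
            * (ε / (2 * (D (e i) t₀ + 1)) + ε / (2 * (D (e i) t₀ + 1))) := by
            have := (hh n).le
            gcongr
            linarith
        _ = ε := by field_simp; ring)
  have hfm : ∀ t, 0 ≤ t → f t ∈ momentSet Ω (C t) := fun t ht => by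
    simpa [max_eq_left ht] using! (hf t).1
  have hfS : ∀ s t, 0 ≤ t → s ≤ t → f s ∈ momentSet Ω (C t) := fun s t ht hst =>
    (hΩ.isClosed_momentSet _).mem_of_tendsto (hf s).2
      (Eventually.of_forall fun n => hF _ s t ht hst)
  have hh1 : Tendsto (fun n => h (φ n)) atTop (𝓝 0) := hh0.comp hφ.tendsto_atTop
  have hlipf : ∀ a s t t₀, 0 ≤ t₀ → s ≤ t₀ → t ≤ t₀ →
      |ℓ a (f s) - ℓ a (f t)| ≤ D a t₀ * |s - t| := by
    intro a s t t₀ h0 hs ht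
    have h1 : Tendsto (fun n => |ℓ a (F (φ n) s) - ℓ a (F (φ n) t)|) atTop
        (𝓝 |ℓ a (f s) - ℓ a (f t)|) :=
      ((((hℓ a).tendsto _).comp (hf s).2).sub (((hℓ a).tendsto _).comp (hf t).2)).abs
    have h2 := (hh1.const_add |s - t|).const_mul (D a t₀)
    rw [add_zero] at h2
    exact le_of_tendsto_of_tendsto' h1 h2 fun n => hlip (φ n) a s t t₀ h0 hs ht
  have hcont : Continuous f := by
    refine continuous_iff_continuousAt.2 fun t => ?_
    refine continuousAt_of_separating (fun i => hℓ (e i)) hsep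
      (hΩ.isCompact_momentSet (C (|t| + 1))) ?_ fun i => ?_
    · filter_upwards [gt_mem_nhds (show t < |t| + 1 by linarith [le_abs_self t])] with s hs
      exact hfS s _ (by positivity) hs.le
    · refine tendsto_iff_dist_tendsto_zero.2 ?_
      have h2 : Tendsto (fun s => D (e i) (|t| + 1) * |s - t|) (𝓝 t) (𝓝 0) := by
        have : Continuous fun s => D (e i) (|t| + 1) * |s - t| := by fun_prop
        simpa using this.tendsto t
      refine squeeze_zero' (Eventually.of_forall fun _ => dist_nonneg) ?_ h2
      filter_upwards [gt_mem_nhds (show t < |t| + 1 by linarith [le_abs_self t])] with s hs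
      exact hlipf (e i) s t _ (by positivity) hs.le (by linarith [le_abs_self t])
  have hf0 : f 0 = μ₀ := by
    refine tendsto_nhds_unique (hf 0).2 ?_
    simp only [F, zero_div, Nat.floor_zero, hm0]
    exact tendsto_const_nhds
  refine ⟨f, hcont, hf0, hfm, fun a t ht => ?_⟩
  let A : ℕ → ℝ → ℝ := fun n s => coagGen (k n) join (Φ a) (g n a) (F n s)
  have hAb : ∀ n s, s ≤ t → |A n s| ≤ D a t := fun n s hs =>
    hΩ.abs_coagGen_le (hF n s t ht hs) join hc (hkc n) (hM0 a) (hB a) (hM n a)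
  have hAi : ∀ n, ∀ u, 0 ≤ u → IntervalIntegrable (A n) volume 0 u := by
    intro n u hu
    have h1 := (integral_natFloor_div (hh n)
      (fun j => coagGen (k n) join (Φ a) (g n a) (m n j)) (⌊u / h n⌋₊ + 1)).1
    refine h1.mono_set ?_
    have h2 := Nat.lt_floor_add_one (u / h n)
    rw [div_lt_iff₀ (hh n)] at h2
    push_cast
    rw [uIcc_of_le hu, uIcc_of_le (hu.trans h2.le)]
    exact Icc_subset_Icc_right h2.le
  have hA : ∀ n, |(ℓ a (F n t) - ℓ a μ₀) - ∫ s in (0 : ℝ)..t, A n s| ≤ D a t * h n := by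
    intro n
    set J := ⌊t / h n⌋₊ with hJ
    have hJ1 : J * h n ≤ t := by
      rw [← le_div_iff₀ (hh n)]; exact Nat.floor_le (div_nonneg ht (hh n).le)
    have hJ2 : t < (J + 1) * h n := by
      rw [← div_lt_iff₀ (hh n)]; exact Nat.lt_floor_add_one _
    have hJ0 : 0 ≤ J * h n := mul_nonneg (Nat.cast_nonneg _) (hh n).le
    have hsum : ∀ N : ℕ, ℓ a (m n N) - ℓ a μ₀
        = h n * ∑ i ∈ Finset.range N, coagGen (k n) join (Φ a) (g n a) (m n i) := by
      intro N
      induction N with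
      | zero => simp [hm0]
      | succ N ih =>
        rw [Finset.sum_range_succ, mul_add, ← ih]
        have := hstep n N a
        simp only [ℓ]
        linarith
    have e1 : ℓ a (F n t) - ℓ a μ₀ = ∫ s in (0 : ℝ)..(J * h n), A n s := by
      rw [(integral_natFloor_div (hh n)
        (fun j => coagGen (k n) join (Φ a) (g n a) (m n j)) J).2]
      exact hsum J
    have e2 := intervalIntegral.integral_add_adjacent_intervals (hAi n _ hJ0)
      ((hAi n _ hJ0).symm.trans (hAi n t ht))
    have h3 : ‖∫ s in (J * h n)..t, A n s‖ ≤ D a t * |t - J * h n| :=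
      intervalIntegral.norm_integral_le_of_norm_le_const fun s hs => by
        rw [uIoc_of_le hJ1] at hs
        exact hAb n s hs.2
    rw [e1, ← e2, sub_add_cancel_left, abs_neg, ← Real.norm_eq_abs]
    refine h3.trans ?_
    have := hD a t
    gcongr
    rw [abs_of_nonneg (by linarith)]
    linarith
  have hlimA : Tendsto (fun n => ∫ s in (0 : ℝ)..t, A (φ n) s) atTop
      (𝓝 (∫ s in (0 : ℝ)..t, coagGen K join (Φ a) (G a) (f s))) := by
    refine intervalIntegral.tendsto_integral_filter_of_dominated_convergence (fun _ => D a t)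
      (Eventually.of_forall fun n => ?_) (Eventually.of_forall fun n => ae_of_all _ fun s hs => ?_)
      intervalIntegrable_const (ae_of_all _ fun s hs => ?_)
    · have := (hAi (φ n) t ht).aestronglyMeasurable
      rwa [uIoc_of_le ht]
    · rw [uIoc_of_le ht] at hs
      exact hAb _ s hs.2
    · exact hΩ.tendsto_coagGen (C := C (max s 0))
        (fun n => hF (φ n) s _ (le_max_right _ _) (le_max_left _ _)) (hf s).2 join
        (hk.comp hφ.tendsto_atTop) (fun n => hkc (φ n)) tendsto_const_nhds
        ((hg a).comp hφ.tendsto_atTop) (fun _ => hB a) (fun n => hM (φ n) a)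
  have h1 : Tendsto (fun n => (ℓ a (F (φ n) t) - ℓ a μ₀) - ∫ s in (0 : ℝ)..t, A (φ n) s) atTop
      (𝓝 ((ℓ a (f t) - ℓ a μ₀) - ∫ s in (0 : ℝ)..t, coagGen K join (Φ a) (G a) (f s))) :=
    ((((hℓ a).tendsto _).comp (hf t).2).sub_const _).sub hlimA
  have h2 : Tendsto (fun n => (ℓ a (F (φ n) t) - ℓ a μ₀) - ∫ s in (0 : ℝ)..t, A (φ n) s) atTop
      (𝓝 0) := by
    refine squeeze_zero_norm (fun n => hA (φ n)) ?_
    simpa using hh1.const_mul (D a t)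
  exact sub_eq_zero.1 (tendsto_nhds_unique h1 h2)

end Limit

section PowerInequalities

theorem rpow_le_rpow_add_rpow {x e q p : ℝ} (hx : 0 < x) (hq : -q ≤ e) (hp : e ≤ p) :
    x ^ e ≤ x ^ (-q) + x ^ p := by
  have h1 := rpow_pos_of_pos hx (-q)
  have h2 := rpow_pos_of_pos hx p
  rcases le_total x 1 with h | h
  · linarith [rpow_le_rpow_of_exponent_ge hx h hq]
  · linarith [rpow_le_rpow_of_exponent_le h hp]

theorem sub_rpow_le {x y p : ℝ} (hx : 0 < x) (hy : 0 < y) (hp : 1 ≤ p) :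
    x ^ p - y ^ p ≤ p * x ^ (p - 1) * (x - y) := by
  have h := one_add_mul_self_le_rpow_one_add (s := (y - x) / x) (by
    rw [le_div_iff₀ hx]; linarith) hp
  have e : 1 + (y - x) / x = y / x := by field_simp; ring
  rw [e, div_rpow hy.le hx.le, le_div_iff₀ (rpow_pos_of_pos hx p)] at h
  have e2 : x ^ p = x ^ (p - 1) * x := by
    rw [← rpow_add_one hx.ne']; congr 1; ring
  have e3 : (1 + p * ((y - x) / x)) * x ^ p = x ^ p + p * x ^ (p - 1) * (y - x) := by
    rw [add_mul, one_mul]; congr 1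
    rw [e2]; field_simp
  linarith

/-- The defect of additivity of `x ↦ x ^ p` when `x ≤ y`. -/
theorem add_rpow_sub_le {x y p : ℝ} (hx : 0 < x) (hxy : x ≤ y) (hp : 1 ≤ p) :
    (x + y) ^ p - x ^ p - y ^ p ≤ p * 2 ^ (p - 1) * (x * y ^ (p - 1)) := by
  have hy := hx.trans_le hxy
  have h1 := sub_rpow_le (x := x + y) (by positivity) hy hp
  have h2 : (x + y) ^ (p - 1) ≤ 2 ^ (p - 1) * y ^ (p - 1) := by
    rw [← mul_rpow zero_le_two hy.le]
    exact rpow_le_rpow (by positivity) (by linarith) (by linarith)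
  have h3 := rpow_pos_of_pos hx p
  have h4 : p * (x + y) ^ (p - 1) * (x + y - y) ≤ p * (2 ^ (p - 1) * y ^ (p - 1)) * x := by
    rw [add_sub_cancel_right]; gcongr
  linarith

theorem add_rpow_sub_le_symm {x y p : ℝ} (hx : 0 < x) (hy : 0 < y) (hp : 1 ≤ p) :
    (x + y) ^ p - x ^ p - y ^ p ≤ p * 2 ^ (p - 1) * (x * y ^ (p - 1) + y * x ^ (p - 1)) := by
  rcases le_total x y with h | h
  · have := add_rpow_sub_le hx h hp
    have h2 : 0 ≤ p * 2 ^ (p - 1) * (y * x ^ (p - 1)) := by positivity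
    linarith
  · have := add_rpow_sub_le hy h hp
    have h2 : 0 ≤ p * 2 ^ (p - 1) * (x * y ^ (p - 1)) := by positivity
    rw [add_comm y x] at this
    linarith

theorem rpow_sub_one_mul_le {a z m : ℝ} (ha : 0 < a) (hz : 0 < z) (hm : 1 ≤ m) :
    a ^ (m - 1) * z ≤ a ^ m + z ^ m := by
  have h1 := rpow_pos_of_pos ha m
  have h2 := rpow_pos_of_pos hz m
  rcases le_total a z with h | h
  · have : a ^ (m - 1) * z ≤ z ^ (m - 1) * z := by
      gcongr
    rw [← rpow_add_one hz.ne', sub_add_cancel] at this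
    linarith
  · have : a ^ (m - 1) * z ≤ a ^ (m - 1) * a := by gcongr
    rw [← rpow_add_one ha.ne', sub_add_cancel] at this
    linarith

theorem add_rpow_neg_le {x y s : ℝ} (hx : 0 < x) (hy : 0 < y) (hs : 0 ≤ s) :
    (x + y) ^ (-s) ≤ x ^ (-s) :=
  rpow_le_rpow_of_nonpos hx (by linarith) (by linarith)

end PowerInequalities

/-- Exponents for the moment hierarchy: `α`, `β` of the coagulation kernel, `q` and `p` for small
and large volumes, `m` for large areas. -/
structure IsMomentExponents (al be q p m : ℝ) : Prop where
  al_pos : 0 < al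
  al_lt : al < 1
  be_pos : 0 < be
  be_lt : be < 1
  al_le_be : al ≤ be
  two_le : 2 ≤ m
  m_le_p : m ≤ p
  m_le_q : m ≤ q

section MomentWeights

/-- The first moment weight, which is subadditive. -/
noncomputable def lowWeight (al q : ℝ) (η : ℝ × ℝ) : ℝ := η.2 ^ (-q) + η.2 + η.1 * η.2 ^ (-al)

/-- The second moment weight, controlling large volumes. -/
noncomputable def midWeight (al be q p : ℝ) (η : ℝ × ℝ) : ℝ :=
  lowWeight al q η + η.2 ^ p + η.1 * η.2 ^ be

/-- The third moment weight, controlling large areas. -/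
noncomputable def topWeight (al be q p m : ℝ) (η : ℝ × ℝ) : ℝ := midWeight al be q p η + η.1 ^ m

variable {al be q p m : ℝ} (hE : IsMomentExponents al be q p m) {η ζ : ℝ × ℝ}

theorem lowWeight_nonneg (h : η ∈ Quad) : 0 ≤ lowWeight al q η := by
  have := h.1; have := h.2; rw [lowWeight]; positivity

theorem lowWeight_le_midWeight (h : η ∈ Quad) : lowWeight al q η ≤ midWeight al be q p η := by
  have := h.1; have := h.2
  have h1 : 0 ≤ η.2 ^ p + η.1 * η.2 ^ be := by positivity
  rw [midWeight]; linarith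

theorem midWeight_le_topWeight (h : η ∈ Quad) :
    midWeight al be q p η ≤ topWeight al be q p m η := by
  have := h.1
  have h1 : 0 ≤ η.1 ^ m := by positivity
  rw [topWeight]; linarith

theorem rpow_le_lowWeight (h : η ∈ Quad) {e : ℝ} (h1 : -q ≤ e) (h2 : e ≤ 1) :
    η.2 ^ e ≤ lowWeight al q η := by
  have := rpow_le_rpow_add_rpow h.2 h1 h2
  rw [rpow_one] at this
  have h3 := h.1; have h4 := h.2
  have : 0 ≤ η.1 * η.2 ^ (-al) := by positivity
  rw [lowWeight]; linarith

theorem mul_rpow_le_lowWeight (hη : η ∈ Quad) : η.1 * η.2 ^ (-al) ≤ lowWeight al q η := by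
  have := hη.2
  have : 0 ≤ η.2 ^ (-q) := by positivity
  rw [lowWeight]; linarith

theorem rpow_le_midWeight (h : η ∈ Quad) {e : ℝ} (h1 : -q ≤ e) (h2 : e ≤ p) :
    η.2 ^ e ≤ midWeight al be q p η := by
  have := rpow_le_rpow_add_rpow h.2 h1 h2
  have h3 := h.1; have h4 := h.2
  have h5 : 0 ≤ η.1 * η.2 ^ (-al) := by positivity
  have h6 : 0 ≤ η.1 * η.2 ^ be := by positivity
  rw [midWeight, lowWeight]; linarith

theorem mul_rpow_le_midWeight (hη : η ∈ Quad) : η.1 * η.2 ^ be ≤ midWeight al be q p η := by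
  have := lowWeight_nonneg (al := al) (q := q) hη
  have := hη.2
  have : 0 ≤ η.2 ^ p := by positivity
  rw [midWeight]; linarith

theorem lowWeight_add_le (hq : 0 ≤ q) (hal : 0 ≤ al) (hη : η ∈ Quad) (hζ : ζ ∈ Quad) :
    lowWeight al q (η + ζ) ≤ lowWeight al q η + lowWeight al q ζ := by
  obtain ⟨a, x⟩ := η
  obtain ⟨b, y⟩ := ζ
  obtain ⟨ha, hx⟩ := hη
  obtain ⟨hb, hy⟩ := hζ
  simp only [lowWeight, Prod.mk_add_mk] at *
  have h1 := add_rpow_neg_le hx hy hq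
  have h2 := rpow_nonneg hy.le (-q)
  have h3 := add_rpow_neg_le hx hy hal
  have h4 := add_rpow_neg_le hy hx hal
  rw [add_comm y x] at h4
  have h5 : a * (x + y) ^ (-al) ≤ a * x ^ (-al) := by gcongr
  have h6 : b * (x + y) ^ (-al) ≤ b * y ^ (-al) := by gcongr
  linarith [add_mul a b ((x + y) ^ (-al))]

/-- The upper bound for the coagulation kernel, up to a constant. -/
noncomputable def powerKernel (al be : ℝ) (η ζ : ℝ × ℝ) : ℝ :=
  η.2 ^ (-al) * ζ.2 ^ be + ζ.2 ^ (-al) * η.2 ^ be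

include hE

/-- Gain of the volume moment against the power kernel, in the ordered case. -/
theorem powerKernel_mul_volume_le (hη : η ∈ Quad) (hζ : ζ ∈ Quad) (hle : η.2 ≤ ζ.2) :
    powerKernel al be η ζ * (p * 2 ^ (p - 1) * (η.2 * ζ.2 ^ (p - 1)))
      ≤ 2 * p * 2 ^ (p - 1) * (lowWeight al q η * midWeight al be q p ζ) := by
  obtain ⟨hal, hal1, hbe, hbe1, hab, h2, hmp, hmq⟩ := hE
  have hx := hη.2
  have hy := hζ.2
  have hk : powerKernel al be η ζ ≤ 2 * (η.2 ^ (-al) * ζ.2 ^ be) := by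
    have h1 : ζ.2 ^ (-al) * η.2 ^ be ≤ η.2 ^ (-al) * ζ.2 ^ be := by
      refine mul_le_mul (rpow_le_rpow_of_nonpos hx hle (by linarith)) ?_ (by positivity)
        (by positivity)
      gcongr
    rw [powerKernel]; linarith
  have e1 : η.2 ^ (-al) * η.2 = η.2 ^ (1 - al) := by
    rw [← rpow_add_one hx.ne']; congr 1; ring
  have e2 : ζ.2 ^ be * ζ.2 ^ (p - 1) = ζ.2 ^ (be + p - 1) := by
    rw [← rpow_add hy]; congr 1; ring
  have b1 : η.2 ^ (1 - al) ≤ lowWeight al q η := rpow_le_lowWeight hη (by linarith) (by linarith)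
  have b2 : ζ.2 ^ (be + p - 1) ≤ midWeight al be q p ζ :=
    rpow_le_midWeight hζ (by linarith) (by linarith)
  have hp : 0 ≤ p := by linarith
  calc _ ≤ 2 * (η.2 ^ (-al) * ζ.2 ^ be) * (p * 2 ^ (p - 1) * (η.2 * ζ.2 ^ (p - 1))) := by
        gcongr
    _ = 2 * p * 2 ^ (p - 1) * ((η.2 ^ (-al) * η.2) * (ζ.2 ^ be * ζ.2 ^ (p - 1))) := by ring
    _ ≤ _ := by
      rw [e1, e2]
      have := lowWeight_nonneg (al := al) (q := q) hη
      gcongr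

theorem powerKernel_mul_volume_le' (hη : η ∈ Quad) (hζ : ζ ∈ Quad) :
    powerKernel al be η ζ * ((η.2 + ζ.2) ^ p - η.2 ^ p - ζ.2 ^ p)
      ≤ 2 * p * 2 ^ (p - 1) * (lowWeight al q η * midWeight al be q p ζ
        + midWeight al be q p η * lowWeight al q ζ) := by
  have hx := hη.2
  have hy := hζ.2
  have hp : 1 ≤ p := by linarith [hE.two_le, hE.m_le_p]
  have l1 := lowWeight_nonneg (al := al) (q := q) hη
  have l2 := lowWeight_nonneg (al := al) (q := q) hζ
  have m1 := l1.trans (lowWeight_le_midWeight (be := be) (p := p) hη)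
  have m2 := l2.trans (lowWeight_le_midWeight (be := be) (p := p) hζ)
  have hk : 0 ≤ powerKernel al be η ζ := by rw [powerKernel]; positivity
  rcases le_total η.2 ζ.2 with h | h
  · have h1 := mul_le_mul_of_nonneg_left (add_rpow_sub_le hx h hp) hk
    refine (h1.trans (powerKernel_mul_volume_le hE hη hζ h)).trans ?_
    gcongr
    linarith [mul_nonneg m1 l2]
  · have h1 := mul_le_mul_of_nonneg_left (add_rpow_sub_le hy h hp) hk
    have h2 := powerKernel_mul_volume_le hE hζ hη h
    rw [show powerKernel al be ζ η = powerKernel al be η ζ by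
      rw [powerKernel, powerKernel, add_comm]] at h2
    rw [add_comm ζ.2, sub_right_comm] at h1
    refine (h1.trans h2).trans ?_
    gcongr
    linarith [mul_nonneg l1 m2]

theorem powerKernel_mul_midWeight_le (hη : η ∈ Quad) (hζ : ζ ∈ Quad) :
    powerKernel al be η ζ * (midWeight al be q p (η + ζ) - midWeight al be q p η
        - midWeight al be q p ζ)
      ≤ (2 * p * 2 ^ (p - 1) + 2) * (lowWeight al q η * midWeight al be q p ζ
        + midWeight al be q p η * lowWeight al q ζ) := by
  have hq : 0 ≤ q := by linarith [hE.two_le, hE.m_le_q]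
  have hv := powerKernel_mul_volume_le' hE hη hζ
  have hl := lowWeight_add_le hq hE.al_pos.le hη hζ
  obtain ⟨hal, hal1, hbe, hbe1, hab, h2, hmp, hmq⟩ := hE
  have hx := hη.2
  have hy := hζ.2
  have ha := hη.1
  have hb := hζ.1
  have l1 := lowWeight_nonneg (al := al) (q := q) hη
  have l2 := lowWeight_nonneg (al := al) (q := q) hζ
  have m1 := l1.trans (lowWeight_le_midWeight (be := be) (p := p) hη)
  have m2 := l2.trans (lowWeight_le_midWeight (be := be) (p := p) hζ)
  have hk : 0 ≤ powerKernel al be η ζ := by rw [powerKernel]; positivity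
  have hsub : (η.2 + ζ.2) ^ be ≤ η.2 ^ be + ζ.2 ^ be :=
    rpow_add_le_add_rpow hx.le hy.le hbe.le hbe1.le
  have hP : (η.1 + ζ.1) * (η.2 + ζ.2) ^ be - η.1 * η.2 ^ be - ζ.1 * ζ.2 ^ be
      ≤ η.1 * ζ.2 ^ be + ζ.1 * η.2 ^ be := by
    have := mul_le_mul_of_nonneg_left hsub (add_pos ha hb).le
    linarith [mul_add (η.1 + ζ.1) (η.2 ^ be) (ζ.2 ^ be)]
  have hPk : powerKernel al be η ζ * (η.1 * ζ.2 ^ be + ζ.1 * η.2 ^ be)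
      ≤ 2 * (lowWeight al q η * midWeight al be q p ζ
        + midWeight al be q p η * lowWeight al q ζ) := by
    have e : powerKernel al be η ζ * (η.1 * ζ.2 ^ be + ζ.1 * η.2 ^ be)
        = (η.1 * η.2 ^ (-al)) * ζ.2 ^ (2 * be) + η.2 ^ (be - al) * (ζ.1 * ζ.2 ^ be)
          + (η.1 * η.2 ^ be) * ζ.2 ^ (be - al) + η.2 ^ (2 * be) * (ζ.1 * ζ.2 ^ (-al)) := by
      rw [powerKernel, two_mul, rpow_add hx, rpow_add hy, sub_eq_add_neg, rpow_add hx, rpow_add hy]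
      ring
    rw [e]
    have := mul_rpow_le_lowWeight (al := al) (q := q) hη
    have := mul_rpow_le_lowWeight (al := al) (q := q) hζ
    have := mul_rpow_le_midWeight (al := al) (be := be) (q := q) (p := p) hη
    have := mul_rpow_le_midWeight (al := al) (be := be) (q := q) (p := p) hζ
    have : η.2 ^ (be - al) ≤ lowWeight al q η := rpow_le_lowWeight hη (by linarith) (by linarith)
    have : ζ.2 ^ (be - al) ≤ lowWeight al q ζ := rpow_le_lowWeight hζ (by linarith) (by linarith)
    have : η.2 ^ (2 * be) ≤ midWeight al be q p η :=
      rpow_le_midWeight hη (by linarith) (by linarith)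
    have : ζ.2 ^ (2 * be) ≤ midWeight al be q p ζ :=
      rpow_le_midWeight hζ (by linarith) (by linarith)
    calc _ ≤ lowWeight al q η * midWeight al be q p ζ + lowWeight al q η * midWeight al be q p ζ
          + midWeight al be q p η * lowWeight al q ζ
          + midWeight al be q p η * lowWeight al q ζ := by gcongr
      _ = _ := by ring
  have hD : midWeight al be q p (η + ζ) - midWeight al be q p η - midWeight al be q p ζ
      ≤ ((η.2 + ζ.2) ^ p - η.2 ^ p - ζ.2 ^ p) + (η.1 * ζ.2 ^ be + ζ.1 * η.2 ^ be) := by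
    simp only [midWeight, Prod.fst_add, Prod.snd_add]
    linarith
  have := mul_le_mul_of_nonneg_left hD hk
  rw [mul_add] at this
  linarith

theorem powerKernel_mul_topWeight_le (hη : η ∈ Quad) (hζ : ζ ∈ Quad) :
    powerKernel al be η ζ * (topWeight al be q p m (η + ζ) - topWeight al be q p m η
        - topWeight al be q p m ζ)
      ≤ (2 * p * 2 ^ (p - 1) + 2 + 2 * m * 2 ^ (m - 1))
        * (midWeight al be q p η * topWeight al be q p m ζ
          + topWeight al be q p m η * midWeight al be q p ζ) := by
  have hmid := powerKernel_mul_midWeight_le hE hη hζ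
  obtain ⟨hal, hal1, hbe, hbe1, hab, h2, hmp, hmq⟩ := hE
  have hx := hη.2
  have hy := hζ.2
  have ha := hη.1
  have hb := hζ.1
  have l1 := lowWeight_nonneg (al := al) (q := q) hη
  have l2 := lowWeight_nonneg (al := al) (q := q) hζ
  have lm1 := lowWeight_le_midWeight (al := al) (q := q) (be := be) (p := p) hη
  have lm2 := lowWeight_le_midWeight (al := al) (q := q) (be := be) (p := p) hζ
  have m1 := l1.trans lm1
  have m2 := l2.trans lm2
  have mt1 := midWeight_le_topWeight (al := al) (q := q) (be := be) (p := p) (m := m) hη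
  have mt2 := midWeight_le_topWeight (al := al) (q := q) (be := be) (p := p) (m := m) hζ
  have t1 := m1.trans mt1
  have t2 := m2.trans mt2
  have hk : 0 ≤ powerKernel al be η ζ := by rw [powerKernel]; positivity
  have key : ∀ {ξ : ℝ × ℝ}, ξ ∈ Quad → ∀ {e : ℝ}, -1 ≤ e → e ≤ 1 →
      ξ.1 ^ (m - 1) * ξ.2 ^ e ≤ topWeight al be q p m ξ := by
    intro ξ hξ e h1 h2
    have h3 := rpow_sub_one_mul_le hξ.1 (rpow_pos_of_pos hξ.2 e) (show 1 ≤ m by linarith)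
    rw [← rpow_mul hξ.2.le] at h3
    have h4 : ξ.2 ^ (e * m) ≤ midWeight al be q p ξ :=
      rpow_le_midWeight hξ (by nlinarith) (by nlinarith)
    rw [topWeight]
    linarith
  have hAk : powerKernel al be η ζ * (η.1 * ζ.1 ^ (m - 1) + ζ.1 * η.1 ^ (m - 1))
      ≤ 2 * (midWeight al be q p η * topWeight al be q p m ζ
          + topWeight al be q p m η * midWeight al be q p ζ) := by
    have e : powerKernel al be η ζ * (η.1 * ζ.1 ^ (m - 1) + ζ.1 * η.1 ^ (m - 1))
        = (η.1 * η.2 ^ (-al)) * (ζ.1 ^ (m - 1) * ζ.2 ^ be)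
          + (η.1 * η.2 ^ be) * (ζ.1 ^ (m - 1) * ζ.2 ^ (-al))
          + (η.1 ^ (m - 1) * η.2 ^ (-al)) * (ζ.1 * ζ.2 ^ be)
          + (η.1 ^ (m - 1) * η.2 ^ be) * (ζ.1 * ζ.2 ^ (-al)) := by
      rw [powerKernel]
      ring
    rw [e]
    have := (mul_rpow_le_lowWeight (al := al) (q := q) hη).trans lm1
    have := (mul_rpow_le_lowWeight (al := al) (q := q) hζ).trans lm2
    have := mul_rpow_le_midWeight (al := al) (be := be) (q := q) (p := p) hη
    have := mul_rpow_le_midWeight (al := al) (be := be) (q := q) (p := p) hζ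
    have := key hη (e := be) (by linarith) hbe1.le
    have := key hζ (e := be) (by linarith) hbe1.le
    have := key hη (e := -al) (by linarith) (by linarith)
    have := key hζ (e := -al) (by linarith) (by linarith)
    calc _ ≤ midWeight al be q p η * topWeight al be q p m ζ
          + midWeight al be q p η * topWeight al be q p m ζ
          + topWeight al be q p m η * midWeight al be q p ζ
          + topWeight al be q p m η * midWeight al be q p ζ := by gcongr
      _ = _ := by ring
  have hA := add_rpow_sub_le_symm ha hb (show 1 ≤ m by linarith)
  have hA2 := mul_le_mul_of_nonneg_left hA hk
  have hm0 : 0 ≤ m * 2 ^ (m - 1) := by positivity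
  have hA3 := mul_le_mul_of_nonneg_left hAk hm0
  have hmt : (2 * p * 2 ^ (p - 1) + 2) * (lowWeight al q η * midWeight al be q p ζ
        + midWeight al be q p η * lowWeight al q ζ) ≤ (2 * p * 2 ^ (p - 1) + 2)
        * (midWeight al be q p η * topWeight al be q p m ζ
          + topWeight al be q p m η * midWeight al be q p ζ) := by
    have : 0 ≤ p := by linarith
    gcongr
  have hD : topWeight al be q p m (η + ζ) - topWeight al be q p m η - topWeight al be q p m ζ
      = (midWeight al be q p (η + ζ) - midWeight al be q p η - midWeight al be q p ζ)
        + ((η.1 + ζ.1) ^ m - η.1 ^ m - ζ.1 ^ m) := by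
    simp only [topWeight, Prod.fst_add]
    ring
  rw [hD, mul_add]
  linarith

end MomentWeights

theorem c0_pos : 0 < c0 := by unfold c0; positivity

theorem isoRegion_subset_quad : IsoRegion ⊆ Quad := fun _ hp =>
  ⟨lt_of_lt_of_le (mul_pos c0_pos (rpow_pos_of_pos hp.1 _)) hp.2, hp.1⟩

theorem isOpen_quad : IsOpen Quad :=
  (isOpen_lt continuous_const continuous_fst).inter (isOpen_lt continuous_const continuous_snd)

theorem continuous_c0_mul_rpow : Continuous fun p : ℝ × ℝ => c0 * p.2 ^ ((2 : ℝ) / 3) :=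
  continuous_const.mul (continuous_snd.rpow_const fun _ => Or.inr (by norm_num))

theorem isClosed_isoperimetric : IsClosed {p : ℝ × ℝ | c0 * p.2 ^ ((2 : ℝ) / 3) ≤ p.1} :=
  isClosed_le continuous_c0_mul_rpow continuous_fst

theorem isLocallyClosed_isoRegion : IsLocallyClosed IsoRegion :=
  ⟨{p | 0 < p.2}, _, isOpen_lt continuous_const continuous_snd, isClosed_isoperimetric, rfl⟩

theorem measurableSet_isoRegion : MeasurableSet IsoRegion :=
  (isOpen_lt continuous_const continuous_snd).measurableSet.inter
    isClosed_isoperimetric.measurableSet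

theorem add_mem_isoRegion {p p' : ℝ × ℝ} (h : p ∈ IsoRegion) (h' : p' ∈ IsoRegion) :
    p + p' ∈ IsoRegion := by
  refine ⟨add_pos h.1 h'.1, ?_⟩
  have h1 := rpow_add_le_add_rpow h.1.le h'.1.le (show (0 : ℝ) ≤ 2 / 3 by norm_num) (by norm_num)
  have h2 := mul_le_mul_of_nonneg_left h1 c0_pos.le
  rw [mul_add] at h2
  exact h2.trans (add_le_add h.2 h'.2)

instance : LocallyCompactSpace IsoRegion := isLocallyClosed_isoRegion.locallyCompactSpace

instance : PolishSpace IsoRegion := by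
  have hU : IsOpen {p : ℝ × ℝ | 0 < p.2} := isOpen_lt continuous_const continuous_snd
  have := hU.polishSpace
  have hsub : IsoRegion ⊆ {p : ℝ × ℝ | 0 < p.2} := fun _ hp => hp.1
  refine Topology.IsClosedEmbedding.polishSpace (f := inclusion hsub)
    ⟨Topology.IsEmbedding.inclusion hsub, ?_⟩
  convert! isClosed_isoperimetric.preimage
    (continuous_subtype_val : Continuous (Subtype.val : {p : ℝ × ℝ | 0 < p.2} → ℝ × ℝ)) using 1
  rw [range_inclusion]
  ext p
  exact ⟨fun h => h.2, fun h => ⟨p.2, h⟩⟩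

/-- Addition on the isoperimetric region. -/
def isoAdd : C(IsoRegion × IsoRegion, IsoRegion) where
  toFun p := ⟨p.1.1 + p.2.1, add_mem_isoRegion p.1.2 p.2.2⟩
  continuous_toFun := by fun_prop


section Weights

variable {al be q p m : ℝ}

/-- The continuity of a power of the volume on the isoperimetric region. -/
theorem continuous_snd_rpow (e : ℝ) : Continuous fun x : IsoRegion => x.1.2 ^ e :=
  (continuous_snd.comp continuous_subtype_val).rpow_const fun x => Or.inl x.2.1.ne'

theorem continuous_fst_rpow (e : ℝ) : Continuous fun x : IsoRegion => x.1.1 ^ e :=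
  (continuous_fst.comp continuous_subtype_val).rpow_const fun x =>
    Or.inl (isoRegion_subset_quad x.2).1.ne'

theorem continuous_lowWeight : Continuous fun x : IsoRegion => lowWeight al q x.1 := by
  have h1 := continuous_snd_rpow (-q)
  have h2 := continuous_snd_rpow (-al)
  unfold lowWeight
  fun_prop

theorem continuous_midWeight : Continuous fun x : IsoRegion => midWeight al be q p x.1 := by
  have h1 := continuous_lowWeight (al := al) (q := q)
  have h2 := continuous_snd_rpow p
  have h3 := continuous_snd_rpow be
  unfold midWeight
  fun_prop

theorem continuous_topWeight : Continuous fun x : IsoRegion => topWeight al be q p m x.1 := by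
  have h1 := continuous_midWeight (al := al) (be := be) (q := q) (p := p)
  have h2 := continuous_fst_rpow m
  unfold topWeight
  fun_prop

theorem one_le_lowWeight (hq : 0 ≤ q) {η : ℝ × ℝ} (h : η ∈ Quad) : 1 ≤ lowWeight al q η := by
  have := rpow_le_lowWeight (al := al) (q := q) h (e := 0) (by linarith) zero_le_one
  rwa [rpow_zero] at this

theorem isProperWeight_topWeight (hE : IsMomentExponents al be q p m) :
    IsProperWeight fun x : IsoRegion => topWeight al be q p m x.1 where
  continuous := continuous_topWeight
  one_le x := by
    have hx := isoRegion_subset_quad x.2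
    exact (one_le_lowWeight (by linarith [hE.two_le, hE.m_le_q]) hx).trans
      ((lowWeight_le_midWeight hx).trans (midWeight_le_topWeight hx))
  isCompact_le L := by
    obtain ⟨-, -, -, -, -, h2, hmp, hmq⟩ := hE
    set N := max L 1
    have hN : 0 < N := lt_max_of_lt_right one_pos
    have hK : IsCompact (Icc ((0 : ℝ), N⁻¹) (N, N) ∩
          {η : ℝ × ℝ | c0 * η.2 ^ ((2 : ℝ) / 3) ≤ η.1}) :=
      isCompact_Icc.inter_right isClosed_isoperimetric
    have hsub : Icc ((0 : ℝ), N⁻¹) (N, N) ∩ {η : ℝ × ℝ | c0 * η.2 ^ ((2 : ℝ) / 3) ≤ η.1}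
        ⊆ IsoRegion := fun η hη => ⟨(inv_pos.2 hN).trans_le hη.1.1.2, hη.2⟩
    refine ((Topology.IsInducing.subtypeVal.isCompact_preimage_iff
      (by rwa [Subtype.range_coe])).2 hK).of_isClosed_subset
      (isClosed_le continuous_topWeight continuous_const) ?_
    rintro ⟨⟨a, v⟩, hx⟩ hL
    obtain ⟨ha, hv⟩ := isoRegion_subset_quad hx
    simp only [Set.mem_ofPred_eq, topWeight, midWeight, lowWeight] at hL ha hv
    have t1 : 0 ≤ a * v ^ (-al) := by positivity
    have t2 : 0 ≤ a * v ^ be := by positivity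
    have t3 : 0 ≤ v ^ (-q) := by positivity
    have t4 : 0 ≤ v ^ p := by positivity
    have t5 : 0 ≤ a ^ m := by positivity
    have hLN : L ≤ N := le_max_left _ _
    have h1N : 1 ≤ N := le_max_right _ _
    have ha' : a ≤ N := by
      rcases le_total a 1 with h | h
      · linarith
      · have := rpow_le_rpow_of_exponent_le h (show 1 ≤ m by linarith)
        rw [rpow_one] at this; linarith
    have hv2 : N⁻¹ ≤ v := by
      rw [inv_le_comm₀ hN hv]
      rcases le_total v 1 with h | h
      · have := rpow_le_rpow_of_exponent_ge hv h (show -q ≤ -1 by linarith)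
        rw [rpow_neg_one] at this; linarith
      · exact (inv_le_one_of_one_le₀ h).trans h1N
    exact ⟨⟨⟨ha.le, hv2⟩, ⟨ha', by linarith⟩⟩, hx.2⟩

end Weights

/-- Continuously differentiable functions with compact support which vanish off the quadrant. -/
structure IsQuadTest (φ : ℝ × ℝ → ℝ) : Prop where
  contDiff : ContDiff ℝ 1 φ
  hasCompactSupport : HasCompactSupport φ
  eq_zero : ∀ p ∉ Quad, φ p = 0

section Separation

open Classical in
/-- A countable family of bump functions in the quadrant with rational centers and radii. -/
noncomputable def quadBump (i : (ℚ × ℚ) × ℚ) : ℝ × ℝ → ℝ :=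
  if h : 0 < i.2 ∧ Metric.ball ((i.1.1 : ℝ), (i.1.2 : ℝ)) i.2 ⊆ Quad then
    (ContDiffBump.mk (c := ((i.1.1 : ℝ), (i.1.2 : ℝ))) (i.2 / 2 : ℝ) (i.2 : ℝ)
      (by have : (0 : ℝ) < i.2 := by exact_mod_cast h.1
          positivity)
      (by have : (0 : ℝ) < i.2 := by exact_mod_cast h.1
          linarith) : ContDiffBump ((i.1.1 : ℝ), (i.1.2 : ℝ)))
  else 0

theorem isQuadTest_quadBump (i : (ℚ × ℚ) × ℚ) : IsQuadTest (quadBump i) := by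
  unfold quadBump
  split_ifs with h
  · refine ⟨ContDiffBump.contDiff _, ContDiffBump.hasCompactSupport _, fun p hp => ?_⟩
    rw [← Function.notMem_support, ContDiffBump.support_eq]
    exact fun h' => hp (h.2 h')
  · exact ⟨contDiff_const, HasCompactSupport.zero, fun _ _ => rfl⟩

theorem quadBump_mem_Icc (i : (ℚ × ℚ) × ℚ) (p : ℝ × ℝ) : quadBump i p ∈ Icc (0 : ℝ) 1 := by
  unfold quadBump
  split_ifs with h
  · exact ⟨ContDiffBump.nonneg _, ContDiffBump.le_one _⟩
  · simp

theorem exists_quadBump {U : Set (ℝ × ℝ)} (hU : IsOpen U) {x : ℝ × ℝ} (hx : x ∈ U)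
    (hxQ : x ∈ Quad) : ∃ i, quadBump i x ≠ 0 ∧ Function.support (quadBump i) ⊆ U := by
  obtain ⟨ε, hε, hsub⟩ := Metric.isOpen_iff.1 (hU.inter isOpen_quad) x ⟨hx, hxQ⟩
  obtain ⟨ρ, hρ0, hρ⟩ := exists_rat_btwn (half_pos hε)
  have hdense : DenseRange (Prod.map ((↑) : ℚ → ℝ) ((↑) : ℚ → ℝ)) :=
    Rat.denseRange_cast.prodMap Rat.denseRange_cast
  obtain ⟨c, hc⟩ := hdense.exists_dist_lt x hρ0
  have hρ0' : 0 < ρ := by exact_mod_cast hρ0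
  have hball : Metric.ball ((c.1 : ℝ), (c.2 : ℝ)) ρ ⊆ U ∩ Quad := by
    refine Subset.trans (fun y hy => ?_) hsub
    rw [Metric.mem_ball] at hy ⊢
    calc dist y x ≤ dist y ((c.1 : ℝ), (c.2 : ℝ)) + dist x ((c.1 : ℝ), (c.2 : ℝ)) :=
          dist_triangle_right _ _ _
      _ < ρ + ρ := add_lt_add hy hc
      _ < ε := by linarith
  have h : 0 < ρ ∧ Metric.ball ((c.1 : ℝ), (c.2 : ℝ)) ρ ⊆ Quad :=
    ⟨hρ0', hball.trans inter_subset_right⟩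
  have hsupp : Function.support (quadBump (c, ρ)) = Metric.ball ((c.1 : ℝ), (c.2 : ℝ)) ρ := by
    unfold quadBump
    rw [dif_pos h, ContDiffBump.support_eq]
  refine ⟨(c, ρ), ?_, ?_⟩
  · rw [← Function.mem_support, hsupp]; exact hc
  · rw [hsupp]; exact hball.trans inter_subset_left

/-- A countable family of test functions separating measures. -/
noncomputable def quadSep (i : Finset ((ℚ × ℚ) × ℚ) × ℕ) (p : ℝ × ℝ) : ℝ :=
  1 - ∏ j ∈ i.1, (1 - quadBump j p) ^ i.2

theorem isQuadTest_quadSep (i : Finset ((ℚ × ℚ) × ℚ) × ℕ) : IsQuadTest (quadSep i) := by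
  refine ⟨?_, ?_, fun p hp => ?_⟩
  · refine contDiff_const.sub (contDiff_prod fun j _ => ?_)
    exact (contDiff_const.sub (isQuadTest_quadBump j).contDiff).pow _
  · have hK : IsCompact (⋃ j ∈ i.1, tsupport (quadBump j)) :=
      i.1.isCompact_biUnion fun j _ => (isQuadTest_quadBump j).hasCompactSupport
    refine HasCompactSupport.intro hK fun p hp => ?_
    rw [quadSep, Finset.prod_eq_one, sub_self]
    intro j hj
    have : quadBump j p = 0 := image_eq_zero_of_notMem_tsupport fun h =>
      hp (mem_biUnion hj h)
    rw [this]; simp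
  · rw [quadSep, Finset.prod_eq_one, sub_self]
    intro j _
    rw [(isQuadTest_quadBump j).eq_zero p hp]; simp

theorem eq_of_integral_quadSep_eq {μ ν : FiniteMeasure IsoRegion}
    (h : ∀ i, ∫ x : IsoRegion, quadSep i x.1 ∂(μ : Measure IsoRegion)
      = ∫ x : IsoRegion, quadSep i x.1 ∂(ν : Measure IsoRegion)) : μ = ν := by
  refine FiniteMeasure.eq_of_integral_bump_eq (g := fun i (x : IsoRegion) => quadBump i x.1)
    (fun i => (isQuadTest_quadBump i).contDiff.continuous.comp continuous_subtype_val)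
    (fun i x => (quadBump_mem_Icc i x.1).1) (fun i x => (quadBump_mem_Icc i x.1).2) ?_
    fun F k => h (F, k)
  rintro U hU x hx
  obtain ⟨V, hV, rfl⟩ := isOpen_induced_iff.1 hU
  obtain ⟨i, hi, hi'⟩ := exists_quadBump hV hx (isoRegion_subset_quad x.2)
  exact ⟨i, hi, fun y hy => hi' hy⟩

end Separation

section AreaDerivative

variable {φ : ℝ × ℝ → ℝ}

theorem da_eq_fderiv (hφ : ContDiff ℝ 1 φ) (p : ℝ × ℝ) : da φ p = fderiv ℝ φ p (1, 0) := by
  have h1 : HasDerivAt (fun a : ℝ => (a, p.2)) (1, 0) p.1 :=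
    (hasDerivAt_id p.1).prodMk (hasDerivAt_const p.1 p.2)
  exact ((hφ.differentiable one_ne_zero p).hasFDerivAt.comp_hasDerivAt p.1 h1).deriv

theorem hasDerivAt_da (hφ : ContDiff ℝ 1 φ) (p : ℝ × ℝ) :
    HasDerivAt (fun a => φ (a, p.2)) (da φ p) p.1 := by
  have h1 : HasDerivAt (fun a : ℝ => (a, p.2)) (1, 0) p.1 :=
    (hasDerivAt_id p.1).prodMk (hasDerivAt_const p.1 p.2)
  exact ((hφ.differentiable one_ne_zero p).hasFDerivAt.comp_hasDerivAt p.1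
    h1).differentiableAt.hasDerivAt

theorem continuous_da (hφ : ContDiff ℝ 1 φ) : Continuous (da φ) := by
  have : da φ = fun p => fderiv ℝ φ p (1, 0) := funext (da_eq_fderiv hφ)
  rw [this]
  exact (hφ.continuous_fderiv one_ne_zero).clm_apply continuous_const

theorem da_eq_zero (hφ : ContDiff ℝ 1 φ) {p : ℝ × ℝ} (hp : p ∉ tsupport φ) : da φ p = 0 := by
  rw [da_eq_fderiv hφ, image_eq_zero_of_notMem_tsupport fun h => hp (tsupport_fderiv_subset ℝ h)]
  rfl

theorem IsQuadTest.exists_area_bound (hφ : IsQuadTest φ) :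
    ∃ A > 0, ∀ p : ℝ × ℝ, A < p.1 → da φ p = 0 := by
  obtain ⟨A, hA, hsub⟩ := hφ.hasCompactSupport.isBounded.subset_closedBall_lt 0 0
  refine ⟨A, hA, fun p hp => da_eq_zero hφ.contDiff fun h => ?_⟩
  have := hsub h
  rw [mem_closedBall_zero_iff] at this
  have h2 := norm_fst_le p
  rw [Real.norm_eq_abs] at h2
  linarith [le_abs_self p.1]

theorem IsQuadTest.exists_bound (hφ : IsQuadTest φ) : ∃ M, 0 ≤ M ∧ ∀ p, |φ p| ≤ M := by
  obtain ⟨M, hM⟩ := hφ.hasCompactSupport.exists_bound_of_continuous hφ.contDiff.continuous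
  exact ⟨M, (abs_nonneg (φ 0)).trans (hM 0), hM⟩

theorem IsQuadTest.exists_da_bound (hφ : IsQuadTest φ) : ∃ M, 0 ≤ M ∧ ∀ p, |da φ p| ≤ M := by
  have hc : HasCompactSupport (da φ) := HasCompactSupport.intro hφ.hasCompactSupport
    fun p hp => da_eq_zero hφ.contDiff hp
  obtain ⟨M, hM⟩ := hc.exists_bound_of_continuous (continuous_da hφ.contDiff)
  exact ⟨M, (abs_nonneg (da φ 0)).trans (hM 0), hM⟩

end AreaDerivative

section AreaShift

/-- The excess of area over that of a ball. -/
noncomputable def excess (η : ℝ × ℝ) : ℝ := η.1 - c0 * η.2 ^ ((2 : ℝ) / 3)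

theorem continuous_excess : Continuous excess := continuous_fst.sub continuous_c0_mul_rpow

theorem excess_nonneg (x : IsoRegion) : 0 ≤ excess x.1 := sub_nonneg.2 x.2.2

theorem excess_le (x : IsoRegion) : excess x.1 ≤ x.1.1 :=
  sub_le_self _ (mul_nonneg c0_pos.le (rpow_nonneg x.2.1.le _))

/-- The saturated fusion rate. -/
noncomputable def satRate (ρ : IsoRegion → ℝ) (δ : ℝ) (x : IsoRegion) : ℝ :=
  ρ x / (1 + 2 * |δ| * ρ x)

variable {ρ : IsoRegion → ℝ} (hρ : ∀ x, 0 ≤ ρ x) {δ : ℝ} {x : IsoRegion}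

include hρ

theorem satRate_nonneg : 0 ≤ satRate ρ δ x := by
  have := hρ x
  unfold satRate; positivity

theorem satRate_le : satRate ρ δ x ≤ ρ x :=
  div_le_self (hρ x) (by have := hρ x; linarith [show 0 ≤ 2 * |δ| * ρ x by positivity])

theorem abs_mul_satRate_le : |δ| * satRate ρ δ x ≤ 1 / 2 := by
  have := hρ x
  unfold satRate
  rw [← mul_div_assoc, div_le_iff₀ (by positivity)]
  linarith [show 0 ≤ 2 * |δ| * ρ x by positivity]

/-- Decrease of the excess area by the fraction `θ |δ| satRate ρ δ`. -/
theorem shift_mem {θ : ℝ} (hθ : θ ∈ Icc (0 : ℝ) 1) :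
    (x.1.1 - θ * (|δ| * satRate ρ δ x) * excess x.1, x.1.2) ∈ IsoRegion := by
  refine ⟨x.2.1, ?_⟩
  have h1 := abs_mul_satRate_le hρ (δ := δ) (x := x)
  have h2 : 0 ≤ |δ| * satRate ρ δ x := mul_nonneg (abs_nonneg _) (satRate_nonneg hρ)
  have h3 := excess_nonneg x
  have h4 : θ * (|δ| * satRate ρ δ x) * excess x.1 ≤ 1 * excess x.1 := by
    gcongr
    nlinarith [hθ.1, hθ.2]
  have h5 : excess x.1 = x.1.1 - c0 * x.1.2 ^ ((2 : ℝ) / 3) := rfl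
  dsimp only
  linarith

theorem half_le_shift {θ : ℝ} (hθ : θ ∈ Icc (0 : ℝ) 1) :
    x.1.1 / 2 ≤ x.1.1 - θ * (|δ| * satRate ρ δ x) * excess x.1 := by
  have h1 := abs_mul_satRate_le hρ (δ := δ) (x := x)
  have h2 : 0 ≤ |δ| * satRate ρ δ x := mul_nonneg (abs_nonneg _) (satRate_nonneg hρ)
  have h3 := excess_nonneg x
  have h4 : θ * (|δ| * satRate ρ δ x) * excess x.1 ≤ (1 / 2) * excess x.1 := by
    gcongr
    nlinarith [hθ.1, hθ.2]
  linarith [excess_le x]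

omit hρ

/-- The jump which discretizes fusion. -/
noncomputable def areaJump (ρ : IsoRegion → ℝ) (hρ : ∀ x, 0 ≤ ρ x) (δ : ℝ) (x : IsoRegion) :
    IsoRegion :=
  ⟨(x.1.1 - 1 * (|δ| * satRate ρ δ x) * excess x.1, x.1.2), shift_mem hρ (by simp)⟩

/-- The difference quotient of `φ` along `areaJump`. -/
noncomputable def jumpQuotient (ρ : IsoRegion → ℝ) (φ : ℝ × ℝ → ℝ) (δ : ℝ) (x : IsoRegion) : ℝ :=
  -(satRate ρ δ x * excess x.1)
    * ∫ θ in (0 : ℝ)..1, da φ (x.1.1 - θ * (|δ| * satRate ρ δ x) * excess x.1, x.1.2)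

end AreaShift

section JumpQuotient

variable {ρ : IsoRegion → ℝ} {φ : ℝ × ℝ → ℝ}

theorem continuous_satRate (hρ : ∀ x, 0 ≤ ρ x) (hc : Continuous ρ) :
    Continuous fun p : ℝ × IsoRegion => satRate ρ p.1 p.2 := by
  unfold satRate
  refine Continuous.div (by fun_prop) (by fun_prop) fun p => ?_
  have := hρ p.2
  positivity

theorem continuous_jumpQuotient (hρ : ∀ x, 0 ≤ ρ x) (hc : Continuous ρ) (hφ : ContDiff ℝ 1 φ) :
    Continuous fun p : ℝ × IsoRegion => jumpQuotient ρ φ p.1 p.2 := by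
  have h1 := continuous_satRate hρ hc
  have h2 := continuous_excess
  have h3 := continuous_da hφ
  unfold jumpQuotient
  refine Continuous.mul (by fun_prop) ?_
  refine intervalIntegral.continuous_parametric_intervalIntegral_of_continuous'
    (f := fun (p : ℝ × IsoRegion) (θ : ℝ) => da φ (p.2.1.1 - θ * (|p.1| * satRate ρ p.1 p.2)
      * excess p.2.1, p.2.1.2)) ?_ 0 1
  refine h3.comp ?_
  have h4 : Continuous fun q : (ℝ × IsoRegion) × ℝ => satRate ρ q.1.1 q.1.2 :=
    h1.comp continuous_fst
  fun_prop

theorem jumpQuotient_zero (x : IsoRegion) :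
    jumpQuotient ρ φ 0 x = -(ρ x * excess x.1) * da φ x.1 := by
  simp [jumpQuotient, satRate]

theorem continuous_areaJump (hρ : ∀ x, 0 ≤ ρ x) (hc : Continuous ρ) (δ : ℝ) :
    Continuous (areaJump ρ hρ δ) := by
  have h1 : Continuous fun x => satRate ρ δ x :=
    (continuous_satRate hρ hc).comp (continuous_const.prodMk continuous_id)
  have h2 := continuous_excess
  unfold areaJump
  fun_prop

theorem mul_jumpQuotient (hρ : ∀ x, 0 ≤ ρ x) (hφ : ContDiff ℝ 1 φ) {δ : ℝ} (hδ : 0 < δ)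
    (x : IsoRegion) :
    δ * jumpQuotient ρ φ δ x = φ (areaJump ρ hρ δ x).1 - φ x.1 := by
  have hda := continuous_da hφ
  set s := (|δ| * satRate ρ δ x) * excess x.1 with hs
  have hder : ∀ θ ∈ uIcc (0 : ℝ) 1, HasDerivAt (fun θ : ℝ => φ (x.1.1 - θ * s, x.1.2))
      (da φ (x.1.1 - θ * s, x.1.2) * (-s)) θ := by
    intro θ _
    have h1 := hasDerivAt_da hφ (x.1.1 - θ * s, x.1.2)
    have h2 : HasDerivAt (fun θ : ℝ => x.1.1 - θ * s) (-s) θ := by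
      simpa using ((hasDerivAt_id θ).mul_const s).const_sub x.1.1
    exact h1.comp θ h2
  have hint := intervalIntegral.integral_eq_sub_of_hasDerivAt hder
    (Continuous.intervalIntegrable (by fun_prop) _ _)
  rw [intervalIntegral.integral_mul_const] at hint
  have e1 : φ (x.1.1 - 0 * s, x.1.2) = φ x.1 := by simp
  have e2 : (areaJump ρ hρ δ x).1 = (x.1.1 - 1 * s, x.1.2) := by
    simp [areaJump, hs]
  rw [e1, ← e2] at hint
  rw [← hint]
  unfold jumpQuotient
  simp_rw [mul_assoc _ (|δ| * satRate ρ δ x) (excess x.1), ← hs]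
  rw [abs_of_pos hδ] at hs
  rw [hs]; ring

theorem abs_jumpQuotient_le (hρ : ∀ x, 0 ≤ ρ x) {A M : ℝ} (hA0 : 0 < A) (hM : ∀ p, |da φ p| ≤ M)
    (hA : ∀ p : ℝ × ℝ, A < p.1 → da φ p = 0) {R mu sg : ℝ} (hR : 0 ≤ R) (hmu : 0 ≤ mu)
    (hρR : ∀ x : IsoRegion, ρ x ≤ R * x.1.1 ^ mu * x.1.2 ^ sg) (δ : ℝ) (x : IsoRegion) :
    |jumpQuotient ρ φ δ x| ≤ R * (2 * A) ^ (mu + 1) * M * x.1.2 ^ sg := by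
  have hM0 : 0 ≤ M := (abs_nonneg _).trans (hM 0)
  have hx := isoRegion_subset_quad x.2
  have hv : 0 < x.1.2 ^ sg := rpow_pos_of_pos hx.2 _
  by_cases h : 2 * A < x.1.1
  · have h0 : ∫ θ in (0 : ℝ)..1,
        da φ (x.1.1 - θ * (|δ| * satRate ρ δ x) * excess x.1, x.1.2) = 0 := by
      refine intervalIntegral.integral_zero_ae (ae_of_all _ fun θ hθ => ?_)
      rw [uIoc_of_le zero_le_one] at hθ
      have := half_le_shift hρ (δ := δ) (x := x) ⟨hθ.1.le, hθ.2⟩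
      exact hA _ (by dsimp only; linarith)
    rw [jumpQuotient, h0, mul_zero, abs_zero]
    positivity
  · push Not at h
    have h1 : |∫ θ in (0 : ℝ)..1,
        da φ (x.1.1 - θ * (|δ| * satRate ρ δ x) * excess x.1, x.1.2)| ≤ M := by
      have := intervalIntegral.norm_integral_le_of_norm_le_const (a := (0 : ℝ)) (b := 1) (C := M)
        (f := fun θ => da φ (x.1.1 - θ * (|δ| * satRate ρ δ x) * excess x.1, x.1.2))
        fun θ _ => hM _
      simpa using this
    have h2 : |satRate ρ δ x * excess x.1| ≤ R * (2 * A) ^ (mu + 1) * x.1.2 ^ sg := by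
      rw [abs_of_nonneg (mul_nonneg (satRate_nonneg hρ) (excess_nonneg x))]
      calc satRate ρ δ x * excess x.1 ≤ (R * x.1.1 ^ mu * x.1.2 ^ sg) * x.1.1 :=
            mul_le_mul ((satRate_le hρ).trans (hρR x)) (excess_le x) (excess_nonneg x)
              (by have := rpow_pos_of_pos hx.1 mu; positivity)
        _ = R * x.1.1 ^ (mu + 1) * x.1.2 ^ sg := by
            rw [rpow_add_one hx.1.ne']; ring
        _ ≤ _ := by
            have := rpow_le_rpow hx.1.le h (show 0 ≤ mu + 1 by linarith)
            gcongr
    rw [jumpQuotient, neg_mul, abs_neg, abs_mul]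
    calc _ ≤ (R * (2 * A) ^ (mu + 1) * x.1.2 ^ sg) * M := by gcongr
      _ = _ := by ring

end JumpQuotient

section WeightsAlongJumps

variable {al be q p m : ℝ} {ρ : IsoRegion → ℝ} (hρ : ∀ x, 0 ≤ ρ x) (δ : ℝ) (x : IsoRegion)

theorem areaJump_fst_le : (areaJump ρ hρ δ x).1.1 ≤ x.1.1 := by
  have h2 : 0 ≤ |δ| * satRate ρ δ x := mul_nonneg (abs_nonneg _) (satRate_nonneg hρ)
  have h3 := mul_nonneg h2 (excess_nonneg x)
  have : (areaJump ρ hρ δ x).1.1 = x.1.1 - 1 * (|δ| * satRate ρ δ x) * excess x.1 := rfl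
  rw [this, one_mul]
  linarith

theorem lowWeight_areaJump_le : lowWeight al q (areaJump ρ hρ δ x).1 ≤ lowWeight al q x.1 := by
  have h1 := areaJump_fst_le hρ δ x
  have h2 : (areaJump ρ hρ δ x).1.2 = x.1.2 := rfl
  have h3 := rpow_nonneg x.2.1.le (-al)
  rw [lowWeight, lowWeight, h2]
  gcongr

theorem midWeight_areaJump_le :
    midWeight al be q p (areaJump ρ hρ δ x).1 ≤ midWeight al be q p x.1 := by
  have h1 := areaJump_fst_le hρ δ x
  have h2 : (areaJump ρ hρ δ x).1.2 = x.1.2 := rfl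
  have h3 := rpow_nonneg x.2.1.le be
  have h4 := lowWeight_areaJump_le (al := al) (q := q) hρ δ x
  rw [midWeight, midWeight, h2]
  gcongr

theorem topWeight_areaJump_le (hm : 0 ≤ m) :
    topWeight al be q p m (areaJump ρ hρ δ x).1 ≤ topWeight al be q p m x.1 := by
  have h1 := areaJump_fst_le hρ δ x
  have h4 := midWeight_areaJump_le (al := al) (be := be) (q := q) (p := p) hρ δ x
  have h5 := (isoRegion_subset_quad (areaJump ρ hρ δ x).2).1.le
  rw [topWeight, topWeight]
  gcongr

end WeightsAlongJumps

/-- Sampling a jointly continuous function along a convergent net of parameters gives convergence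
in the compact-open topology. -/
theorem tendsto_slice {Y X Z ι : Type*} [TopologicalSpace Y] [TopologicalSpace X]
    [TopologicalSpace Z] {F : Y → X → Z} (hF : Continuous fun p : Y × X => F p.1 p.2)
    {G : Y → C(X, Z)} (hG : ∀ y x, G y x = F y x) {l : Filter ι} {s : ι → Y} {y : Y}
    (hs : Tendsto s l (𝓝 y)) : Tendsto (fun i => G (s i)) l (𝓝 (G y)) := by
  have h : G = ContinuousMap.curry ⟨fun p : Y × X => F p.1 p.2, hF⟩ := by
    ext y x
    simp [hG]
  rw [h]
  exact ((ContinuousMap.curry _).continuous.tendsto y).comp hs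

section Kernel

variable {K : ℝ × ℝ → ℝ × ℝ → ℝ} {K₀ K₁ al be q p m : ℝ}

theorem IsCoagKernel.isMomentExponents (hK : IsCoagKernel K K₀ K₁ al be) (h2 : 2 ≤ m)
    (hmp : m ≤ p) (hmq : m ≤ q) : IsMomentExponents al be q p m :=
  ⟨hK.al_pos, by linarith [hK.be_sub_al_mem.1, hK.be_mem.2], hK.be_mem.1, hK.be_mem.2,
    by linarith [hK.be_sub_al_mem.1], h2, hmp, hmq⟩

theorem IsCoagKernel.K0_pos (hK : IsCoagKernel K K₀ K₁ al be) : 0 < K₀ :=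
  hK.K1_pos.trans_le hK.K1_le_K0

theorem powerKernel_nonneg {η ζ : ℝ × ℝ} (hη : η ∈ Quad) (hζ : ζ ∈ Quad) :
    0 ≤ powerKernel al be η ζ := by
  have := hη.2; have := hζ.2
  rw [powerKernel]; positivity

theorem IsCoagKernel.nonneg (hK : IsCoagKernel K K₀ K₁ al be) {η ζ : ℝ × ℝ} (hη : η ∈ Quad)
    (hζ : ζ ∈ Quad) : 0 ≤ K η ζ :=
  (mul_nonneg hK.K1_pos.le (powerKernel_nonneg hη hζ)).trans (hK.lower η hη ζ hζ)

/-- The restriction of the kernel to the isoperimetric region, as a continuous map. -/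
def IsCoagKernel.iso (hK : IsCoagKernel K K₀ K₁ al be) : C(IsoRegion × IsoRegion, ℝ) where
  toFun p := K p.1.1 p.2.1
  continuous_toFun := hK.cont.comp_continuous
    (f := fun p : IsoRegion × IsoRegion => (p.1.1, p.2.1)) (by fun_prop)
    fun p => ⟨isoRegion_subset_quad p.1.2, isoRegion_subset_quad p.2.2⟩

theorem IsCoagKernel.iso_nonneg (hK : IsCoagKernel K K₀ K₁ al be) (x : IsoRegion × IsoRegion) :
    0 ≤ hK.iso x :=
  hK.nonneg (isoRegion_subset_quad x.1.2) (isoRegion_subset_quad x.2.2)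

theorem IsCoagKernel.iso_le (hK : IsCoagKernel K K₀ K₁ al be) (x : IsoRegion × IsoRegion) :
    hK.iso x ≤ K₀ * powerKernel al be x.1.1 x.2.1 :=
  hK.upper _ (isoRegion_subset_quad x.1.2) _ (isoRegion_subset_quad x.2.2)

/-- The kernel truncated at height `1 / |s|`. -/
noncomputable def IsCoagKernel.trunc (hK : IsCoagKernel K K₀ K₁ al be) (s : ℝ) :
    C(IsoRegion × IsoRegion, ℝ) where
  toFun x := hK.iso x / (1 + |s| * hK.iso x)
  continuous_toFun := by
    refine Continuous.div (by fun_prop) (by fun_prop) fun x => ?_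
    have := hK.iso_nonneg x
    positivity

theorem IsCoagKernel.trunc_apply (hK : IsCoagKernel K K₀ K₁ al be) (s : ℝ)
    (x : IsoRegion × IsoRegion) : hK.trunc s x = hK.iso x / (1 + |s| * hK.iso x) := rfl

theorem IsCoagKernel.trunc_zero (hK : IsCoagKernel K K₀ K₁ al be) : hK.trunc 0 = hK.iso := by
  ext x
  simp [IsCoagKernel.trunc_apply]

theorem IsCoagKernel.trunc_nonneg (hK : IsCoagKernel K K₀ K₁ al be) (s : ℝ)
    (x : IsoRegion × IsoRegion) : 0 ≤ hK.trunc s x := by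
  have := hK.iso_nonneg x
  rw [hK.trunc_apply]
  positivity

theorem IsCoagKernel.trunc_le (hK : IsCoagKernel K K₀ K₁ al be) (s : ℝ)
    (x : IsoRegion × IsoRegion) : hK.trunc s x ≤ hK.iso x := by
  have := hK.iso_nonneg x
  exact div_le_self this (by linarith [show 0 ≤ |s| * hK.iso x by positivity])

theorem IsCoagKernel.trunc_le_inv (hK : IsCoagKernel K K₀ K₁ al be) {s : ℝ} (hs : 0 < s)
    (x : IsoRegion × IsoRegion) : hK.trunc s x ≤ s⁻¹ := by
  have h := hK.iso_nonneg x
  rw [hK.trunc_apply, abs_of_pos hs, div_le_iff₀ (by positivity), mul_add, ← mul_assoc,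
    inv_mul_cancel₀ hs.ne']
  have := inv_pos.2 hs
  linarith

theorem IsCoagKernel.trunc_symm (hK : IsCoagKernel K K₀ K₁ al be) (s : ℝ) (x y : IsoRegion) :
    hK.trunc s (x, y) = hK.trunc s (y, x) := by
  have : hK.iso (x, y) = hK.iso (y, x) := hK.symm _ _
  rw [hK.trunc_apply, hK.trunc_apply, this]

theorem IsCoagKernel.tendsto_trunc (hK : IsCoagKernel K K₀ K₁ al be) {ι : Type*} {l : Filter ι}
    {s : ι → ℝ} (hs : Tendsto s l (𝓝 0)) :
    Tendsto (fun i => hK.trunc (s i)) l (𝓝 hK.iso) := by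
  rw [← hK.trunc_zero]
  refine tendsto_slice (F := fun s x => hK.iso x / (1 + |s| * hK.iso x)) ?_ (fun _ _ => rfl) hs
  refine Continuous.div (by fun_prop) (by fun_prop) fun p => ?_
  have := hK.iso_nonneg p.2
  positivity

theorem rpow_sq_le_topWeight {η : ℝ × ℝ} (h : η ∈ Quad)
    {e : ℝ} (h1 : -q ≤ 2 * e) (h2 : 2 * e ≤ p) : (η.2 ^ e) ^ 2 ≤ topWeight al be q p m η := by
  rw [← rpow_natCast, ← rpow_mul h.2.le, mul_comm e]
  exact (rpow_le_midWeight h (by simpa using h1) (by simpa using h2)).trans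
    (midWeight_le_topWeight h)

theorem powerKernel_sq_le (hE : IsMomentExponents al be q p m) {η ζ : ℝ × ℝ} (hη : η ∈ Quad)
    (hζ : ζ ∈ Quad) : powerKernel al be η ζ ^ 2
      ≤ 4 * (topWeight al be q p m η * topWeight al be q p m ζ) := by
  obtain ⟨hal, hal1, hbe, hbe1, hab, h2, hmp, hmq⟩ := id hE
  have a1 := rpow_sq_le_topWeight (al := al) (be := be) (q := q) (p := p) (m := m) hη
    (e := -al) (by linarith) (by linarith)
  have a2 := rpow_sq_le_topWeight (al := al) (be := be) (q := q) (p := p) (m := m) hζ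
    (e := -al) (by linarith) (by linarith)
  have b1 := rpow_sq_le_topWeight (al := al) (be := be) (q := q) (p := p) (m := m) hη
    (e := be) (by linarith) (by linarith)
  have b2 := rpow_sq_le_topWeight (al := al) (be := be) (q := q) (p := p) (m := m) hζ
    (e := be) (by linarith) (by linarith)
  have c1 := mul_le_mul a1 b2 (sq_nonneg _) ((sq_nonneg _).trans a1)
  have c2 := mul_le_mul b1 a2 (sq_nonneg _) ((sq_nonneg _).trans b1)
  rw [powerKernel]
  nlinarith [sq_nonneg (η.2 ^ (-al) * ζ.2 ^ be - ζ.2 ^ (-al) * η.2 ^ be)]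

theorem IsCoagKernel.iso_sq_le (hK : IsCoagKernel K K₀ K₁ al be)
    (hE : IsMomentExponents al be q p m) (x : IsoRegion × IsoRegion) :
    hK.iso x ^ 2 ≤ 4 * K₀ ^ 2
      * (topWeight al be q p m x.1.1 * topWeight al be q p m x.2.1) := by
  have h1 := powerKernel_sq_le hE (isoRegion_subset_quad x.1.2) (isoRegion_subset_quad x.2.2)
  calc hK.iso x ^ 2 ≤ (K₀ * powerKernel al be x.1.1 x.2.1) ^ 2 :=
        pow_le_pow_left₀ (hK.iso_nonneg x) (hK.iso_le x) 2
    _ = K₀ ^ 2 * powerKernel al be x.1.1 x.2.1 ^ 2 := by ring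
    _ ≤ K₀ ^ 2 * (4 * (topWeight al be q p m x.1.1 * topWeight al be q p m x.2.1)) := by gcongr
    _ = _ := by ring

/-- A truncated kernel times a defect is controlled by the power kernel times the defect. -/
theorem IsCoagKernel.trunc_mul_le (hK : IsCoagKernel K K₀ K₁ al be) {s b d : ℝ}
    {x : IsoRegion × IsoRegion} (h : powerKernel al be x.1.1 x.2.1 * d ≤ b) (hb : 0 ≤ b) :
    hK.trunc s x * d ≤ K₀ * b := by
  have hK0 := hK.K0_pos
  rcases le_total d 0 with hd | hd
  · exact (mul_nonpos_of_nonneg_of_nonpos (hK.trunc_nonneg s x) hd).trans (by positivity)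
  · calc hK.trunc s x * d ≤ K₀ * powerKernel al be x.1.1 x.2.1 * d := by
          gcongr
          exact (hK.trunc_le s x).trans (hK.iso_le x)
      _ ≤ K₀ * b := by rw [mul_assoc]; gcongr

end Kernel

section Existence

variable {K : ℝ × ℝ → ℝ × ℝ → ℝ} {K₀ K₁ al be q p m : ℝ}

/-- The growth constant of the moments. -/
noncomputable def growthConst (K₀ p m : ℝ) : ℝ :=
  K₀ * (2 * p * 2 ^ (p - 1) + 2 + 2 * m * 2 ^ (m - 1))

/-- The bound on the top moment at time `t`, in terms of its initial value `X`. -/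
noncomputable def momentBound (c X t : ℝ) : ℝ≥0 :=
  (Real.exp (c * (Real.exp (c * X * t) * X) * t) * X).toNNReal

theorem momentBound_mono {c X t t' : ℝ} (hc : 0 ≤ c) (hX : 0 ≤ X) (ht : 0 ≤ t) (h : t ≤ t') :
    momentBound c X t ≤ momentBound c X t' := by
  unfold momentBound
  gcongr

theorem growthConst_nonneg (hK₀ : 0 ≤ K₀) (hp : 0 ≤ p) (hm : 0 ≤ m) : 0 ≤ growthConst K₀ p m := by
  unfold growthConst; positivity

/-- The flux of a test function under fusion with rate `ρ`. -/
noncomputable def fusionFlux (ρ : IsoRegion → ℝ) (φ : ℝ × ℝ → ℝ) (x : IsoRegion) : ℝ :=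
  -(ρ x * excess x.1) * da φ x.1

theorem momentSet_of_trajectory (hK : IsCoagKernel K K₀ K₁ al be)
    (hE : IsMomentExponents al be q p m) {ρ : IsoRegion → ℝ} (hρ : ∀ x, 0 ≤ ρ x) {s δ h lam κ M : ℝ}
    (H : IsStepData (hK.trunc s) isoAdd (areaJump ρ hρ δ) h lam κ M)
    {μ : ℕ → FiniteMeasure IsoRegion} (hM : ∀ j, (μ j : Measure IsoRegion).real univ ≤ M)
    (hμ : ∀ j, (μ (j + 1) : Measure IsoRegion)
      = coagStep (hK.trunc s) isoAdd (areaJump ρ hρ δ) h lam (μ j)) {X : ℝ} (hX : 0 ≤ X)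
    (hX₀ : ∫⁻ x : IsoRegion, ENNReal.ofReal (topWeight al be q p m x.1)
      ∂(μ 0 : Measure IsoRegion) ≤ ENNReal.ofReal X)
    {j : ℕ} {t : ℝ} (hj : j * h ≤ t) :
    μ j ∈ momentSet (fun x : IsoRegion => topWeight al be q p m x.1)
      (momentBound (growthConst K₀ p m) X t) := by
  obtain ⟨hal, hal1, hbe, hbe1, hab, h2, hmp, hmq⟩ := id hE
  have hK0 := hK.K0_pos
  have hQ : ∀ x : IsoRegion, x.1 ∈ Quad := fun x => isoRegion_subset_quad x.2
  have l0 : ∀ x : IsoRegion, 0 ≤ lowWeight al q x.1 := fun x => lowWeight_nonneg (hQ x)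
  have l1 : ∀ x : IsoRegion, lowWeight al q x.1 ≤ midWeight al be q p x.1 := fun x =>
    lowWeight_le_midWeight (hQ x)
  have l2 : ∀ x : IsoRegion, midWeight al be q p x.1 ≤ topWeight al be q p m x.1 := fun x =>
    midWeight_le_topWeight (hQ x)
  have b1 : ∀ x y : IsoRegion, 0 ≤ lowWeight al q x.1 * midWeight al be q p y.1
      + midWeight al be q p x.1 * lowWeight al q y.1 := fun x y => by
    have := l0 x; have := l0 y; have := (l0 x).trans (l1 x); have := (l0 y).trans (l1 y)
    positivity
  have b2 : ∀ x y : IsoRegion, 0 ≤ midWeight al be q p x.1 * topWeight al be q p m y.1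
      + topWeight al be q p m x.1 * midWeight al be q p y.1 := fun x y => by
    have := (l0 x).trans (l1 x); have := (l0 y).trans (l1 y)
    have := this.trans (l2 y); have := ((l0 x).trans (l1 x)).trans (l2 x)
    positivity
  have hp0 : 0 ≤ p := by linarith
  have hm0 : 0 ≤ m := by linarith
  have hc := growthConst_nonneg hK0.le (show 0 ≤ p by linarith) (show 0 ≤ m by linarith)
  have key := H.moment_trajectory_le hM hμ
    (w₁ := fun x => lowWeight al q x.1) (w₂ := fun x => midWeight al be q p x.1)
    (w₃ := fun x => topWeight al be q p m x.1) continuous_lowWeight.measurable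
    continuous_midWeight.measurable continuous_topWeight.measurable l0 l1 l2
    (lowWeight_areaJump_le hρ δ) (midWeight_areaJump_le hρ δ)
    (fun x => topWeight_areaJump_le hρ δ x (by linarith)) hc hX ?_ ?_ ?_ hX₀ hj
  · exact key
  · intro x
    have := lowWeight_add_le (al := al) (q := q) (by linarith) hal.le (hQ x.1) (hQ x.2)
    exact mul_nonpos_of_nonneg_of_nonpos (hK.trunc_nonneg s x)
      (by change lowWeight al q (x.1.1 + x.2.1) - _ - _ ≤ 0; linarith)
  · intro x
    have h1 := powerKernel_mul_midWeight_le hE (hQ x.1) (hQ x.2)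
    refine (hK.trunc_mul_le h1 ?_).trans ?_
    · exact mul_nonneg (by positivity) (b1 _ _)
    · rw [← mul_assoc]
      refine mul_le_mul_of_nonneg_right ?_ (b1 _ _)
      unfold growthConst
      have : 0 ≤ 2 * m * 2 ^ (m - 1) := by positivity
      exact mul_le_mul_of_nonneg_left (by linarith) hK0.le
  · intro x
    have h1 := powerKernel_mul_topWeight_le hE (hQ x.1) (hQ x.2)
    refine (hK.trunc_mul_le h1 ?_).trans ?_
    · exact mul_nonneg (by positivity) (b2 _ _)
    · rw [← mul_assoc]; rfl

/-- Existence for the fusion-coagulation equation, tested against stationary functions. -/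
theorem exists_fusion_curve (hK : IsCoagKernel K K₀ K₁ al be)
    (hE : IsMomentExponents al be q p m) {ρ : IsoRegion → ℝ} (hρ : ∀ x, 0 ≤ ρ x)
    (hρc : Continuous ρ) {R mu sg : ℝ} (hR : 0 ≤ R) (hmu : 0 ≤ mu)
    (hρR : ∀ x : IsoRegion, ρ x ≤ R * x.1.1 ^ mu * x.1.2 ^ sg) (hs1 : -q ≤ 2 * sg)
    (hs2 : 2 * sg ≤ p) (μ₀ : FiniteMeasure IsoRegion) {X : ℝ} (hX : 0 ≤ X)
    (hX₀ : ∫⁻ x : IsoRegion, ENNReal.ofReal (topWeight al be q p m x.1)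
      ∂(μ₀ : Measure IsoRegion) ≤ ENNReal.ofReal X) :
    ∃ f : ℝ → FiniteMeasure IsoRegion, Continuous f ∧ f 0 = μ₀ ∧
      (∀ t, 0 ≤ t → f t ∈ momentSet (fun x : IsoRegion => topWeight al be q p m x.1)
        (momentBound (growthConst K₀ p m) X t)) ∧
      ∀ φ, IsQuadTest φ → ∀ t, 0 ≤ t →
        ∫ x : IsoRegion, φ x.1 ∂(f t : Measure IsoRegion)
          - ∫ x : IsoRegion, φ x.1 ∂(μ₀ : Measure IsoRegion)
        = ∫ s in (0 : ℝ)..t, coagGen hK.iso isoAdd (fun x => φ x.1) (fusionFlux ρ φ) (f s) := by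
  have hΩ := isProperWeight_topWeight hE
  let M : ℝ := (μ₀.mass : ℝ)
  have hM0 : 0 ≤ M := μ₀.mass.2
  let δ : ℕ → ℝ := fun n => 1 / ((n : ℝ) + 1)
  have hδ : ∀ n, 0 < δ n := fun n => by positivity
  have hδ0 : Tendsto δ atTop (𝓝 0) := tendsto_one_div_add_atTop_nhds_zero_nat
  let h : ℕ → ℝ := fun n => δ n / (1 + M)
  have hh : ∀ n, 0 < h n := fun n => div_pos (hδ n) (by positivity)
  have hh0 : Tendsto h atTop (𝓝 0) := by
    simpa using hδ0.div_const (1 + M)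
  have H : ∀ n, IsStepData (hK.trunc (δ n)) isoAdd (areaJump ρ hρ (δ n)) (h n) (δ n)⁻¹
      (δ n)⁻¹ M := fun n =>
    { meas_k := (hK.trunc (δ n)).continuous.measurable
      meas_add := isoAdd.continuous.measurable
      meas_T := (continuous_areaJump hρ hρc (δ n)).measurable
      symm := hK.trunc_symm _
      nonneg := hK.trunc_nonneg _
      le := hK.trunc_le_inv (hδ n)
      h_nonneg := (hh n).le
      lam_nonneg := (inv_pos.2 (hδ n)).le
      small := by
        have := (hδ n).ne'
        have : 1 + M ≠ 0 := by positivity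
        refine le_of_eq ?_
        simp only [h]
        field_simp }
  choose μ hμ0 hμM hμ using fun n => (H n).exists_trajectory μ₀ le_rfl
  let Φ : {φ // IsQuadTest φ} → C(IsoRegion, ℝ) := fun φ =>
    ⟨fun x => φ.1 x.1, φ.2.contDiff.continuous.comp continuous_subtype_val⟩
  let g : ℝ → {φ // IsQuadTest φ} → C(IsoRegion, ℝ) := fun d φ =>
    ⟨jumpQuotient ρ φ.1 d, (continuous_jumpQuotient hρ hρc φ.2.contDiff).comp
      (continuous_const.prodMk continuous_id)⟩
  choose B hB0 hB using fun φ : {φ // IsQuadTest φ} => φ.2.exists_bound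
  choose D hD0 hD using fun φ : {φ // IsQuadTest φ} => φ.2.exists_da_bound
  choose A hA0 hA using fun φ : {φ // IsQuadTest φ} => φ.2.exists_area_bound
  have hgsq : ∀ n φ x, g (δ n) φ x ^ 2
      ≤ (R * (2 * A φ) ^ (mu + 1) * D φ) ^ 2 * topWeight al be q p m x.1 := by
    intro n φ x
    have h1 := abs_jumpQuotient_le hρ (hA0 φ) (hD φ) (hA φ) hR hmu hρR (δ n) x
    have h2 := rpow_sq_le_topWeight (al := al) (be := be) (m := m) (isoRegion_subset_quad x.2)
      hs1 hs2
    calc (jumpQuotient ρ φ.1 (δ n) x) ^ 2 = |jumpQuotient ρ φ.1 (δ n) x| ^ 2 := (sq_abs _).symm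
      _ ≤ (R * (2 * A φ) ^ (mu + 1) * D φ * x.1.2 ^ sg) ^ 2 := by gcongr
      _ = (R * (2 * A φ) ^ (mu + 1) * D φ) ^ 2 * (x.1.2 ^ sg) ^ 2 := by ring
      _ ≤ _ := by gcongr
  have hglim : ∀ φ, Tendsto (fun n => g (δ n) φ) atTop (𝓝 (g 0 φ)) := fun φ =>
    tendsto_slice (continuous_jumpQuotient hρ hρc φ.2.contDiff)
      (G := fun d => g d φ) (fun _ _ => rfl) hδ0
  have hstep : ∀ n j φ, ∫ x, Φ φ x ∂(μ n (j + 1) : Measure IsoRegion)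
      = ∫ x, Φ φ x ∂(μ n j : Measure IsoRegion)
        + h n * coagGen (hK.trunc (δ n)) isoAdd (Φ φ) (g (δ n) φ) (μ n j) := by
    intro n j φ
    rw [hμ, (H n).integral_coagStep (Φ φ).continuous.measurable (fun x => hB φ x.1) (hμM n j)]
    have : ∀ x, (δ n)⁻¹ * (Φ φ (areaJump ρ hρ (δ n) x) - Φ φ x) = g (δ n) φ x := fun x => by
      rw [inv_mul_eq_iff_eq_mul₀ (hδ n).ne']
      exact (mul_jumpQuotient hρ φ.2.contDiff (hδ n) x).symm
    simp_rw [this]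
    rfl
  obtain ⟨f, hf, hf0, hfm, hfe⟩ := hΩ.exists_curve_of_euler isoAdd
    (k := fun n => hK.trunc (δ n)) (hK.tendsto_trunc hδ0) (c := 4 * K₀ ^ 2) (by positivity)
    (fun n x => (pow_le_pow_left₀ (hK.trunc_nonneg _ x) (hK.trunc_le _ x) 2).trans
      (hK.iso_sq_le hE x)) hh hh0 hμ0 (C := momentBound (growthConst K₀ p m) X)
    (fun n j t _ hj => momentSet_of_trajectory hK hE hρ (H n) (hμM n) (hμ n) hX
      (by rw [hμ0]; exact hX₀) hj)
    (Φ := Φ) (G := g 0) (g := fun n => g (δ n)) (fun φ x => hB φ x.1)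
    (M := fun φ => (R * (2 * A φ) ^ (mu + 1) * D φ) ^ 2) (fun φ => sq_nonneg _)
    hgsq hglim hstep (e := fun i => ⟨_, isQuadTest_quadSep i⟩)
    (fun μ ν hμν => eq_of_integral_quadSep_eq hμν)
  refine ⟨f, hf, hf0, hfm, fun φ hφ t ht => ?_⟩
  have hG : ∀ x, g 0 ⟨φ, hφ⟩ x = fusionFlux ρ φ x := jumpQuotient_zero
  have := hfe ⟨φ, hφ⟩ t ht
  rw [show (⇑(g 0 ⟨φ, hφ⟩) : IsoRegion → ℝ) = fusionFlux ρ φ from funext hG] at this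
  exact this

end Existence

theorem hasDerivAt_diag {F F₁ F₂ : ℝ → ℝ → ℝ} {U : Set ℝ} (hU : IsOpen U)
    (h₁ : ∀ s, ∀ u ∈ U, HasDerivAt (fun s => F s u) (F₁ s u) s)
    (h₂ : ∀ s, ∀ u ∈ U, HasDerivAt (fun u => F s u) (F₂ s u) u)
    (c₁ : Continuous fun p : ℝ × ℝ => F₁ p.1 p.2) (c₂ : Continuous fun p : ℝ × ℝ => F₂ p.1 p.2)
    {t : ℝ} (ht : t ∈ U) : HasDerivAt (fun t => F t t) (F₁ t t + F₂ t t) t := by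
  have hev : ∀ᶠ v in 𝓝 (t, t), v.2 ∈ U :=
    (continuous_snd.tendsto (t, t)).eventually (hU.mem_nhds ht)
  have hs := hasStrictFDerivAt_uncurry_coprod (𝕜 := ℝ) (u := (t, t)) (f := F)
    (f₁ := fun a b => ContinuousLinearMap.toSpanSingleton ℝ (F₁ a b))
    (f₂ := fun a b => ContinuousLinearMap.toSpanSingleton ℝ (F₂ a b))
    (hev.mono fun v hv => (h₁ v.1 v.2 hv).hasFDerivAt)
    (hev.mono fun v hv => (h₂ v.1 v.2 hv).hasFDerivAt)
    ((ContinuousLinearMap.toSpanSingletonCLE.continuous.comp c₁).continuousAt)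
    ((ContinuousLinearMap.toSpanSingletonCLE.continuous.comp c₂).continuousAt)
  have hd : HasDerivAt (fun t : ℝ => (t, t)) ((1 : ℝ), (1 : ℝ)) t :=
    (hasDerivAt_id t).prodMk (hasDerivAt_id t)
  have := HasFDerivAt.comp_hasDerivAt (f := fun t : ℝ => (t, t)) t hs.hasFDerivAt hd
  convert! this using 1
  simp [Function.HasUncurry.uncurry]

section TimeDependent

variable {E : Type*} [TopologicalSpace E] [MeasurableSpace E] [BorelSpace E] [PolishSpace E]
  [LocallyCompactSpace E] {Ω : E → ℝ} {C : ℝ≥0}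

theorem IsProperWeight.continuous_coagGen (hΩ : IsProperWeight Ω) {f : ℝ → FiniteMeasure E}
    (hf : Continuous f) (hfC : ∀ s, f s ∈ momentSet Ω C) (join : C(E × E, E)) {K : C(E × E, ℝ)}
    {c : ℝ} (hKc : ∀ p, K p ^ 2 ≤ c * (Ω p.1 * Ω p.2)) {Φ G : ℝ → C(E, ℝ)} (hΦ : Continuous Φ)
    (hG : Continuous G) {B M : ℝ} (hB : ∀ s x, |Φ s x| ≤ B) (hM : ∀ s x, G s x ^ 2 ≤ M * Ω x) :
    Continuous fun p : ℝ × ℝ => coagGen K join (Φ p.1) (G p.1) (f p.2) :=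
  continuous_iff_continuousAt.2 fun p => hΩ.tendsto_coagGen (fun q : ℝ × ℝ => hfC q.2)
    ((hf.comp continuous_snd).tendsto p) join (k := fun _ => K) tendsto_const_nhds (fun _ => hKc)
    ((hΦ.comp continuous_fst).tendsto p) ((hG.comp continuous_fst).tendsto p)
    (fun q => hB q.1) (fun q => hM q.1)

theorem IsProperWeight.continuous_integral (hΩ : IsProperWeight Ω) {f : ℝ → FiniteMeasure E}
    (hf : Continuous f) (hfC : ∀ s, f s ∈ momentSet Ω C) {Φ : ℝ → C(E, ℝ)} (hΦ : Continuous Φ)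
    {B : ℝ} (hB : ∀ s x, |Φ s x| ≤ B) :
    Continuous fun p : ℝ × ℝ => ∫ x, Φ p.1 x ∂(f p.2 : Measure E) :=
  continuous_iff_continuousAt.2 fun p => hΩ.tendsto_integral (fun q : ℝ × ℝ => hfC q.2)
    ((hf.comp continuous_snd).tendsto p) ((hΦ.comp continuous_fst).tendsto p) (M := B ^ 2)
    fun q x => by
      have h1 := pow_le_pow_left₀ (abs_nonneg _) (hB q.1 x) 2
      rw [sq_abs] at h1
      nlinarith [hΩ.one_le x, sq_nonneg B]

/-- A stationary weak formulation implies the time-dependent one. -/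
theorem IsProperWeight.integral_sub_eq_of_stationary (hΩ : IsProperWeight Ω)
    {f : ℝ → FiniteMeasure E} (hf : Continuous f) (hfC : ∀ s, f s ∈ momentSet Ω C)
    (join : C(E × E, E)) {K : C(E × E, ℝ)} {c : ℝ} (hKc : ∀ p, K p ^ 2 ≤ c * (Ω p.1 * Ω p.2))
    {Φ Φ' G : ℝ → C(E, ℝ)} (hΦ : Continuous Φ) (hΦ' : Continuous Φ') (hG : Continuous G)
    {B B' M : ℝ} (hB : ∀ s x, |Φ s x| ≤ B) (hB' : ∀ s x, |Φ' s x| ≤ B')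
    (hM : ∀ s x, G s x ^ 2 ≤ M * Ω x) (hder : ∀ s x, HasDerivAt (fun s => Φ s x) (Φ' s x) s)
    {T : ℝ} (hT : 0 ≤ T) (heq : ∀ s, ∀ t ∈ Icc 0 T, ∫ x, Φ s x ∂(f t : Measure E)
      - ∫ x, Φ s x ∂(f 0 : Measure E) = ∫ u in (0 : ℝ)..t, coagGen K join (Φ s) (G s) (f u)) :
    ∫ x, Φ T x ∂(f T : Measure E) - ∫ x, Φ 0 x ∂(f 0 : Measure E)
      = (∫ s in (0 : ℝ)..T, ∫ x, Φ' s x ∂(f s : Measure E))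
        + ∫ s in (0 : ℝ)..T, coagGen K join (Φ s) (G s) (f s) := by
  have c₀ := hΩ.continuous_integral hf hfC hΦ hB
  have c₁ := hΩ.continuous_integral hf hfC hΦ' hB'
  have c₂ := hΩ.continuous_coagGen hf hfC join hKc hΦ hG hB hM
  have hdiag : Continuous fun s : ℝ => (s, s) := continuous_id.prodMk continuous_id
  have hint : ∀ s (μ : FiniteMeasure E), Integrable (Φ s) (μ : Measure E) := fun s μ =>
    Integrable.of_bound (Φ s).continuous.measurable.aestronglyMeasurable B
      (ae_of_all _ fun x => (Real.norm_eq_abs _).trans_le (hB s x))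
  have h₁ : ∀ s, ∀ u ∈ Ioo 0 T, HasDerivAt (fun s => ∫ x, Φ s x ∂(f u : Measure E))
      (∫ x, Φ' s x ∂(f u : Measure E)) s := fun s u _ =>
    (hasDerivAt_integral_of_dominated_loc_of_deriv_le (μ := (f u : Measure E))
      (F := fun s x => Φ s x) (F' := fun s x => Φ' s x) (bound := fun _ => B') (s := univ)
      univ_mem (Eventually.of_forall fun s => (hint s (f u)).aestronglyMeasurable) (hint s (f u))
      (Φ' s).continuous.measurable.aestronglyMeasurable
      (ae_of_all _ fun x r _ => (Real.norm_eq_abs _).trans_le (hB' r x)) (integrable_const _)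
      (ae_of_all _ fun x r _ => hder r x)).2
  have h₂ : ∀ s, ∀ u ∈ Ioo 0 T, HasDerivAt (fun u => ∫ x, Φ s x ∂(f u : Measure E))
      (coagGen K join (Φ s) (G s) (f u)) u := by
    intro s u hu
    have hc : Continuous fun u => coagGen K join (Φ s) (G s) (f u) :=
      c₂.comp (continuous_const.prodMk continuous_id)
    have hd := (hc.integral_hasStrictDerivAt 0 u).hasDerivAt.const_add
      (∫ x, Φ s x ∂(f 0 : Measure E))
    refine hd.congr_of_eventuallyEq ?_
    filter_upwards [isOpen_Ioo.mem_nhds hu] with r hr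
    rw [← heq s r (Ioo_subset_Icc_self hr)]
    ring
  have hint₁ : ∀ a b, IntervalIntegrable (fun s => ∫ x, Φ' s x ∂(f s : Measure E)) volume a b :=
    fun _ _ => (c₁.comp hdiag).intervalIntegrable _ _
  have hint₂ : ∀ a b, IntervalIntegrable (fun s => coagGen K join (Φ s) (G s) (f s)) volume a b :=
    fun _ _ => (c₂.comp hdiag).intervalIntegrable _ _
  rw [← intervalIntegral.integral_add (hint₁ _ _) (hint₂ _ _)]
  exact (intervalIntegral.integral_eq_sub_of_hasDerivAt_of_le hT (c₀.comp hdiag).continuousOn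
    (fun t ht => hasDerivAt_diag (F := fun s u => ∫ x, Φ s x ∂(f u : Measure E))
      (F₁ := fun s u => ∫ x, Φ' s x ∂(f u : Measure E))
      (F₂ := fun s u => coagGen K join (Φ s) (G s) (f u)) isOpen_Ioo h₁ h₂ c₁ c₂ ht)
    ((hint₁ _ _).add (hint₂ _ _))).symm

end TimeDependent

theorem IsProperWeight.integrable_of_sq_le {E : Type*} [TopologicalSpace E] [MeasurableSpace E]
    [BorelSpace E] {Ω : E → ℝ} {C : ℝ≥0} (hΩ : IsProperWeight Ω) {μ : FiniteMeasure E}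
    (hμ : μ ∈ momentSet Ω C) {g : E → ℝ} (hg : AEStronglyMeasurable g (μ : Measure E)) {M : ℝ}
    (hM : ∀ x, g x ^ 2 ≤ M * Ω x) : Integrable g (μ : Measure E) := by
  refine ((hΩ.integrable hμ).const_mul (M + 1)).mono' hg (ae_of_all _ fun x => ?_)
  rw [Real.norm_eq_abs]
  nlinarith [hM x, hΩ.one_le x, sq_abs (g x), sq_nonneg (|g x| - 1)]

section TestFun

variable {ψ : ℝ × (ℝ × ℝ) → ℝ}

theorem IsTestFun.isQuadTest (hψ : IsTestFun ψ) (s : ℝ) : IsQuadTest fun p => ψ (s, p) where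
  contDiff := hψ.1.comp (contDiff_const.prodMk contDiff_id)
  hasCompactSupport := HasCompactSupport.intro (hψ.2.1.image continuous_snd) fun p hp =>
    image_eq_zero_of_notMem_tsupport fun h => hp ⟨(s, p), h, rfl⟩
  eq_zero p hp := hψ.2.2 (s, p) hp

theorem IsTestFun.da_slice (hψ : IsTestFun ψ) (s : ℝ) (p : ℝ × ℝ) :
    da (fun p => ψ (s, p)) p = fderiv ℝ ψ (s, p) (0, (1, 0)) := by
  have h1 : HasDerivAt (fun a : ℝ => (s, (a, p.2))) (0, (1, 0)) p.1 :=
    (hasDerivAt_const p.1 s).prodMk ((hasDerivAt_id p.1).prodMk (hasDerivAt_const p.1 p.2))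
  exact ((hψ.1.differentiable one_ne_zero (s, p)).hasFDerivAt.comp_hasDerivAt p.1 h1).deriv

theorem IsTestFun.hasDerivAt_time (hψ : IsTestFun ψ) (s : ℝ) (p : ℝ × ℝ) :
    HasDerivAt (fun s => ψ (s, p)) (fderiv ℝ ψ (s, p) (1, 0)) s :=
  (hψ.1.differentiable one_ne_zero (s, p)).hasFDerivAt.comp_hasDerivAt s
    ((hasDerivAt_id s).prodMk (hasDerivAt_const s p))

theorem IsTestFun.continuous_fderiv_apply (hψ : IsTestFun ψ) (w : ℝ × (ℝ × ℝ)) :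
    Continuous fun z => fderiv ℝ ψ z w :=
  (hψ.1.continuous_fderiv one_ne_zero).clm_apply continuous_const

theorem IsTestFun.exists_bound (hψ : IsTestFun ψ) : ∃ B, ∀ z, |ψ z| ≤ B :=
  hψ.2.1.exists_bound_of_continuous hψ.1.continuous

theorem IsTestFun.exists_fderiv_bound (hψ : IsTestFun ψ) (w : ℝ × (ℝ × ℝ)) :
    ∃ B, ∀ z, |fderiv ℝ ψ z w| ≤ B :=
  (hψ.2.1.fderiv_apply (𝕜 := ℝ) w).exists_bound_of_continuous (hψ.continuous_fderiv_apply w)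

theorem IsTestFun.exists_area_bound (hψ : IsTestFun ψ) :
    ∃ A > 0, ∀ s, ∀ p : ℝ × ℝ, A < p.1 → da (fun p => ψ (s, p)) p = 0 := by
  obtain ⟨A, hA, hsub⟩ := hψ.2.1.isBounded.subset_closedBall_lt 0 0
  refine ⟨A, hA, fun s p hp => ?_⟩
  have hz : (s, p) ∉ tsupport ψ := fun h => by
    have := hsub h
    rw [mem_closedBall_zero_iff] at this
    have h2 := (norm_fst_le p).trans (norm_snd_le (s, p))
    rw [Real.norm_eq_abs] at h2
    linarith [le_abs_self p.1]
  rw [hψ.da_slice, image_eq_zero_of_notMem_tsupport fun h => hz (tsupport_fderiv_subset ℝ h)]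
  rfl

end TestFun

/-- A finite measure on the isoperimetric region, seen as a measure on the plane. -/
noncomputable def planeMeasure (μ : FiniteMeasure IsoRegion) : Measure (ℝ × ℝ) :=
  (μ : Measure IsoRegion).map Subtype.val

theorem integral_planeMeasure (μ : FiniteMeasure IsoRegion) (g : ℝ × ℝ → ℝ) :
    ∫ η, g η ∂planeMeasure μ = ∫ x, g x.1 ∂(μ : Measure IsoRegion) :=
  (MeasurableEmbedding.subtype_coe measurableSet_isoRegion).integral_map g

theorem lintegral_planeMeasure (μ : FiniteMeasure IsoRegion) (g : ℝ × ℝ → ℝ≥0∞) :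
    ∫⁻ η, g η ∂planeMeasure μ = ∫⁻ x, g x.1 ∂(μ : Measure IsoRegion) :=
  (MeasurableEmbedding.subtype_coe measurableSet_isoRegion).lintegral_map g

theorem isIsoMeasure_planeMeasure (μ : FiniteMeasure IsoRegion) :
    IsIsoMeasure (planeMeasure μ) := by
  rw [IsIsoMeasure, planeMeasure, Measure.map_apply measurable_subtype_coe
    measurableSet_isoRegion.compl]
  simp

section Identity

variable {K : ℝ × ℝ → ℝ × ℝ → ℝ} {K₀ K₁ al be q p m : ℝ}

theorem fusionFlux_sq_le {ρ : IsoRegion → ℝ} (hρ : ∀ x, 0 ≤ ρ x) {φ : ℝ × ℝ → ℝ} {A D : ℝ}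
    (hA0 : 0 < A) (hD : ∀ p, |da φ p| ≤ D) (hA : ∀ p : ℝ × ℝ, A < p.1 → da φ p = 0)
    {R mu sg : ℝ} (hR : 0 ≤ R) (hmu : 0 ≤ mu)
    (hρR : ∀ x : IsoRegion, ρ x ≤ R * x.1.1 ^ mu * x.1.2 ^ sg)
    (hs1 : -q ≤ 2 * sg) (hs2 : 2 * sg ≤ p) (x : IsoRegion) :
    fusionFlux ρ φ x ^ 2 ≤ (R * (2 * A) ^ (mu + 1) * D) ^ 2 * topWeight al be q p m x.1 := by
  have h1 := abs_jumpQuotient_le hρ hA0 hD hA hR hmu hρR 0 x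
  rw [jumpQuotient_zero] at h1
  have h2 := pow_le_pow_left₀ (abs_nonneg _) h1 2
  rw [sq_abs, mul_pow _ (x.1.2 ^ sg)] at h2
  exact h2.trans (mul_le_mul_of_nonneg_left
    (rpow_sq_le_topWeight (isoRegion_subset_quad x.2) hs1 hs2) (sq_nonneg _))

/-- A curve solving the stationary weak formulation satisfies the weak identity against
time-dependent test functions. -/
theorem weakIdentity_of_curve (hK : IsCoagKernel K K₀ K₁ al be)
    (hE : IsMomentExponents al be q p m) {r : ℝ × ℝ → ℝ} {ε : ℝ}
    (hρ : ∀ x : IsoRegion, 0 ≤ ε * r x.1) (hρc : Continuous fun x : IsoRegion => ε * r x.1)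
    {R mu sg : ℝ} (hR : 0 ≤ R) (hmu : 0 ≤ mu)
    (hρR : ∀ x : IsoRegion, ε * r x.1 ≤ R * x.1.1 ^ mu * x.1.2 ^ sg) (hs1 : -q ≤ 2 * sg)
    (hs2 : 2 * sg ≤ p) {T : ℝ} (hT : 0 ≤ T) {f : ℝ → FiniteMeasure IsoRegion}
    (hf : Continuous f) {C : ℝ≥0}
    (hfC : ∀ t ∈ Icc 0 T, f t ∈ momentSet (fun x : IsoRegion => topWeight al be q p m x.1) C)
    (heq : ∀ φ, IsQuadTest φ → ∀ t, 0 ≤ t →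
        ∫ x : IsoRegion, φ x.1 ∂(f t : Measure IsoRegion)
          - ∫ x : IsoRegion, φ x.1 ∂(f 0 : Measure IsoRegion)
        = ∫ s in (0 : ℝ)..t, coagGen hK.iso isoAdd (fun x => φ x.1)
            (fusionFlux (fun x => ε * r x.1) φ) (f s))
    {ψ : ℝ × (ℝ × ℝ) → ℝ} (hψ : IsTestFun ψ) :
    WeakIdentity K r ε (planeMeasure (f 0)) (fun t => planeMeasure (f t)) ψ T := by
  have hΩ := isProperWeight_topWeight hE
  obtain ⟨B, hB⟩ := hψ.exists_bound
  obtain ⟨B', hB'⟩ := hψ.exists_fderiv_bound (1, 0)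
  obtain ⟨D, hD⟩ := hψ.exists_fderiv_bound (0, (1, 0))
  obtain ⟨A, hA0, hA⟩ := hψ.exists_area_bound
  let ρ : IsoRegion → ℝ := fun x => ε * r x.1
  let F : ℝ × IsoRegion → ℝ × (ℝ × ℝ) := fun z => (z.1, z.2.1)
  have hF : Continuous F := by fun_prop
  have hcΦ : Continuous fun z : ℝ × IsoRegion => ψ (z.1, z.2.1) := hψ.1.continuous.comp hF
  have hcΦ' : Continuous fun z : ℝ × IsoRegion => fderiv ℝ ψ (z.1, z.2.1) (1, 0) :=
    (hψ.continuous_fderiv_apply _).comp hF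
  have hcG : Continuous fun z : ℝ × IsoRegion => fusionFlux ρ (fun p => ψ (z.1, p)) z.2 := by
    simp only [fusionFlux, hψ.da_slice]
    have h1 := continuous_excess
    have h2 : Continuous fun z : ℝ × IsoRegion => fderiv ℝ ψ (z.1, z.2.1) (0, (1, 0)) :=
      (hψ.continuous_fderiv_apply _).comp hF
    exact ((hρc.comp continuous_snd).mul (h1.comp
      (continuous_subtype_val.comp continuous_snd))).neg.mul h2
  let Φ : ℝ → C(IsoRegion, ℝ) := ContinuousMap.curry ⟨_, hcΦ⟩
  let Φ' : ℝ → C(IsoRegion, ℝ) := ContinuousMap.curry ⟨_, hcΦ'⟩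
  let G : ℝ → C(IsoRegion, ℝ) := ContinuousMap.curry ⟨_, hcG⟩
  have hΦ : Continuous Φ := (ContinuousMap.curry _).continuous
  have hΦ' : Continuous Φ' := (ContinuousMap.curry _).continuous
  have hG : Continuous G := (ContinuousMap.curry _).continuous
  let f' : ℝ → FiniteMeasure IsoRegion := fun t => f (max 0 (min t T))
  have hf' : Continuous f' := hf.comp (by fun_prop)
  have hff' : ∀ t ∈ Icc 0 T, f' t = f t := fun t ht => by
    simp only [f', min_eq_left ht.2, max_eq_right ht.1]
  have hfC' : ∀ t, f' t ∈ momentSet (fun x : IsoRegion => topWeight al be q p m x.1) C :=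
    fun t => hfC _ ⟨le_max_left _ _, max_le hT (min_le_right _ _)⟩
  have hBx : ∀ s x, |Φ s x| ≤ B := fun s x => hB _
  have hGx : ∀ s x, G s x ^ 2 ≤ (R * (2 * A) ^ (mu + 1) * D) ^ 2
      * topWeight al be q p m (x : ℝ × ℝ) := fun s x =>
    fusionFlux_sq_le hρ hA0 (fun p => by rw [hψ.da_slice]; exact hD _) (hA s) hR hmu hρR hs1 hs2 x
  have hsq := hK.iso_sq_le hE
  have main := hΩ.integral_sub_eq_of_stationary hf' hfC' isoAdd hsq hΦ hΦ' hG hBx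
    (B' := B') (fun s x => hB' _) hGx (fun s x => hψ.hasDerivAt_time s x) hT (by
      intro s t ht
      rw [hff' t ht, hff' 0 ⟨le_rfl, hT⟩]
      refine (heq _ (hψ.isQuadTest s) t ht.1).trans
        (intervalIntegral.integral_congr fun u hu => ?_)
      rw [uIcc_of_le ht.1] at hu
      simp only [hff' u ⟨hu.1, hu.2.trans ht.2⟩]
      rfl)
  have hzero : ∀ s (x : IsoRegion), (0 : ℝ → C(IsoRegion, ℝ)) s x ^ 2
      ≤ 0 * topWeight al be q p m (x : ℝ × ℝ) := fun s x => by simp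
  have hdiag : Continuous fun s : ℝ => (s, s) := continuous_id.prodMk continuous_id
  have i1 : IntervalIntegrable (fun s => coagGen hK.iso isoAdd (Φ s) 0 (f' s)) volume 0 T :=
    ((hΩ.continuous_coagGen hf' hfC' isoAdd hsq hΦ (G := 0) continuous_zero hBx hzero).comp
      hdiag).intervalIntegrable _ _
  have i2 : IntervalIntegrable (fun s => ∫ x, G s x ∂(f' s : Measure IsoRegion)) volume 0 T := by
    have := ((hΩ.continuous_coagGen hf' hfC' isoAdd hsq (Φ := 0) (B := 0) continuous_zero hG
      (by simp) hGx).comp hdiag).intervalIntegrable (μ := volume) 0 T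
    simpa [coagGen, Function.comp_def] using this
  have hsplit : ∫ s in (0 : ℝ)..T, coagGen hK.iso isoAdd (Φ s) (G s) (f' s)
      = (∫ s in (0 : ℝ)..T, coagGen hK.iso isoAdd (Φ s) 0 (f' s))
        + ∫ s in (0 : ℝ)..T, ∫ x, G s x ∂(f' s : Measure IsoRegion) := by
    rw [← intervalIntegral.integral_add i1 i2]
    simp [coagGen]
  rw [hsplit, hff' T ⟨hT, le_rfl⟩, hff' 0 ⟨le_rfl, hT⟩] at main
  rw [WeakIdentity]
  simp only [integral_planeMeasure]
  have e1 : ∫ s in (0 : ℝ)..T, ∫ x : IsoRegion, deriv (fun u => ψ (u, x.1)) s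
      ∂(f s : Measure IsoRegion) = ∫ s in (0 : ℝ)..T, ∫ x, Φ' s x ∂(f' s : Measure IsoRegion) := by
    refine intervalIntegral.integral_congr fun s hs => ?_
    rw [uIcc_of_le hT] at hs
    simp only [hff' s hs, (hψ.hasDerivAt_time _ _).deriv]
    rfl
  have e2 : ∫ s in (0 : ℝ)..T, (1 / 2) * ∫ x : IsoRegion, ∫ y : IsoRegion, K x.1 y.1 *
        (ψ (s, x.1 + y.1) - ψ (s, x.1) - ψ (s, y.1)) ∂(f s : Measure IsoRegion)
          ∂(f s : Measure IsoRegion)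
      = ∫ s in (0 : ℝ)..T, coagGen hK.iso isoAdd (Φ s) 0 (f' s) := by
    refine intervalIntegral.integral_congr fun s hs => ?_
    rw [uIcc_of_le hT] at hs
    simp only [coagGen, hff' s hs, Pi.zero_apply, integral_zero, add_zero]
    rw [integral_prod]
    · rfl
    · have hcont : Continuous fun z : IsoRegion × IsoRegion =>
          hK.iso z * (Φ s (isoAdd z) - Φ s z.1 - Φ s z.2) := by fun_prop
      have := (hΩ.prod hΩ).integrable_of_sq_le
        (prod_mem_momentSet hΩ.continuous.measurable hΩ.one_le (hfC s hs))
        hcont.measurable.aestronglyMeasurable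
        (fun z => mul_sub_sub_sq_le (hsq z) (hBx s _) (hBx s _) (hBx s _))
      simpa using this
  have e3 : ε * ∫ s in (0 : ℝ)..T, ∫ x : IsoRegion, r x.1 * (c0 * x.1.2 ^ ((2 : ℝ) / 3) - x.1.1)
        * da (fun p => ψ (s, p)) x.1 ∂(f s : Measure IsoRegion)
      = ∫ s in (0 : ℝ)..T, ∫ x, G s x ∂(f' s : Measure IsoRegion) := by
    rw [← intervalIntegral.integral_const_mul]
    refine intervalIntegral.integral_congr fun s hs => ?_
    rw [uIcc_of_le hT] at hs
    simp only [hff' s hs]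
    rw [← integral_const_mul]
    refine integral_congr_ae (ae_of_all _ fun x => ?_)
    change _ = -(ε * r x.1 * excess x.1) * da (fun p => ψ (s, p)) x.1
    rw [excess]
    ring
  rw [e1, e2, e3]
  have m1 : ∫ x, Φ T x ∂(f T : Measure IsoRegion) = ∫ x : IsoRegion, ψ (T, x.1)
    ∂(f T : Measure IsoRegion) := rfl
  have m2 : ∫ x, Φ 0 x ∂(f 0 : Measure IsoRegion) = ∫ x : IsoRegion, ψ (0, x.1)
    ∂(f 0 : Measure IsoRegion) := rfl
  linarith

end Identity

section DataWeight

variable {al be sg m : ℝ} {η : ℝ × ℝ}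

/-- The weight whose moment is assumed finite on the initial datum. -/
noncomputable def dataWeight (sg m : ℝ) (η : ℝ × ℝ) : ℝ :=
  η.2 ^ (-m) + η.2 ^ m + η.2 ^ (sg * m) + η.1 ^ m

theorem rpow_le_dataWeight (h : η ∈ Quad) {e : ℝ} (h1 : -m ≤ e) (h2 : e ≤ m) :
    η.2 ^ e ≤ dataWeight sg m η := by
  have h3 := rpow_le_rpow_add_rpow h.2 h1 h2
  have h4 := rpow_pos_of_pos h.2 (sg * m)
  have h5 := rpow_pos_of_pos h.1 m
  rw [dataWeight]
  linarith

theorem one_le_dataWeight (h : η ∈ Quad) (hm : 0 ≤ m) : 1 ≤ dataWeight sg m η := by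
  have := rpow_le_dataWeight (sg := sg) h (e := 0) (by linarith) hm
  rwa [rpow_zero] at this

theorem rpow_mul_le_dataWeight (h : η ∈ Quad) : η.2 ^ (sg * m) ≤ dataWeight sg m η := by
  have h3 := rpow_pos_of_pos h.2 (-m)
  have h4 := rpow_pos_of_pos h.2 m
  have h5 := rpow_pos_of_pos h.1 m
  rw [dataWeight]
  linarith

theorem mul_rpow_le_dataWeight (h : η ∈ Quad) {e : ℝ} (hm : 2 ≤ m) (h1 : -1 ≤ e) (h2 : e ≤ 1) :
    η.1 * η.2 ^ e ≤ 3 * dataWeight sg m η := by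
  have a1 := rpow_le_dataWeight (sg := sg) h (e := 2 * e) (m := m) (by linarith) (by linarith)
  have a2 := one_le_dataWeight (sg := sg) (m := m) h (by linarith)
  have a3 := rpow_le_rpow_add_rpow (e := 2) (q := 0) h.1 (by norm_num) hm
  have a4 : η.1 ^ m ≤ dataWeight sg m η := by
    have h3 := rpow_pos_of_pos h.2 (-m)
    have h4 := rpow_pos_of_pos h.2 m
    have h5 := rpow_pos_of_pos h.2 (sg * m)
    rw [dataWeight]
    linarith
  rw [neg_zero, rpow_zero, rpow_two] at a3
  rw [mul_comm 2 e, rpow_mul h.2.le, rpow_two] at a1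
  nlinarith [sq_nonneg (η.1 - η.2 ^ e)]

theorem dataWeight_le_topWeight (h : η ∈ Quad) (hm : 0 ≤ m) :
    dataWeight sg m η
      ≤ 4 * topWeight al be (max m (-(sg * m))) (max m (sg * m)) m η := by
  have hq := le_max_left m (-(sg * m))
  have hq' := le_max_right m (-(sg * m))
  have hp := le_max_left m (sg * m)
  have hp' := le_max_right m (sg * m)
  have key : ∀ e, -max m (-(sg * m)) ≤ e → e ≤ max m (sg * m) →
      η.2 ^ e ≤ topWeight al be (max m (-(sg * m))) (max m (sg * m)) m η := fun e h1 h2 =>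
    (rpow_le_midWeight h h1 h2).trans (midWeight_le_topWeight h)
  have b1 := key (-m) (by linarith) (by linarith)
  have b2 := key m (by linarith) (by linarith)
  have b3 := key (sg * m) (by linarith) (by linarith)
  have b4 : η.1 ^ m ≤ topWeight al be (max m (-(sg * m))) (max m (sg * m)) m η := by
    have h1 := rpow_pos_of_pos h.2 m
    have h2 := rpow_le_midWeight (al := al) (be := be) h
      (show -max m (-(sg * m)) ≤ m by linarith) hp
    rw [topWeight]
    linarith
  rw [dataWeight]
  linarith

theorem topWeight_le_dataWeight (h : η ∈ Quad) (hm : 2 ≤ m) (hal : 0 < al) (hal' : al < 1)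
    (hbe : 0 < be) (hbe' : be < 1) :
    topWeight al be (max m (-(sg * m))) (max m (sg * m)) m η ≤ 10 * dataWeight sg m η := by
  have b1 : η.2 ^ (-max m (-(sg * m))) ≤ dataWeight sg m η := by
    rcases max_choice m (-(sg * m)) with e | e <;> rw [e]
    · exact rpow_le_dataWeight h le_rfl (by linarith)
    · rw [neg_neg]; exact rpow_mul_le_dataWeight h
  have b2 : η.2 ^ (max m (sg * m)) ≤ dataWeight sg m η := by
    rcases max_choice m (sg * m) with e | e <;> rw [e]
    · exact rpow_le_dataWeight h (by linarith) le_rfl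
    · exact rpow_mul_le_dataWeight h
  have b3 := rpow_le_dataWeight (sg := sg) h (e := 1) (m := m) (by linarith) (by linarith)
  rw [rpow_one] at b3
  have b4 := mul_rpow_le_dataWeight (sg := sg) h (e := -al) hm (by linarith) (by linarith)
  have b5 := mul_rpow_le_dataWeight (sg := sg) h (e := be) hm (by linarith) (by linarith)
  have b6 : η.1 ^ m ≤ dataWeight sg m η := by
    have h3 := rpow_pos_of_pos h.2 (-m)
    have h4 := rpow_pos_of_pos h.2 m
    have h5 := rpow_pos_of_pos h.2 (sg * m)
    rw [dataWeight]
    linarith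
  rw [topWeight, midWeight, lowWeight]
  linarith

end DataWeight

section Observables

theorem IsC0Quad.exists_bound {φ : ℝ × ℝ → ℝ} (hφ : IsC0Quad φ) : ∃ B, ∀ p, |φ p| ≤ B := by
  obtain ⟨S, hS, -, h1⟩ := hφ.2.2 1 one_pos
  obtain ⟨B, hB⟩ := hS.exists_bound_of_continuousOn hφ.1.continuousOn
  refine ⟨max B 1, fun p => ?_⟩
  by_cases hp : p ∈ S
  · exact (hB p hp).trans (le_max_left _ _)
  · exact (h1 p hp).trans (le_max_right _ _)

/-- Integration of a bounded continuous function is continuous on finite measures. -/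
theorem continuous_integral_iso {φ : ℝ × ℝ → ℝ} (hφ : Continuous φ) {B : ℝ}
    (hB : ∀ p, |φ p| ≤ B) :
    Continuous fun μ : FiniteMeasure IsoRegion =>
      ∫ x : IsoRegion, φ x.1 ∂(μ : Measure IsoRegion) := by
  let g : IsoRegion →ᵇ ℝ := BoundedContinuousFunction.ofNormedAddCommGroup
    (fun x : IsoRegion => φ x.1) (hφ.comp continuous_subtype_val) B fun x => hB _
  exact continuous_iff_continuousAt.2 fun μ =>
    FiniteMeasure.tendsto_iff_forall_integral_tendsto.1 tendsto_id g

end Observables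

section Curves

variable {K : ℝ × ℝ → ℝ × ℝ → ℝ} {K₀ K₁ al be q p m : ℝ}

/-- Curves solving the stationary weak formulation are Lipschitz against test functions. -/
theorem abs_integral_sub_le_of_curve (hK : IsCoagKernel K K₀ K₁ al be)
    (hE : IsMomentExponents al be q p m) {ρ : IsoRegion → ℝ}
    (hρ : ∀ x : IsoRegion, 0 ≤ ρ x) (hρc : Continuous ρ)
    {R mu sg : ℝ} (hR : 0 ≤ R) (hmu : 0 ≤ mu)
    (hρR : ∀ x : IsoRegion, ρ x ≤ R * x.1.1 ^ mu * x.1.2 ^ sg) (hs1 : -q ≤ 2 * sg)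
    (hs2 : 2 * sg ≤ p) {T : ℝ} {f : ℝ → FiniteMeasure IsoRegion}
    (hf : Continuous f) {C : ℝ≥0}
    (hfC : ∀ t ∈ Icc 0 T, f t ∈ momentSet (fun x : IsoRegion => topWeight al be q p m x.1) C)
    {φ : ℝ × ℝ → ℝ} (hφ : IsQuadTest φ) (heq : ∀ t, 0 ≤ t →
        ∫ x : IsoRegion, φ x.1 ∂(f t : Measure IsoRegion)
          - ∫ x : IsoRegion, φ x.1 ∂(f 0 : Measure IsoRegion)
        = ∫ s in (0 : ℝ)..t, coagGen hK.iso isoAdd (fun x => φ x.1) (fusionFlux ρ φ) (f s))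
    {A B D : ℝ} (hA0 : 0 < A) (hA : ∀ p : ℝ × ℝ, A < p.1 → da φ p = 0)
    (hB : ∀ p, |φ p| ≤ B) (hD : ∀ p, |da φ p| ≤ D) {s t : ℝ} (hs : s ∈ Icc 0 T)
    (ht : t ∈ Icc 0 T) :
    |∫ x : IsoRegion, φ x.1 ∂(f t : Measure IsoRegion)
        - ∫ x : IsoRegion, φ x.1 ∂(f s : Measure IsoRegion)|
      ≤ ((9 * B ^ 2 * (4 * K₀ ^ 2) + 1) * (C * C)
        + ((R * (2 * A) ^ (mu + 1) * D) ^ 2 + 1) * C) * |t - s| := by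
  have hΩ := isProperWeight_topWeight hE
  have hT : 0 ≤ T := hs.1.trans hs.2
  let Φ : C(IsoRegion, ℝ) := ⟨fun x => φ x.1, hφ.contDiff.continuous.comp continuous_subtype_val⟩
  let G : C(IsoRegion, ℝ) := ⟨fusionFlux ρ φ, by
    have h1 := continuous_excess
    have h2 := continuous_da hφ.contDiff
    unfold fusionFlux
    fun_prop⟩
  have hG : ∀ x, G x ^ 2 ≤ (R * (2 * A) ^ (mu + 1) * D) ^ 2 * topWeight al be q p m (x : ℝ × ℝ) :=
    fun x => fusionFlux_sq_le hρ hA0 hD hA hR hmu hρR hs1 hs2 x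
  have hΦ : ∀ x, |Φ x| ≤ B := fun x => hB _
  have hsq := hK.iso_sq_le hE
  let f' : ℝ → FiniteMeasure IsoRegion := fun t => f (max 0 (min t T))
  have hf' : Continuous f' := hf.comp (by fun_prop)
  have hff' : ∀ t ∈ Icc 0 T, f' t = f t := fun t ht => by
    simp only [f', min_eq_left ht.2, max_eq_right ht.1]
  have hfC' : ∀ t, f' t ∈ momentSet (fun x : IsoRegion => topWeight al be q p m x.1) C :=
    fun t => hfC _ ⟨le_max_left _ _, max_le hT (min_le_right _ _)⟩
  have hcont : Continuous fun u => coagGen hK.iso isoAdd Φ G (f' u) :=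
    (hΩ.continuous_coagGen hf' hfC' isoAdd hsq (Φ := fun _ => Φ) (G := fun _ => G)
      continuous_const continuous_const (fun _ => hΦ) (fun _ => hG)).comp
      (continuous_id.prodMk continuous_id)
  have key : ∀ t ∈ Icc 0 T, ∫ x : IsoRegion, φ x.1 ∂(f t : Measure IsoRegion)
      = ∫ x : IsoRegion, φ x.1 ∂(f 0 : Measure IsoRegion)
        + ∫ u in (0 : ℝ)..t, coagGen hK.iso isoAdd Φ G (f' u) := fun t ht => by
    rw [← sub_eq_iff_eq_add', heq t ht.1]
    refine intervalIntegral.integral_congr fun u hu => ?_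
    rw [uIcc_of_le ht.1] at hu
    simp only [hff' u ⟨hu.1, hu.2.trans ht.2⟩]
    rfl
  rw [key t ht, key s hs, add_sub_add_left_eq_sub,
    intervalIntegral.integral_interval_sub_left (hcont.intervalIntegrable _ _)
      (hcont.intervalIntegrable _ _)]
  have hle : ∀ u, ‖coagGen hK.iso isoAdd Φ G (f' u)‖ ≤ (9 * B ^ 2 * (4 * K₀ ^ 2) + 1) * (C * C)
      + ((R * (2 * A) ^ (mu + 1) * D) ^ 2 + 1) * C := fun u =>
    hΩ.abs_coagGen_le (hfC' u) isoAdd (by positivity) hsq (by positivity) hΦ hG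
  exact intervalIntegral.norm_integral_le_of_norm_le_const fun u _ => hle u

theorem isWeakSolution_of_curve (hK : IsCoagKernel K K₀ K₁ al be)
    (hE : IsMomentExponents al be q p m) {r : ℝ × ℝ → ℝ} {ε : ℝ}
    (hρ : ∀ x : IsoRegion, 0 ≤ ε * r x.1) (hρc : Continuous fun x : IsoRegion => ε * r x.1)
    {R mu sg : ℝ} (hR : 0 ≤ R) (hmu : 0 ≤ mu)
    (hρR : ∀ x : IsoRegion, ε * r x.1 ≤ R * x.1.1 ^ mu * x.1.2 ^ sg) (hs1 : -q ≤ 2 * sg)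
    (hs2 : 2 * sg ≤ p) {f : ℝ → FiniteMeasure IsoRegion} (hf : Continuous f) {C : ℝ → ℝ≥0}
    (hfC : ∀ T, ∀ t ∈ Icc 0 T,
      f t ∈ momentSet (fun x : IsoRegion => topWeight al be q p m x.1) (C T))
    (heq : ∀ φ, IsQuadTest φ → ∀ t, 0 ≤ t →
        ∫ x : IsoRegion, φ x.1 ∂(f t : Measure IsoRegion)
          - ∫ x : IsoRegion, φ x.1 ∂(f 0 : Measure IsoRegion)
        = ∫ s in (0 : ℝ)..t, coagGen hK.iso isoAdd (fun x => φ x.1)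
            (fusionFlux (fun x => ε * r x.1) φ) (f s)) :
    IsWeakSolution K r ε al be (planeMeasure (f 0)) fun t => planeMeasure (f t) := by
  refine ⟨fun t _ => isIsoMeasure_planeMeasure _, fun φ hφ => ?_, fun T _ => ?_,
    fun ψ hψ t ht => weakIdentity_of_curve hK hE hρ hρc hR hmu hρR hs1 hs2 ht hf (hfC t) heq hψ⟩
  · obtain ⟨B, hB⟩ := hφ.exists_bound
    simp only [integral_planeMeasure]
    exact ((continuous_integral_iso hφ.1 hB).comp hf).continuousOn
  · refine ⟨ENNReal.ofReal 2 * C T, ENNReal.mul_ne_top ENNReal.ofReal_ne_top ENNReal.coe_ne_top,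
      fun t ht => ?_⟩
    rw [lintegral_planeMeasure]
    refine le_trans (lintegral_mono fun x => ?_) ((lintegral_const_mul' (ENNReal.ofReal 2)
      (fun x : IsoRegion => ENNReal.ofReal (topWeight al be q p m x.1))
      ENNReal.ofReal_ne_top).le.trans (mul_le_mul_right (hfC T t ht) _))
    rw [← ENNReal.ofReal_mul zero_le_two]
    refine ENNReal.ofReal_le_ofReal ?_
    have hx := isoRegion_subset_quad x.2
    have h1 := hE.al_pos
    have h2 := hE.al_lt
    have h3 := hE.be_pos
    have h4 := hE.be_lt
    have h5 := hE.two_le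
    have h6 := hE.m_le_p
    have h7 := hE.m_le_q
    have b1 := rpow_le_midWeight (al := al) (be := be) hx
      (show -q ≤ -al by linarith) (show -al ≤ p by linarith)
    have b2 := rpow_le_midWeight (al := al) (be := be) hx
      (show -q ≤ be by linarith) (show be ≤ p by linarith)
    have b3 := midWeight_le_topWeight (al := al) (be := be) (q := q) (p := p) (m := m) hx
    linarith

end Curves

/-- A measure with finite data moment comes from a finite measure on the isoperimetric region. -/
theorem exists_planeMeasure_eq {fin : Measure (ℝ × ℝ)} (hiso : IsIsoMeasure fin) {sg m : ℝ}
    (hm : 0 ≤ m) (hmom : ∫⁻ η, ENNReal.ofReal (dataWeight sg m η) ∂fin ≠ ⊤) :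
    ∃ μ : FiniteMeasure IsoRegion, planeMeasure μ = fin := by
  have hemb := MeasurableEmbedding.subtype_coe measurableSet_isoRegion
  have hae : ∀ᵐ η ∂fin, η ∈ IsoRegion := by
    rw [ae_iff]; exact hiso
  have hmap : (fin.comap (Subtype.val : IsoRegion → ℝ × ℝ)).map Subtype.val = fin := by
    rw [hemb.map_comap, Subtype.range_coe]
    exact Measure.restrict_eq_self_of_ae_mem hae
  have hfin : fin univ < ⊤ := by
    rw [← lintegral_one]
    refine lt_of_le_of_lt (lintegral_mono_ae ?_) hmom.lt_top
    filter_upwards [hae] with η hη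
    rw [← ENNReal.ofReal_one]
    exact ENNReal.ofReal_le_ofReal (one_le_dataWeight (isoRegion_subset_quad hη) hm)
  have : IsFiniteMeasure (fin.comap (Subtype.val : IsoRegion → ℝ × ℝ)) :=
    ⟨by rwa [← preimage_univ (f := (Subtype.val : IsoRegion → ℝ × ℝ)),
      ← Measure.map_apply hemb.measurable MeasurableSet.univ, hmap]⟩
  exact ⟨⟨_, this⟩, hmap⟩

/-- Compactness of curves of measures which are Lipschitz against test functions. -/
theorem exists_subseq_tendsto_of_lipschitz {Ω : IsoRegion → ℝ} (hΩ : IsProperWeight Ω) {C : ℝ≥0}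
    {T : ℝ} (hT : 0 ≤ T) {f : ℕ → ℝ → FiniteMeasure IsoRegion}
    (hfC : ∀ n, ∀ t ∈ Icc 0 T, f n t ∈ momentSet Ω C)
    (hL : ∀ φ, IsQuadTest φ → ∃ L : ℝ, ∀ n, ∀ s ∈ Icc 0 T, ∀ t ∈ Icc 0 T,
      |∫ x : IsoRegion, φ x.1 ∂(f n t : Measure IsoRegion)
        - ∫ x : IsoRegion, φ x.1 ∂(f n s : Measure IsoRegion)| ≤ L * |t - s|) :
    ∃ φ : ℕ → ℕ, StrictMono φ ∧ ∃ g : ℝ → FiniteMeasure IsoRegion, Continuous g ∧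
      ∀ t ∈ Icc 0 T, Tendsto (fun k => f (φ k) t) atTop (𝓝 (g t)) := by
  let P : ℝ → ℝ := fun t => max 0 (min t T)
  have hP : ∀ t, P t ∈ Icc 0 T := fun t => ⟨le_max_left _ _, max_le hT (min_le_right _ _)⟩
  have hPT : ∀ t ∈ Icc 0 T, P t = t := fun t ht => by
    simp only [P, min_eq_left ht.2, max_eq_right ht.1]
  have hP1 : ∀ s t, |P t - P s| ≤ |t - s| := fun s t => by
    have h1 := abs_max_sub_max_le_max 0 (min t T) 0 (min s T)
    have h2 := abs_min_sub_min_le_max t T s T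
    simp only [sub_self, abs_zero, abs_nonneg, sup_of_le_left, sup_of_le_right] at h1 h2
    exact h1.trans h2
  let ℓ : Finset ((ℚ × ℚ) × ℚ) × ℕ → FiniteMeasure IsoRegion → ℝ := fun i μ =>
    ∫ x : IsoRegion, quadSep i x.1 ∂(μ : Measure IsoRegion)
  have hℓ : ∀ i, Continuous (ℓ i) := fun i => by
    obtain ⟨B, -, hB⟩ := (isQuadTest_quadSep i).exists_bound
    exact continuous_integral_iso (isQuadTest_quadSep i).contDiff.continuous hB
  have hsep : ∀ μ ν, (∀ i, ℓ i μ = ℓ i ν) → μ = ν := fun μ ν h => eq_of_integral_quadSep_eq h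
  have hL' : ∀ i, ∃ L : ℝ≥0, ∀ n s t, |ℓ i (f n (P t)) - ℓ i (f n (P s))| ≤ L * |t - s| := by
    intro i
    obtain ⟨L, hL⟩ := hL _ (isQuadTest_quadSep i)
    refine ⟨L.toNNReal, fun n s t => (hL n _ (hP s) _ (hP t)).trans ?_⟩
    exact mul_le_mul (Real.le_coe_toNNReal L) (hP1 s t) (abs_nonneg _) L.toNNReal.2
  obtain ⟨φ, hφ, g, hg⟩ := exists_subseq_tendsto_of_equicontinuous hℓ hsep
    (S := fun _ => momentSet Ω C) (fun _ => hΩ.isCompact_momentSet C) (F := fun n t => f n (P t))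
    (fun n t => hfC n _ (hP t)) (by
      intro i t e he
      obtain ⟨L, hL⟩ := hL' i
      refine ⟨e / (L + 1), by positivity, fun s hs => Eventually.of_forall fun n => ?_⟩
      rw [lt_div_iff₀ (by positivity)] at hs
      nlinarith [hL n t s, abs_nonneg (s - t), L.2])
  refine ⟨φ, hφ, g, ?_, fun t ht => by simpa only [hPT t ht] using (hg t).2⟩
  refine continuous_iff_continuousAt.2 fun t => continuousAt_of_separating hℓ hsep
    (hΩ.isCompact_momentSet C) (Eventually.of_forall fun s => (hg s).1) fun i => ?_
  obtain ⟨L, hL⟩ := hL' i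
  refine (LipschitzWith.of_dist_le_mul fun s t => ?_ :
    LipschitzWith L fun s => ℓ i (g s)).continuous.continuousAt
  have h1 := fun s => ((hℓ i).tendsto (g s)).comp (hg s).2
  rw [Real.dist_eq, Real.dist_eq]
  exact le_of_tendsto ((h1 s).sub (h1 t)).abs (Eventually.of_forall fun n => hL _ t s)

/-- compactness in the negligible-fusion regime — existence of weak
solutions with fusion coefficient ε, uniform Lipschitz equicontinuity in time, and
weak-* convergence of a subsequence to a limit in C([0,T]; 𝓜^I₊). -/
theorem negligible_fusion_compactness
    (K : ℝ × ℝ → ℝ × ℝ → ℝ) (K₀ K₁ al be : ℝ) (hK : IsCoagKernel K K₀ K₁ al be)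
    (r : ℝ × ℝ → ℝ) (R₀ R₁ mu sg B : ℝ) (hr : IsFusionKernel r R₀ R₁ mu sg B)
    (hmu : 0 < mu)
    (fin : Measure (ℝ × ℝ)) (hfin_iso : IsIsoMeasure fin)
    (hfin_mom : (∫⁻ η : ℝ × ℝ, ENNReal.ofReal
        (η.2 ^ (-(mu + 2)) + η.2 ^ (mu + 2) + η.2 ^ (sg * (mu + 2)) + η.1 ^ (mu + 2))
        ∂fin) ≠ ⊤)
    (T : ℝ) (hT : 0 < T) :
    ∃ f : ℝ → ℝ → Measure (ℝ × ℝ),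
      -- weak solutions with fusion coefficient ε, uniform moment bounds
      (∀ ε ∈ Ioo (0 : ℝ) 1, IsWeakSolution K r ε al be fin (f ε)) ∧
      (∃ C : ℝ≥0∞, C ≠ ⊤ ∧ ∀ ε ∈ Ioo (0 : ℝ) 1, ∀ t ∈ Icc (0 : ℝ) T,
          (∫⁻ η : ℝ × ℝ, ENNReal.ofReal
            (η.2 ^ (-(mu + 2)) + η.2 ^ (mu + 2) + η.2 ^ (sg * (mu + 2)) + η.1 ^ (mu + 2))
            ∂(f ε t)) ≤ C) ∧
      -- uniform-in-ε Lipschitz equicontinuity in time against C¹_c test functions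
      (∀ φ : ℝ × ℝ → ℝ, ContDiff ℝ 1 φ → HasCompactSupport φ → tsupport φ ⊆ Quad →
        ∃ C > (0 : ℝ), ∀ Mφ Md : ℝ, (∀ p, |φ p| ≤ Mφ) → (∀ p, |da φ p| ≤ Md) →
          ∀ ε ∈ Ioo (0 : ℝ) 1, ∀ s ∈ Icc (0 : ℝ) T, ∀ t ∈ Icc (0 : ℝ) T,
            |(∫ η, φ η ∂(f ε t)) - (∫ η, φ η ∂(f ε s))|
              ≤ C * (Mφ + Md) * |t - s|) ∧
      -- weak-* convergence of a subsequence for every t ∈ [0,T]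
      (∃ es : ℕ → ℝ, (∀ n, es n ∈ Ioo (0 : ℝ) 1) ∧ Tendsto es atTop (𝓝 0) ∧
        ∃ fund : ℝ → Measure (ℝ × ℝ),
          (∀ t ∈ Icc (0 : ℝ) T, IsIsoMeasure (fund t)) ∧
          (∀ φ, IsC0Quad φ →
            ContinuousOn (fun t => ∫ η, φ η ∂(fund t)) (Icc (0 : ℝ) T)) ∧
          (∀ t ∈ Icc (0 : ℝ) T, ∀ φ, IsC0Quad φ →
            Tendsto (fun n => ∫ η, φ η ∂(f (es n) t)) atTop
              (𝓝 (∫ η, φ η ∂(fund t))))) := by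

  obtain ⟨μ₀, hμ₀⟩ : ∃ μ₀ : FiniteMeasure IsoRegion, planeMeasure μ₀ = fin :=
    exists_planeMeasure_eq hfin_iso (sg := sg) (m := mu + 2) (by linarith) hfin_mom
  set m := mu + 2 with hm_def
  have hm : 2 ≤ m := by linarith
  set q := max m (-(sg * m)) with hq_def
  set p := max m (sg * m) with hp_def
  have hE : IsMomentExponents al be q p m :=
    hK.isMomentExponents hm (le_max_left _ _) (le_max_left _ _)
  have hΩ := isProperWeight_topWeight hE
  have hs1 : -q ≤ 2 * sg := by
    have h1 := le_max_left m (-(sg * m))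
    have h2 := le_max_right m (-(sg * m))
    rcases le_total 0 sg with h | h
    · linarith
    · nlinarith
  have hs2 : 2 * sg ≤ p := by
    have h1 := le_max_left m (sg * m)
    have h2 := le_max_right m (sg * m)
    rcases le_total 0 sg with h | h
    · nlinarith
    · linarith
  have hrc : Continuous fun x : IsoRegion => r x.1 :=
    hr.smooth.continuousOn.comp_continuous continuous_subtype_val
      fun x => isoRegion_subset_quad x.2
  have hρ : ∀ ε ∈ Ioo (0 : ℝ) 1, ∀ x : IsoRegion, 0 ≤ ε * r x.1 := fun ε hε x =>
    mul_nonneg hε.1.le (hr.pos _ (isoRegion_subset_quad x.2)).le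
  have hρc : ∀ ε : ℝ, Continuous fun x : IsoRegion => ε * r x.1 := fun ε => hrc.const_mul ε
  have hρR : ∀ ε ∈ Ioo (0 : ℝ) 1, ∀ x : IsoRegion,
      ε * r x.1 ≤ R₁ * x.1.1 ^ mu * x.1.2 ^ sg := fun ε hε x =>
    (mul_le_of_le_one_left (hr.pos _ (isoRegion_subset_quad x.2)).le hε.2.le).trans
      (hr.upper _ (isoRegion_subset_quad x.2))
  have hal' : al < 1 := hE.al_lt
  have htop : ∫⁻ x : IsoRegion, ENNReal.ofReal (topWeight al be q p m x.1)
      ∂(μ₀ : Measure IsoRegion) ≠ ⊤ := by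
    refine ne_top_of_le_ne_top (ENNReal.mul_ne_top (ENNReal.ofReal_ne_top (r := 10)) hfin_mom) ?_
    rw [← lintegral_const_mul' _ _ ENNReal.ofReal_ne_top, ← hμ₀, lintegral_planeMeasure]
    refine lintegral_mono fun x => ?_
    rw [← ENNReal.ofReal_mul (by norm_num)]
    exact ENNReal.ofReal_le_ofReal (topWeight_le_dataWeight (isoRegion_subset_quad x.2) hm
      hK.al_pos hal' hE.be_pos hE.be_lt)
  obtain ⟨X, hX, hX₀⟩ : ∃ X : ℝ, 0 ≤ X ∧ ∫⁻ x : IsoRegion, ENNReal.ofReal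
      (topWeight al be q p m x.1) ∂(μ₀ : Measure IsoRegion) ≤ ENNReal.ofReal X :=
    ⟨_, ENNReal.toReal_nonneg, (ENNReal.ofReal_toReal htop).ge⟩
  choose! F hFc hF0 hFm hFeq using fun (ε : ℝ) (hε : ε ∈ Ioo (0 : ℝ) 1) =>
    exists_fusion_curve hK hE (hρ ε hε) (hρc ε) hr.R1_pos.le hmu.le (hρR ε hε) hs1 hs2 μ₀ hX hX₀
  have hG0 : 0 ≤ growthConst K₀ p m :=
    growthConst_nonneg (hK.K1_pos.le.trans hK.K1_le_K0) (by linarith [hE.m_le_p]) (by linarith)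
  set C : ℝ → ℝ≥0 := momentBound (growthConst K₀ p m) X with hC_def
  have hFC : ∀ ε ∈ Ioo (0 : ℝ) 1, ∀ T, ∀ t ∈ Icc 0 T,
      F ε t ∈ momentSet (fun x : IsoRegion => topWeight al be q p m x.1) (C T) :=
    fun ε hε T t ht => momentSet_mono _ (momentBound_mono hG0 hX ht.1 ht.2) (hFm ε hε t ht.1)
  have hFeq' : ∀ ε ∈ Ioo (0 : ℝ) 1, ∀ φ, IsQuadTest φ → ∀ t, 0 ≤ t →
      ∫ x : IsoRegion, φ x.1 ∂(F ε t : Measure IsoRegion)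
        - ∫ x : IsoRegion, φ x.1 ∂(F ε 0 : Measure IsoRegion)
      = ∫ s in (0 : ℝ)..t, coagGen hK.iso isoAdd (fun x => φ x.1)
          (fusionFlux (fun x => ε * r x.1) φ) (F ε s) := fun ε hε φ hφ t ht => by
    rw [hF0 ε hε]
    exact hFeq ε hε φ hφ t ht
  have hlip : ∀ φ, IsQuadTest φ → ∀ {A B D : ℝ}, 0 < A → (∀ p : ℝ × ℝ, A < p.1 → da φ p = 0) →
      (∀ p, |φ p| ≤ B) → (∀ p, |da φ p| ≤ D) → ∀ ε ∈ Ioo (0 : ℝ) 1, ∀ s ∈ Icc 0 T, ∀ t ∈ Icc 0 T,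
      |∫ x : IsoRegion, φ x.1 ∂(F ε t : Measure IsoRegion)
        - ∫ x : IsoRegion, φ x.1 ∂(F ε s : Measure IsoRegion)|
      ≤ ((9 * B ^ 2 * (4 * K₀ ^ 2) + 1) * (C T * C T)
        + ((R₁ * (2 * A) ^ (mu + 1) * D) ^ 2 + 1) * C T) * |t - s| :=
    fun φ hφ A B D hA0 hA hB hD ε hε s hs t ht =>
      abs_integral_sub_le_of_curve hK hE (hρ ε hε) (hρc ε) hr.R1_pos.le hmu.le (hρR ε hε) hs1 hs2
        (hFc ε hε) (hFC ε hε T) hφ (hFeq' ε hε φ hφ) hA0 hA hB hD hs ht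
  refine ⟨fun ε t => planeMeasure (F ε t), fun ε hε => ?_, ?_, fun φ h1 h2 h3 => ?_, ?_⟩
  · have := isWeakSolution_of_curve hK hE (hρ ε hε) (hρc ε) hr.R1_pos.le hmu.le (hρR ε hε) hs1 hs2
      (hFc ε hε) (hFC ε hε) (hFeq' ε hε)
    rwa [hF0 ε hε, hμ₀] at this
  · refine ⟨ENNReal.ofReal 4 * C T, ENNReal.mul_ne_top ENNReal.ofReal_ne_top ENNReal.coe_ne_top,
      fun ε hε t ht => ?_⟩
    rw [lintegral_planeMeasure]
    refine le_trans (lintegral_mono fun x => ?_) ((lintegral_const_mul' (ENNReal.ofReal 4)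
      (fun x : IsoRegion => ENNReal.ofReal (topWeight al be q p m x.1))
      ENNReal.ofReal_ne_top).le.trans (mul_le_mul_right (hFC ε hε T t ht) _))
    rw [← ENNReal.ofReal_mul (by norm_num)]
    exact ENNReal.ofReal_le_ofReal
      (dataWeight_le_topWeight (isoRegion_subset_quad x.2) (by linarith))
  · have hφ : IsQuadTest φ := ⟨h1, h2, fun p hp =>
      image_eq_zero_of_notMem_tsupport fun h => hp (h3 h)⟩
    obtain ⟨A, hA0, hA⟩ := hφ.exists_area_bound
    refine ⟨(9 * 1 ^ 2 * (4 * K₀ ^ 2) + 1) * (C T * C T)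
        + ((R₁ * (2 * A) ^ (mu + 1) * 1) ^ 2 + 1) * C T + 1, by positivity,
      fun Mφ Md hMφ hMd ε hε s hs t ht => ?_⟩
    simp only [integral_planeMeasure]
    have hN1 : 0 ≤ Mφ := (abs_nonneg _).trans (hMφ 0)
    have hN2 : 0 ≤ Md := (abs_nonneg _).trans (hMd 0)
    rcases (add_nonneg hN1 hN2).eq_or_lt with h0 | hN
    · have hz : ∀ p, φ p = 0 := fun p => abs_eq_zero.1 (le_antisymm ((hMφ p).trans (by linarith))
        (abs_nonneg _))
      simp [hz, ← h0]
    · set N := Mφ + Md with hN_def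
      have hda : ∀ p, da (fun p => N⁻¹ * φ p) p = N⁻¹ * da φ p := fun p =>
        ((hasDerivAt_da h1 p).const_mul N⁻¹).deriv
      have hφ' : IsQuadTest fun p => N⁻¹ * φ p :=
        ⟨contDiff_const.mul h1, h2.mul_left, fun p hp => by simp [hφ.eq_zero p hp]⟩
      have := hlip _ hφ' (B := 1) (D := 1) hA0 (fun p hp => by rw [hda, hA p hp, mul_zero])
        (fun p => by
          rw [abs_mul, abs_inv, abs_of_pos hN, inv_mul_le_one₀ hN]
          linarith [hMφ p])
        (fun p => by
          rw [hda, abs_mul, abs_inv, abs_of_pos hN, inv_mul_le_one₀ hN]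
          linarith [hMd p]) ε hε s hs t ht
      rw [integral_const_mul, integral_const_mul, ← mul_sub, abs_mul, abs_inv, abs_of_pos hN,
        inv_mul_le_iff₀ hN] at this
      refine this.trans ?_
      rw [← mul_assoc, mul_comm N]
      exact mul_le_mul_of_nonneg_right (mul_le_mul_of_nonneg_right (by linarith) hN.le)
        (abs_nonneg _)
  · let es : ℕ → ℝ := fun n => 1 / ((n : ℝ) + 2)
    have hes : ∀ n, es n ∈ Ioo (0 : ℝ) 1 := fun n => ⟨by positivity, by
      rw [div_lt_one (by positivity)]
      have : (0 : ℝ) ≤ n := n.cast_nonneg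
      linarith⟩
    have hlim : Tendsto es atTop (𝓝 0) := by
      have := tendsto_one_div_add_atTop_nhds_zero_nat (𝕜 := ℝ) |>.comp (tendsto_add_atTop_nat 1)
      refine this.congr fun n => ?_
      simp only [Function.comp_apply, es]
      push_cast
      ring
    obtain ⟨φ, hφ, g, hgc, hg⟩ := exists_subseq_tendsto_of_lipschitz hΩ hT.le
      (f := fun n => F (es n)) (fun n => hFC _ (hes n) T) (fun φ hφ => by
        obtain ⟨A, hA0, hA⟩ := hφ.exists_area_bound
        obtain ⟨B, -, hB⟩ := hφ.exists_bound
        obtain ⟨D, -, hD⟩ := hφ.exists_da_bound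
        exact ⟨_, fun n s hs t ht => hlip φ hφ hA0 hA hB hD _ (hes n) s hs t ht⟩)
    refine ⟨es ∘ φ, fun n => hes _, hlim.comp hφ.tendsto_atTop, fun t => planeMeasure (g t),
      fun t _ => isIsoMeasure_planeMeasure _, fun θ hθ => ?_, fun t ht θ hθ => ?_⟩
    all_goals
      obtain ⟨B, hB⟩ := hθ.exists_bound
      simp only [integral_planeMeasure]
    · exact ((continuous_integral_iso hθ.1 hB).comp hgc).continuousOn
    · exact ((continuous_integral_iso hθ.1 hB).tendsto (g t)).comp (hg t ht)
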